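/- Let (v,p) be a suitable weak solution of the Navier–Stokes equations in Q_T = Ω×(0,T), let z₀ = (x₀,t₀) ∈ Q_T and r > 0 be such that the closure of Q_{z₀,r} is contained in Q_T, and let ω = curl v be the vorticity of v. If there exist γ ∈ (3,∞] and α ∈ [2,∞) with 3/γ + 2/α ≤ 1 such that v × (ω/|ω|) ∈ L^{γ,α}_{x,t}(Q_{z₀,r}), then z₀ is a regular point of v. -/

import Mathlib

open MeasureTheory Set Filter ENNReal

noncomputable section

/-- Euclidean 3-space. -/
abbrev E3 := EuclideanSpace ℝ (Fin 3)

/-- The parabolic cylinder `Q_{z,r} = B_{x,r} × (t - r², t)`. -/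
def pcyl (z : E3 × ℝ) (r : ℝ) : Set (E3 × ℝ) :=
  (Metric.ball z.1 r) ×ˢ (Ioo (z.2 - r ^ 2) z.2)

/-- The mixed space-time norm `‖f‖_{L^{γ,α}_{x,t}(B × (a,b))}`,
with the essential-supremum modification when an exponent is `∞`. -/
def mixedNorm {F : Type*} [NormedAddCommGroup F]
    (f : E3 × ℝ → F) (B : Set E3) (a b : ℝ) (γ α : ℝ≥0∞) : ℝ≥0∞ :=
  if α = ∞ then
    essSup (fun t => eLpNorm (fun x => f (x, t)) γ (volume.restrict B))
      (volume.restrict (Ioo a b))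
  else
    (∫⁻ t in Ioo a b,
      (eLpNorm (fun x => f (x, t)) γ (volume.restrict B)) ^ α.toReal) ^ (1 / α.toReal)

/-- `f ∈ L^{γ,α}_{x,t}(B × (a,b))`. -/
def MemMixed {F : Type*} [NormedAddCommGroup F]
    (f : E3 × ℝ → F) (B : Set E3) (a b : ℝ) (γ α : ℝ≥0∞) : Prop :=
  mixedNorm f B a b γ α < ∞

/-- Vector in `ℝ³` from coordinates. -/
def vec3 (a b c : ℝ) : E3 := (WithLp.equiv 2 (Fin 3 → ℝ)).symm ![a, b, c]

/-- Cross product in `ℝ³`. -/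
def cross3 (u w : E3) : E3 :=
  vec3 (u 1 * w 2 - u 2 * w 1) (u 2 * w 0 - u 0 * w 2) (u 0 * w 1 - u 1 * w 0)

/-- The unit direction `w/|w|`, interpreted as `0` when `w = 0`. -/
def unitd (w : E3) : E3 := ‖w‖⁻¹ • w

/-- Spatial partial derivative (in direction `i`) of a function on space-time. -/
def sdz {F : Type*} [NormedAddCommGroup F] [NormedSpace ℝ F]
    (φ : E3 × ℝ → F) (i : Fin 3) (z : E3 × ℝ) : F :=
  fderiv ℝ φ z (EuclideanSpace.single i 1, 0)

/-- Time derivative of a function on space-time. -/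
def tdz {F : Type*} [NormedAddCommGroup F] [NormedSpace ℝ F]
    (φ : E3 × ℝ → F) (z : E3 × ℝ) : F :=
  fderiv ℝ φ z (0, 1)

/-- The vorticity `ω = curl v` built from the (weak) velocity gradient
`Dv`, where `Dv z j i` represents `∂_j v_i (z)`. -/
def curlOf (Dv : E3 × ℝ → Fin 3 → Fin 3 → ℝ) (z : E3 × ℝ) : E3 :=
  vec3 (Dv z 1 2 - Dv z 2 1) (Dv z 2 0 - Dv z 0 2) (Dv z 0 1 - Dv z 1 0)

/-- A `3×3` matrix regarded as a Euclidean vector (so that its norm is the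
Frobenius norm). -/
def frob (M : Fin 3 → Fin 3 → ℝ) : EuclideanSpace ℝ (Fin 3 × Fin 3) :=
  (WithLp.equiv 2 (Fin 3 × Fin 3 → ℝ)).symm fun q => M q.1 q.2

/-- `(v, p)` is a suitable weak solution of the Navier–Stokes equations on
`Q_T = Ω × (0,T)`, with weak spatial gradient `Dv` (`Dv z j i = ∂_j v_i (z)`)
and initial data `v₀`. -/
structure IsSuitableWeakSolution (Ω : Set E3) (T : ℝ) (v : E3 × ℝ → E3)
    (Dv : E3 × ℝ → Fin 3 → Fin 3 → ℝ) (p : E3 × ℝ → ℝ) (v₀ : E3 → E3) : Prop where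
  meas_v : Measurable v
  meas_Dv : Measurable Dv
  meas_p : Measurable p
  /-- `Dv` is the weak spatial gradient of `v`. -/
  weak_grad : ∀ ψ : E3 → ℝ, ContDiff ℝ (⊤ : ℕ∞) ψ → HasCompactSupport ψ → tsupport ψ ⊆ Ω →
    ∀ᵐ t ∂(volume.restrict (Ioo 0 T)), ∀ i j : Fin 3,
      ∫ x in Ω, v (x, t) j * fderiv ℝ ψ x (EuclideanSpace.single i 1) =
        - ∫ x in Ω, Dv (x, t) i j * ψ x
  /-- `v ∈ L^∞(0,T;L²(Ω))`. -/
  v_linf_l2 : MemMixed v Ω 0 T 2 ∞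
  /-- `v ∈ L²(0,T;W^{1,2}(Ω))`. -/
  v_l2_w12 : IntegrableOn (fun z => ‖v z‖ ^ 2 + ∑ i, ∑ j, (Dv z i j) ^ 2) (Ω ×ˢ Ioo 0 T)
  /-- `p ∈ L^{3/2}(Q_T)`. -/
  p_l32 : IntegrableOn (fun z => |p z| ^ (3 / 2 : ℝ)) (Ω ×ˢ Ioo 0 T)
  /-- The weak form of the Navier–Stokes equations. -/
  weak_nse : ∀ φ : E3 × ℝ → E3, ContDiff ℝ (⊤ : ℕ∞) φ → HasCompactSupport φ →
    tsupport φ ⊆ Ω ×ˢ Iio T →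
    ∫ z in Ω ×ˢ Ioo 0 T,
        (-(∑ i, v z i * tdz φ z i) + (∑ i, ∑ j, v z j * Dv z j i * φ z i)
          + (∑ i, ∑ j, Dv z j i * sdz φ j z i) - p z * ∑ i, sdz φ i z i)
      = ∫ x in Ω, ∑ i, v₀ x i * φ (x, 0) i
  /-- `div v = 0` weakly. -/
  div_free : ∀ ψ : E3 × ℝ → ℝ, ContDiff ℝ (⊤ : ℕ∞) ψ → HasCompactSupport ψ →
    tsupport ψ ⊆ Ω ×ˢ Ioo 0 T →
    ∫ z in Ω ×ˢ Ioo 0 T, ∑ i, v z i * sdz ψ i z = 0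
  /-- The local energy inequality. -/
  local_energy : ∀ᵐ t ∂(volume.restrict (Ioo 0 T)), ∀ φ : E3 × ℝ → ℝ,
    ContDiff ℝ (⊤ : ℕ∞) φ → HasCompactSupport φ → tsupport φ ⊆ Ω ×ˢ Ioo 0 T → (∀ z, 0 ≤ φ z) →
    (∫ x in Ω, ‖v (x, t)‖ ^ 2 * φ (x, t))
        + 2 * ∫ z in Ω ×ˢ Ioo 0 t, (∑ i, ∑ j, (Dv z i j) ^ 2) * φ z
      ≤ ∫ z in Ω ×ˢ Ioo 0 t,
          (‖v z‖ ^ 2 * (tdz φ z + ∑ i, sdz (fun w => sdz φ i w) i z)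
            + (‖v z‖ ^ 2 + 2 * p z) * ∑ i, v z i * sdz φ i z)

/-- `z` is a regular point of `v`: `v` is essentially bounded on some parabolic
cylinder `Q_{z,r} ⊆ Q_T`. -/
def RegularPoint (Ω : Set E3) (T : ℝ) (v : E3 × ℝ → E3) (z : E3 × ℝ) : Prop :=
  ∃ r > 0, pcyl z r ⊆ Ω ×ˢ Ioo 0 T ∧
    ∃ M : ℝ, ∀ᵐ w ∂(volume.restrict (pcyl z r)), ‖v w‖ ≤ M

/-- `z` is a singular point of `v` in `Q_T`. -/
def SingularPoint (Ω : Set E3) (T : ℝ) (v : E3 × ℝ → E3) (z : E3 × ℝ) : Prop :=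
  z ∈ Ω ×ˢ Ioo 0 T ∧ ¬ RegularPoint Ω T v z


/-- smooth compactly supported test functions -/
def Tst (φ : E3 × ℝ → ℝ) : Prop := ContDiff ℝ (⊤ : ℕ∞) φ ∧ HasCompactSupport φ

abbrev Smo (φ : E3 × ℝ → ℝ) : Prop := ContDiff ℝ (⊤ : ℕ∞) φ

lemma Smo.fd {φ : E3 × ℝ → ℝ} (h : Smo φ) (e : E3 × ℝ) : Smo (fun z => fderiv ℝ φ z e) :=
  (h.fderiv_right (m := (⊤ : ℕ∞)) (by simp)).clm_apply contDiff_const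

lemma Smo.sdz {φ : E3 × ℝ → ℝ} (h : Smo φ) (i : Fin 3) : Smo (sdz φ i) := h.fd _
lemma Smo.tdz {φ : E3 × ℝ → ℝ} (h : Smo φ) : Smo (tdz φ) := h.fd _

lemma Smo.da {φ : E3 × ℝ → ℝ} (h : Smo φ) (z : E3 × ℝ) : DifferentiableAt ℝ φ z :=
  (h.differentiable (by simp)) z

lemma Tst.sdz {φ : E3 × ℝ → ℝ} (h : Tst φ) (i : Fin 3) : Tst (sdz φ i) :=
  ⟨Smo.sdz h.1 i, h.2.fderiv_apply ℝ _⟩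
lemma Tst.tdz {φ : E3 × ℝ → ℝ} (h : Tst φ) : Tst (tdz φ) :=
  ⟨Smo.tdz h.1, h.2.fderiv_apply ℝ _⟩

lemma Tst.smul {φ η : E3 × ℝ → ℝ} (h : Tst φ) (hη : Smo η) : Tst (fun z => η z * φ z) :=
  ⟨hη.mul h.1, h.2.mul_left⟩
lemma Tst.mul {φ η : E3 × ℝ → ℝ} (h : Tst φ) (hη : Tst η) : Tst (fun z => η z * φ z) :=
  h.smul hη.1
lemma Tst.add {φ η : E3 × ℝ → ℝ} (h : Tst φ) (hη : Tst η) : Tst (fun z => φ z + η z) :=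
  ⟨h.1.add hη.1, h.2.add hη.2⟩
lemma Tst.neg {φ : E3 × ℝ → ℝ} (h : Tst φ) : Tst (fun z => - φ z) :=
  ⟨h.1.neg, h.2.neg⟩
lemma Tst.sub {φ η : E3 × ℝ → ℝ} (h : Tst φ) (hη : Tst η) : Tst (fun z => φ z - η z) := by
  simpa [sub_eq_add_neg] using h.add hη.neg
lemma Tst.const_mul {φ : E3 × ℝ → ℝ} (c : ℝ) (h : Tst φ) : Tst (fun z => c * φ z) :=
  h.smul contDiff_const
lemma Tst.zero : Tst (fun _ => 0) := ⟨contDiff_const, HasCompactSupport.zero⟩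
lemma Tst.sum {ι : Type*} (s : Finset ι) {φ : ι → E3 × ℝ → ℝ} (h : ∀ i, Tst (φ i)) :
    Tst (fun z => ∑ i ∈ s, φ i z) := by
  classical
  induction s using Finset.induction_on with
  | empty => simpa using Tst.zero
  | insert a s ha ih => simpa [Finset.sum_insert ha] using (h a).add ih

lemma Tst.cont {φ : E3 × ℝ → ℝ} (h : Tst φ) : Continuous φ := h.1.continuous
lemma Tst.integrable {φ : E3 × ℝ → ℝ} (h : Tst φ) : Integrable φ :=
  h.cont.integrable_of_hasCompactSupport h.2
lemma Tst.memLp {φ : E3 × ℝ → ℝ} (h : Tst φ) (p : ℝ≥0∞) : MemLp φ p :=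
  h.cont.memLp_of_hasCompactSupport h.2
lemma Tst.bdd {φ : E3 × ℝ → ℝ} (h : Tst φ) : ∃ C, 0 ≤ C ∧ ∀ z, |φ z| ≤ C := by
  obtain ⟨C, hC⟩ := h.cont.bounded_above_of_compact_support h.2
  exact ⟨C, (norm_nonneg _).trans (hC 0), hC⟩

lemma tsupport_fd (φ : E3 × ℝ → ℝ) (e : E3 × ℝ) :
    tsupport (fun z => fderiv ℝ φ z e) ⊆ tsupport φ := by
  refine closure_minimal (fun z hz => ?_) (isClosed_tsupport _)
  by_contra hc
  apply hz
  have : fderiv ℝ φ z = 0 := by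
    by_contra h2
    exact hc (support_fderiv_subset ℝ (f := φ) h2)
  simp [this]
lemma tsupport_sdz (φ : E3 × ℝ → ℝ) (i) : tsupport (sdz φ i) ⊆ tsupport φ := tsupport_fd φ _
lemma tsupport_tdz (φ : E3 × ℝ → ℝ) : tsupport (tdz φ) ⊆ tsupport φ := tsupport_fd φ _

lemma sdz_mul {f g : E3 × ℝ → ℝ} (hf : Smo f) (hg : Smo g) (i : Fin 3) (z) :
    sdz (fun z => f z * g z) i z = sdz f i z * g z + f z * sdz g i z := by
  unfold _root_.sdz
  have := fderiv_mul (hf.da z) (hg.da z)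
  change fderiv ℝ (f * g) z _ = _
  rw [this]; simp; ring
lemma tdz_mul {f g : E3 × ℝ → ℝ} (hf : Smo f) (hg : Smo g) (z) :
    tdz (fun z => f z * g z) z = tdz f z * g z + f z * tdz g z := by
  unfold _root_.tdz
  have := fderiv_mul (hf.da z) (hg.da z)
  change fderiv ℝ (f * g) z _ = _
  rw [this]; simp; ring
lemma sdz_add {f g : E3 × ℝ → ℝ} (hf : Smo f) (hg : Smo g) (i : Fin 3) (z) :
    sdz (fun z => f z + g z) i z = sdz f i z + sdz g i z := by
  unfold _root_.sdz
  rw [fderiv_fun_add (hf.da z) (hg.da z)]; simp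
lemma tdz_add {f g : E3 × ℝ → ℝ} (hf : Smo f) (hg : Smo g) (z) :
    tdz (fun z => f z + g z) z = tdz f z + tdz g z := by
  unfold _root_.tdz
  rw [fderiv_fun_add (hf.da z) (hg.da z)]; simp
lemma sdz_cmul {g : E3 × ℝ → ℝ} (c : ℝ) (hg : Smo g) (i : Fin 3) (z) :
    sdz (fun z => c * g z) i z = c * sdz g i z := by
  unfold _root_.sdz
  rw [fderiv_const_mul (hg.da z)]; simp
lemma tdz_cmul {g : E3 × ℝ → ℝ} (c : ℝ) (hg : Smo g) (z) :
    tdz (fun z => c * g z) z = c * tdz g z := by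
  unfold _root_.tdz
  rw [fderiv_const_mul (hg.da z)]; simp

lemma fd_comm {φ : E3 × ℝ → ℝ} (h : Smo φ) (e e' z : E3 × ℝ) :
    fderiv ℝ (fun w => fderiv ℝ φ w e) z e' = fderiv ℝ (fun w => fderiv ℝ φ w e') z e := by
  have h1 : DifferentiableAt ℝ (fderiv ℝ φ) z :=
    ((h.fderiv_right (m := (⊤ : ℕ∞)) (by simp)).differentiable (by simp)) z
  have h2 : IsSymmSndFDerivAt ℝ φ z :=
    (h.contDiffAt (x := z)).isSymmSndFDerivAt (by simp; exact WithTop.coe_le_coe.2 (le_top : (2 : ℕ∞) ≤ ⊤))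
  have key : ∀ a b, fderiv ℝ (fun w => fderiv ℝ φ w a) z b = fderiv ℝ (fderiv ℝ φ) z b a := by
    intro a b
    rw [fderiv_clm_apply h1 (by fun_prop)]
    simp
  rw [key, key]
  exact h2 _ _
lemma sdz_comm {φ : E3 × ℝ → ℝ} (h : Smo φ) (i j : Fin 3) : sdz (sdz φ i) j = sdz (sdz φ j) i :=
  funext fun z => fd_comm h _ _ z
lemma sdz_tdz {φ : E3 × ℝ → ℝ} (h : Smo φ) (i : Fin 3) : sdz (tdz φ) i = tdz (sdz φ i) :=
  funext fun z => fd_comm h _ _ z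

lemma sdz_slice {φ : E3 × ℝ → ℝ} (h : Smo φ) (i : Fin 3) (x : E3) (t : ℝ) :
    fderiv ℝ (fun y => φ (y, t)) x (EuclideanSpace.single i 1) = sdz φ i (x, t) := by
  have : HasFDerivAt (fun y : E3 => (y, t)) (ContinuousLinearMap.inl ℝ E3 ℝ) x :=
    (hasFDerivAt_id x).prodMk (hasFDerivAt_const t x)
  have h2 := (h.da (x, t)).hasFDerivAt.comp x this
  have h3 : fderiv ℝ (fun y => φ (y, t)) x = _ := h2.fderiv
  rw [h3]; simp [_root_.sdz]

lemma tdz_slice {φ : E3 × ℝ → ℝ} (h : Smo φ) (x : E3) (t : ℝ) :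
    HasDerivAt (fun s => φ (x, s)) (tdz φ (x, t)) t := by
  have : HasDerivAt (fun s : ℝ => (x, s)) ((0 : E3), (1 : ℝ)) t :=
    (hasDerivAt_const t x).prodMk (hasDerivAt_id t)
  exact (h.da (x, t)).hasFDerivAt.comp_hasDerivAt t this

lemma Tst.slice_cs {φ : E3 × ℝ → ℝ} (h : Tst φ) (t : ℝ) : HasCompactSupport (fun x => φ (x, t)) := by
  apply HasCompactSupport.intro (h.2.isCompact.image continuous_fst)
  intro x hx
  by_contra hc
  exact hx ⟨(x, t), subset_tsupport _ hc, rfl⟩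
lemma Smo.slice {φ : E3 × ℝ → ℝ} (h : Smo φ) (t : ℝ) : ContDiff ℝ (⊤ : ℕ∞) (fun x => φ (x, t)) :=
  h.comp (contDiff_id.prodMk contDiff_const)
lemma Tst.slice_int {φ : E3 × ℝ → ℝ} (h : Tst φ) (t : ℝ) : Integrable (fun x => φ (x, t)) :=
  (Smo.slice h.1 t).continuous.integrable_of_hasCompactSupport (h.slice_cs t)

lemma slab_swap {f : E3 × ℝ → ℝ} (hf : Integrable f) (S : Set ℝ) :
    ∫ z in (univ : Set E3) ×ˢ S, f z = ∫ t in S, ∫ x, f (x, t) := by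
  have : (volume : Measure (E3 × ℝ)).restrict ((univ : Set E3) ×ˢ S)
      = (volume : Measure E3).prod (volume.restrict S) := by
    rw [Measure.volume_eq_prod, ← Measure.prod_restrict]; simp
  rw [this, integral_prod_symm]
  rw [← this]; exact hf.integrableOn
lemma slab_swap' {f : E3 × ℝ → ℝ} (hf : Integrable f) (S : Set ℝ) :
    ∫ z in (univ : Set E3) ×ˢ S, f z = ∫ x, ∫ t in S, f (x, t) := by
  have : (volume : Measure (E3 × ℝ)).restrict ((univ : Set E3) ×ˢ S)
      = (volume : Measure E3).prod (volume.restrict S) := by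
    rw [Measure.volume_eq_prod, ← Measure.prod_restrict]; simp
  rw [this, integral_prod]
  rw [← this]; exact hf.integrableOn

/-- the operator `-κ∂ₜ - Δ + 1` -/
def Lop (κ : ℝ) (φ : E3 × ℝ → ℝ) (z : E3 × ℝ) : ℝ :=
  - κ * tdz φ z - (∑ i, sdz (sdz φ i) i z) + φ z

lemma Tst.Lop {φ : E3 × ℝ → ℝ} (h : Tst φ) (κ : ℝ) : Tst (Lop κ φ) :=
  (((h.tdz).const_mul (-κ)).sub (Tst.sum _ fun i => (h.sdz i).sdz i)).add h

instance instHaarX : (volume : Measure (E3 × ℝ)).IsAddHaarMeasure := by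
  rw [Measure.volume_eq_prod]; infer_instance

/-- parameter measure -/
def nuM : Measure (ℝ × E3) := ((volume : Measure ℝ).restrict (Ioi 0)).prod volume
instance : SFinite nuM := by unfold nuM; infer_instance

/-- parabolic shift -/
def shf (κ : ℝ) (a : ℝ × E3) : E3 × ℝ := ((2 * a.1) • a.2, κ * a.1 ^ 2)
lemma shf_cont (κ : ℝ) : Continuous (shf κ) := by unfold shf; fun_prop

/-- averaging operator -/
def SK (κ : ℝ) (K : ℝ × E3 → ℝ) (F : E3 × ℝ → ℝ) (z : E3 × ℝ) : ℝ :=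
  ∫ a, K a * F (z + shf κ a) ∂nuM

section
variable {κ : ℝ} {K : ℝ × E3 → ℝ} {F : E3 × ℝ → ℝ}

lemma SK_intg (hK : Integrable K nuM) (hF : Tst F) (z) :
    Integrable (fun a => K a * F (z + shf κ a)) nuM := by
  obtain ⟨C, hC, hb⟩ := hF.bdd
  refine hK.mul_bdd (c := C) ?_ (ae_of_all _ fun a => hb _)
  exact (hF.cont.comp ((continuous_const).add (shf_cont κ))).aestronglyMeasurable

lemma SK_hasF (hK : Integrable K nuM) (hF : Tst F) (z) :
    HasFDerivAt (SK κ K F) (∫ a, K a • fderiv ℝ F (z + shf κ a) ∂nuM) z ∧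
      Integrable (fun a => K a • fderiv ℝ F (z + shf κ a)) nuM := by
  have hc : Continuous (fderiv ℝ F) := hF.1.continuous_fderiv (by simp)
  obtain ⟨C, hC⟩ := hc.bounded_above_of_compact_support (hF.2.fderiv ℝ)
  have hm : ∀ z, AEStronglyMeasurable (fun a => fderiv ℝ F (z + shf κ a)) nuM := fun z =>
    (hc.comp ((continuous_const).add (shf_cont κ))).aestronglyMeasurable
  have hi : Integrable (fun a => K a • fderiv ℝ F (z + shf κ a)) nuM := by
    refine (hK.norm.mul_const C).mono' (hK.1.smul (hm z)) (ae_of_all _ fun a => ?_)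
    rw [norm_smul]
    exact mul_le_mul_of_nonneg_left (hC _) (norm_nonneg _)
  refine ⟨?_, hi⟩
  refine hasFDerivAt_integral_of_dominated_of_fderiv_le (s := univ) (bound := fun a => ‖K a‖ * C)
    (F' := fun z a => K a • fderiv ℝ F (z + shf κ a))
    univ_mem (Eventually.of_forall fun z => (SK_intg hK hF z).1) (SK_intg hK hF z)
    hi.1 (ae_of_all _ fun a x _ => ?_) (hK.norm.mul_const C) (ae_of_all _ fun a x _ => ?_)
  · rw [norm_smul]
    exact mul_le_mul_of_nonneg_left (hC _) (norm_nonneg _)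
  · have h1 : HasFDerivAt (fun x => x + shf κ a) (ContinuousLinearMap.id ℝ (E3 × ℝ)) x :=
      (hasFDerivAt_id x).add_const _
    have h2 : HasFDerivAt F (fderiv ℝ F (x + shf κ a)) (x + shf κ a) :=
      (Smo.da hF.1 _).hasFDerivAt
    have h3 := (h2.comp x h1).const_mul (K a)
    simpa using h3

lemma SK_fderiv (hK : Integrable K nuM) (hF : Tst F) (z e : E3 × ℝ) :
    fderiv ℝ (SK κ K F) z e = SK κ K (fun w => fderiv ℝ F w e) z := by
  obtain ⟨h, hi⟩ := SK_hasF (κ := κ) hK hF z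
  rw [h.fderiv, ContinuousLinearMap.integral_apply hi]
  rfl

lemma Tst.fd (hF : Tst F) (e : E3 × ℝ) : Tst (fun w => fderiv ℝ F w e) :=
  ⟨Smo.fd hF.1 e, hF.2.fderiv_apply ℝ _⟩

lemma SK_smo (hK : Integrable K nuM) (hF : Tst F) : Smo (SK κ K F) := by
  refine contDiff_infty.2 fun n => ?_
  induction n generalizing F with
  | zero =>
    refine contDiff_zero.2 (continuous_iff_continuousAt.2 fun z => ?_)
    exact (SK_hasF hK hF z).1.continuousAt
  | succ n ih =>
    have hn : ((n + 1 : ℕ) : WithTop ℕ∞) = (n : WithTop ℕ∞) + 1 := by norm_cast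
    rw [hn]
    refine contDiff_succ_iff_fderiv_apply.2 ⟨fun z => (SK_hasF hK hF z).1.differentiableAt,
      fun h => absurd h (by simp), fun e => ?_⟩
    have : (fun x => fderiv ℝ (SK κ K F) x e) = SK κ K (fun w => fderiv ℝ F w e) :=
      funext fun z => SK_fderiv hK hF z e
    rw [this]
    exact ih (hF.fd e)

lemma SK_sdz (hK : Integrable K nuM) (hF : Tst F) (i) : sdz (SK κ K F) i = SK κ K (sdz F i) :=
  funext fun z => SK_fderiv hK hF z _
lemma SK_tdz (hK : Integrable K nuM) (hF : Tst F) : tdz (SK κ K F) = SK κ K (tdz F) :=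
  funext fun z => SK_fderiv hK hF z _

lemma SK_bdd (hK : Integrable K nuM) (hF : Tst F) : ∃ C, 0 ≤ C ∧ ∀ z, |SK κ K F z| ≤ C := by
  obtain ⟨C, hC, hb⟩ := hF.bdd
  refine ⟨∫ a, ‖K a‖ * C ∂nuM, by positivity, fun z => ?_⟩
  refine norm_integral_le_of_norm_le (f := fun a => K a * F (z + shf κ a))
    (hK.norm.mul_const C) (ae_of_all _ fun a => ?_)
  rw [norm_mul]
  exact mul_le_mul_of_nonneg_left (hb _) (norm_nonneg _)

lemma SK_int (hK : Integrable K nuM) (hF : Tst F) : Integrable (SK κ K F) := by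
  have h1 : Integrable (fun q : (E3 × ℝ) × (ℝ × E3) => K q.2 * F (q.1 + shf κ q.2))
      (volume.prod nuM) := by
    have hm : AEStronglyMeasurable (fun q : (E3 × ℝ) × (ℝ × E3) => K q.2 * F (q.1 + shf κ q.2))
      (volume.prod nuM) := by
      refine (hK.1.comp_snd).mul ?_
      exact (hF.cont.comp ((continuous_fst).add ((shf_cont κ).comp continuous_snd))).aestronglyMeasurable
    refine (integrable_prod_iff' hm).2 ⟨ae_of_all _ fun a => ?_, ?_⟩
    · exact (hF.integrable.comp_add_right (shf κ a)).const_mul (K a)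
    · have : (fun a : ℝ × E3 => ∫ x, ‖K a * F (x + shf κ a)‖) =
          fun a => ‖K a‖ * ∫ x, ‖F x‖ := by
        ext a
        simp_rw [norm_mul]
        rw [integral_const_mul, integral_add_right_eq_self (fun x => ‖F x‖)]
      simp only [this]
      exact hK.norm.mul_const _
  exact h1.integral_prod_left

lemma slice_bd (hF : Tst F) : ∃ J : ℝ, ∀ s, ∫ x, ‖F (x, s)‖ ≤ J := by
  obtain ⟨R, hR⟩ : ∃ R, ∀ z, F z ≠ 0 → z.1 ∈ Metric.closedBall (0 : E3) R := by
    obtain ⟨R, hR⟩ := hF.2.isCompact.isBounded.subset_closedBall 0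
    refine ⟨R, fun z hz => ?_⟩
    have := hR (subset_tsupport _ hz)
    rw [mem_closedBall_zero_iff] at this ⊢
    exact (norm_fst_le z).trans this
  obtain ⟨C, hC, hb⟩ := hF.bdd
  have hI : Integrable ((Metric.closedBall (0 : E3) R).indicator fun _ => C) := by
    rw [integrable_indicator_iff measurableSet_closedBall]
    exact integrableOn_const (measure_closedBall_lt_top.ne)
  refine ⟨∫ x, (Metric.closedBall (0 : E3) R).indicator (fun _ => C) x, fun s => ?_⟩
  refine integral_mono (hF.slice_int s).norm hI ?_
  rw [Pi.le_def]
  intro x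
  have h3 := hb (x, s)
  rw [← Real.norm_eq_abs] at h3
  by_cases h : x ∈ Metric.closedBall (0 : E3) R
  · exact h3.trans (le_of_eq (indicator_of_mem h (fun _ => C)).symm)
  · have h0 : F (x, s) = 0 := by
      by_contra h2; exact h (hR (x, s) h2)
    exact (le_of_eq (by rw [h0, norm_zero])).trans (le_of_eq (indicator_of_notMem h (fun _ => C)).symm)

lemma SK_slice_int (hK : Integrable K nuM) (hF : Tst F) (t : ℝ) :
    Integrable (fun x => SK κ K F (x, t)) := by
  have hc2 : Continuous fun q : E3 × (ℝ × E3) => F ((q.1, t) + shf κ q.2) :=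
    hF.cont.comp (((continuous_fst).prodMk continuous_const).add ((shf_cont κ).comp continuous_snd))
  obtain ⟨J, hJ⟩ := slice_bd hF
  have hm : AEStronglyMeasurable (fun q : E3 × (ℝ × E3) => K q.2 * F ((q.1, t) + shf κ q.2))
      ((volume : Measure E3).prod nuM) :=
    (hK.1.comp_snd).mul hc2.aestronglyMeasurable
  have h1 : Integrable (fun q : E3 × (ℝ × E3) => K q.2 * F ((q.1, t) + shf κ q.2))
      ((volume : Measure E3).prod nuM) := by
    refine (integrable_prod_iff' hm).2 ⟨ae_of_all _ fun a => ?_, ?_⟩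
    · exact ((hF.slice_int (t + (shf κ a).2)).comp_add_right (shf κ a).1).const_mul (K a)
    · refine (hK.norm.mul_const J).mono'
        hm.norm.prod_swap.integral_prod_right' (ae_of_all _ fun a => ?_)
      rw [Real.norm_of_nonneg (by positivity)]
      simp_rw [norm_mul]
      rw [integral_const_mul]
      refine mul_le_mul_of_nonneg_left ?_ (norm_nonneg _)
      have := integral_add_right_eq_self (μ := (volume : Measure E3))
        (fun x => ‖F (x, t + (shf κ a).2)‖) (shf κ a).1
      exact this.le.trans (hJ _)
  exact h1.integral_prod_left

lemma SK_zero (hκ : 0 ≤ κ) {t1 : ℝ} (hF : ∀ z : E3 × ℝ, t1 ≤ z.2 → F z = 0) (z : E3 × ℝ)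
    (hz : t1 ≤ z.2) : SK κ K F z = 0 := by
  have : ∀ a, F (z + shf κ a) = 0 := fun a => hF _ (by
    simp only [shf, Prod.snd_add]; nlinarith [mul_nonneg hκ (sq_nonneg a.1)])
  simp [SK, this]
end


def gau (y : E3) : ℝ := Real.exp (-‖y‖ ^ 2)
def wty (y : E3) : ℝ := Real.exp (-(1/2) * ‖y‖ ^ 2)
def wts (s : ℝ) : ℝ := Real.exp (-(1/2) * s ^ 2)
/-- normalising constant -/
def cG : ℝ := (∫ y, gau y)⁻¹

lemma int_exp_sq {b : ℝ} (hb : 0 < b) : Integrable (fun y : E3 => Real.exp (-b * ‖y‖ ^ 2)) ∧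
    0 < ∫ y : E3, Real.exp (-b * ‖y‖ ^ 2) := by
  have h := GaussianFourier.integral_rexp_neg_mul_sq_norm (V := E3) hb
  have hp : 0 < ∫ y : E3, Real.exp (-b * ‖y‖ ^ 2) := by rw [h]; positivity
  refine ⟨?_, hp⟩
  by_contra hc
  rw [integral_undef hc] at hp
  exact lt_irrefl _ hp

lemma wty_int : Integrable wty := (int_exp_sq (b := 1/2) (by norm_num)).1
lemma gau_int : Integrable gau := by
  have := (int_exp_sq (b := 1) (by norm_num)).1
  have e : gau = fun y => Real.exp (-1 * ‖y‖ ^ 2) := by ext y; simp [gau]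
  rw [e]; exact this
lemma cG_pos : 0 < cG := by
  have := (int_exp_sq (b := 1) (by norm_num)).2
  unfold cG; rw [inv_pos]; simpa [gau] using this
lemma cG_mul : cG * ∫ y, gau y = 1 := inv_mul_cancel₀ (by
  have := cG_pos; unfold cG at this; exact (inv_pos.1 this).ne')
lemma wts_int : Integrable wts := integrable_exp_neg_mul_sq (by norm_num)
lemma gau_cont : Continuous gau := by unfold gau; fun_prop

lemma exp_aux (s : ℝ) (_ : 0 ≤ s) : (1 + s) * Real.exp (-s ^ 2) ≤ 2 * Real.exp (-(1/2) * s ^ 2) := by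
  have h1 : Real.exp (-s ^ 2) = Real.exp (-(1/2) * s ^ 2) * Real.exp (-(1/2) * s ^ 2) := by
    rw [← Real.exp_add]; ring_nf
  have h2 : (1 + s) * Real.exp (-(1/2) * s ^ 2) ≤ 2 := by
    have h3 := Real.add_one_le_exp ((1/2) * s ^ 2)
    have h4 : Real.exp (-(1/2) * s ^ 2) * Real.exp ((1/2) * s ^ 2) = 1 := by
      rw [← Real.exp_add]; ring_nf; simp
    have h5 := Real.exp_pos (-(1/2) * s ^ 2)
    nlinarith [sq_nonneg (s - 1)]
  rw [h1]
  nlinarith [Real.exp_pos (-(1/2) * s ^ 2)]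
lemma gau_le (y : E3) : (1 + ‖y‖) * gau y ≤ 2 * wty y := exp_aux _ (norm_nonneg y)
lemma gau_pos (y : E3) : 0 < gau y := Real.exp_pos _
lemma wty_pos (y : E3) : 0 < wty y := Real.exp_pos _
lemma wts_pos (y : ℝ) : 0 < wts y := Real.exp_pos _

/-- dominating weight -/
def wt (a : ℝ × E3) : ℝ := wts a.1 * wty a.2
def K0 (a : ℝ × E3) : ℝ := (2 * a.1 * Real.exp (-a.1 ^ 2)) * (cG * gau a.2)
def K1 (k : Fin 3) (a : ℝ × E3) : ℝ := (2 * Real.exp (-a.1 ^ 2)) * (cG * (a.2 k * gau a.2))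

lemma wt_pos (a) : 0 < wt a := mul_pos (wts_pos _) (wty_pos _)
lemma wt_int : Integrable wt nuM := (wts_int.restrict (s := Ioi 0)).mul_prod wty_int
lemma nuM_pos : ∀ᵐ a ∂nuM, 0 < a.1 := by
  have h : nuM = (volume : Measure (ℝ × E3)).restrict (Ioi 0 ×ˢ univ) := by
    rw [Measure.volume_eq_prod, ← Measure.prod_restrict]; simp [nuM]
  rw [h]
  filter_upwards [ae_restrict_mem (measurableSet_Ioi.prod MeasurableSet.univ)] with a ha
  exact ha.1

lemma coord_le (y : E3) (k : Fin 3) : |y k| ≤ ‖y‖ := by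
  simpa using PiLp.norm_apply_le y k

lemma K0_le (a : ℝ × E3) (ha : 0 < a.1) : |K0 a| ≤ (8 * cG) * wt a := by
  have h1 := exp_aux a.1 ha.le
  have h2 := gau_le a.2
  have h3 := cG_pos
  have h4 := gau_pos a.2
  have h5 := Real.exp_pos (-a.1 ^ 2)
  have e1 : 2 * a.1 * Real.exp (-a.1 ^ 2) ≤ 4 * wts a.1 := by unfold wts; nlinarith
  have e2 : gau a.2 ≤ 2 * wty a.2 := by nlinarith [mul_nonneg (norm_nonneg a.2) h4.le]
  unfold K0 wt
  rw [abs_of_nonneg (by positivity)]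
  calc _ ≤ (4 * wts a.1) * (cG * (2 * wty a.2)) := by
        apply mul_le_mul e1 _ (by positivity) (by have := wts_pos a.1; positivity)
        exact mul_le_mul_of_nonneg_left e2 h3.le
    _ = _ := by ring
lemma K1_le (k) (a : ℝ × E3) (ha : 0 < a.1) : |K1 k a| ≤ (8 * cG) * wt a := by
  have h1 := exp_aux a.1 ha.le
  have h2 := gau_le a.2
  have h3 := cG_pos
  have h4 := gau_pos a.2
  have h5 := Real.exp_pos (-a.1 ^ 2)
  have e1 : 2 * Real.exp (-a.1 ^ 2) ≤ 4 * wts a.1 := by unfold wts; nlinarith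
  have e2 : |a.2 k| * gau a.2 ≤ 2 * wty a.2 := by nlinarith [mul_le_mul_of_nonneg_right (coord_le a.2 k) h4.le]
  unfold K1 wt
  rw [abs_mul, abs_of_pos (by positivity), abs_mul, abs_of_pos h3, abs_mul, abs_of_pos h4]
  calc _ ≤ (4 * wts a.1) * (cG * (2 * wty a.2)) := by
        apply mul_le_mul e1 _ (by positivity) (by have := wts_pos a.1; positivity)
        exact mul_le_mul_of_nonneg_left e2 h3.le
    _ = _ := by ring
lemma K0_int : Integrable K0 nuM := by
  refine (wt_int.const_mul (8 * cG)).mono' ?_ ?_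
  · have : Continuous K0 := by unfold K0 gau; fun_prop
    exact this.aestronglyMeasurable
  · filter_upwards [nuM_pos] with a ha using K0_le a ha
lemma K1_int (k) : Integrable (K1 k) nuM := by
  refine (wt_int.const_mul (8 * cG)).mono' ?_ ?_
  · have : Continuous (K1 k) := by unfold K1 gau; fun_prop
    exact this.aestronglyMeasurable
  · filter_upwards [nuM_pos] with a ha using K1_le k a ha

lemma gau_fderiv (y : E3) (k : Fin 3) :
    DifferentiableAt ℝ gau y ∧ fderiv ℝ gau y (EuclideanSpace.single k 1) = - (2 * y k * gau y) := by
  have h1 : HasFDerivAt (fun y : E3 => ‖y‖ ^ 2) (2 • innerSL ℝ y) y := (hasStrictFDerivAt_norm_sq y).hasFDerivAt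
  have h2 : HasFDerivAt gau _ y := h1.neg.exp
  refine ⟨h2.differentiableAt, ?_⟩
  rw [h2.fderiv]
  simp [gau, EuclideanSpace.inner_single_right]
  ring

lemma ygau_int (k : Fin 3) : Integrable (fun y : E3 => 2 * y k * gau y) := by
  refine (wty_int.const_mul 4).mono' ?_ (ae_of_all _ fun y => ?_)
  · have : Continuous (fun y : E3 => 2 * y k * gau y) := by unfold gau; fun_prop
    exact this.aestronglyMeasurable
  · rw [Real.norm_eq_abs, abs_mul, abs_mul, abs_of_pos (gau_pos y), abs_of_pos (by norm_num : (0:ℝ) < 2)]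
    have := mul_le_mul_of_nonneg_right (coord_le y k) (gau_pos y).le
    nlinarith [gau_le y, gau_pos y]

lemma gauss_ibp {f : E3 → ℝ} (hf : Differentiable ℝ f) (hc : Continuous (fderiv ℝ f))
    {C : ℝ} (hb : ∀ y, |f y| ≤ C) (k : Fin 3)
    (hb' : ∀ y, |fderiv ℝ f y (EuclideanSpace.single k 1)| ≤ C) :
    ∫ y, gau y * fderiv ℝ f y (EuclideanSpace.single k 1) = ∫ y, 2 * y k * gau y * f y := by
  have h := integral_mul_fderiv_eq_neg_fderiv_mul_of_integrable (μ := (volume : Measure E3))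
    (f := gau) (g := f) (v := EuclideanSpace.single k 1) ?_ ?_ ?_
    (fun y _ => (gau_fderiv y k).1) (fun y _ => hf y)
  · rw [h, ← integral_neg]
    congr 1; ext y; rw [(gau_fderiv y k).2]; ring
  · simp_rw [fun y => (gau_fderiv y k).2]
    exact (ygau_int k).neg.mul_bdd (c := C) hf.continuous.aestronglyMeasurable (ae_of_all _ hb)
  · exact gau_int.mul_bdd (c := C) (hc.clm_apply continuous_const).aestronglyMeasurable (ae_of_all _ hb')
  · exact gau_int.mul_bdd (c := C) hf.continuous.aestronglyMeasurable (ae_of_all _ hb)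

lemma fd_decomp (F : E3 × ℝ → ℝ) (w : E3 × ℝ) (y : E3) (c : ℝ) :
    fderiv ℝ F w (y, c) = (∑ k, y k * sdz F k w) + c * tdz F w := by
  have h1 : (y, c) = (∑ k, y k • ((EuclideanSpace.single k 1 : E3), (0 : ℝ))) + c • ((0 : E3), (1 : ℝ)) := by
    ext i
    · simp [Fin.sum_univ_three]
      fin_cases i <;> simp
    · simp [Fin.sum_univ_three]
  rw [h1, map_add, map_sum]
  simp only [sdz, tdz, map_smul, smul_eq_mul]

section
variable {κ : ℝ} {F : E3 × ℝ → ℝ}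

lemma inner_y (hF : Tst F) (z) (s : ℝ) (k : Fin 3) (y : E3) :
    DifferentiableAt ℝ (fun y => F (z + shf κ (s, y))) y ∧
    fderiv ℝ (fun y => F (z + shf κ (s, y))) y (EuclideanSpace.single k 1) =
      2 * s * sdz F k (z + shf κ (s, y)) := by
  have h1 : HasFDerivAt (fun y : E3 => z + shf κ (s, y))
      (((2 * s) • ContinuousLinearMap.id ℝ E3).prod (0 : E3 →L[ℝ] ℝ)) y := by
    unfold shf
    exact ((((hasFDerivAt_id y).const_smul (2 * s)).prodMk (hasFDerivAt_const (κ * s ^ 2) y))).const_add z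
  have h2 := (Smo.da hF.1 (z + shf κ (s, y))).hasFDerivAt.comp y h1
  have h3 : HasFDerivAt (fun y => F (z + shf κ (s, y))) _ y := h2
  refine ⟨h3.differentiableAt, ?_⟩
  rw [h3.fderiv]
  simp [fd_decomp]

lemma inner_contd (hF : Tst F) (z) (s : ℝ) :
    Continuous (fderiv ℝ (fun y => F (z + shf κ (s, y)))) := by
  have : ContDiff ℝ (⊤ : ℕ∞) (fun y => F (z + shf κ (s, y))) := by
    refine hF.1.comp ?_
    unfold shf
    have h1 : ContDiff ℝ (⊤ : ℕ∞) (fun y : E3 => (2 * s) • y) := contDiff_const_smul (2 * s)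
    have h2 : ContDiff ℝ (⊤ : ℕ∞) (fun _ : E3 => κ * s ^ 2) := contDiff_const
    exact contDiff_const.add (h1.prodMk h2)
  exact this.continuous_fderiv (by simp)

lemma ibp_sdz (hF : Tst F) (z) (s : ℝ) (k : Fin 3) :
    ∫ y, gau y * (2 * s * sdz F k (z + shf κ (s, y))) =
      ∫ y, 2 * y k * gau y * F (z + shf κ (s, y)) := by
  obtain ⟨C, hC, hb⟩ := hF.bdd
  obtain ⟨C', hC', hb'⟩ := (hF.sdz k).bdd
  have := gauss_ibp (f := fun y => F (z + shf κ (s, y))) (C := C + |2 * s| * C')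
    (fun y => (inner_y hF z s k y).1) (inner_contd hF z s)
    (fun y => (hb _).trans (by have : 0 ≤ |2 * s| * C' := by positivity
                               linarith)) k
    (fun y => by
      rw [(inner_y hF z s k y).2, abs_mul]
      have := mul_le_mul_of_nonneg_left (hb' (z + shf κ (s, y))) (abs_nonneg (2 * s))
      linarith)
  rw [← this]
  congr 1; ext y; rw [(inner_y hF z s k y).2]

lemma shf_cont2 (s : ℝ) (z : E3 × ℝ) : Continuous (fun y : E3 => z + shf κ (s, y)) := by
  unfold shf; fun_prop

lemma gF_int (hF : Tst F) (z) (s : ℝ) : Integrable fun y => gau y * F (z + shf κ (s, y)) := by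
  obtain ⟨C, hC, hb⟩ := hF.bdd
  exact gau_int.mul_bdd (c := C) (hF.cont.comp (shf_cont2 s z)).aestronglyMeasurable
    (ae_of_all _ fun y => hb _)
lemma ygF_int (hF : Tst F) (z) (s : ℝ) (k) :
    Integrable fun y : E3 => 2 * y k * gau y * F (z + shf κ (s, y)) := by
  obtain ⟨C, hC, hb⟩ := hF.bdd
  exact (ygau_int k).mul_bdd (c := C) (hF.cont.comp (shf_cont2 s z)).aestronglyMeasurable
    (ae_of_all _ fun y => hb _)

lemma inner_s (hF : Tst F) (z) (s : ℝ) (y : E3) :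
    HasDerivAt (fun s => F (z + shf κ (s, y)))
      ((∑ k, 2 * y k * sdz F k (z + shf κ (s, y))) + 2 * κ * s * tdz F (z + shf κ (s, y))) s := by
  have h1 : HasDerivAt (fun s : ℝ => z + shf κ (s, y)) ((2 : ℝ) • y, 2 * κ * s) s := by
    unfold shf
    refine HasDerivAt.const_add z (HasDerivAt.prodMk ?_ ?_)
    · have := ((hasDerivAt_id s).const_mul 2).smul_const y
      simpa using this
    · have := ((hasDerivAt_id s).pow 2).const_mul κ
      refine this.congr_deriv ?_
      simp; ring
  have h2 := (Smo.da hF.1 (z + shf κ (s, y))).hasFDerivAt.comp_hasDerivAt s h1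
  refine h2.congr_deriv ?_
  rw [fd_decomp]; simp

lemma Pderiv (hF : Tst F) (z) (s : ℝ) :
    HasDerivAt (fun s => ∫ y, gau y * F (z + shf κ (s, y)))
      (2 * s * ∫ y, gau y * (κ * tdz F (z + shf κ (s, y)) + ∑ k, sdz (sdz F k) k (z + shf κ (s, y)))) s := by
  obtain ⟨Ct, hCt, hbt⟩ := hF.tdz.bdd
  choose Cs hCs hbs using fun k => (hF.sdz k).bdd
  have hI1 : ∀ s k, Integrable fun y : E3 => 2 * y k * gau y * sdz F k (z + shf κ (s, y)) :=
    fun s k => ygF_int (hF.sdz k) z s k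
  have key := hasDerivAt_integral_of_dominated_loc_of_deriv_le (μ := (volume : Measure E3))
    (F := fun s y => gau y * F (z + shf κ (s, y)))
    (F' := fun s y => gau y * ((∑ k, 2 * y k * sdz F k (z + shf κ (s, y))) + 2 * κ * s * tdz F (z + shf κ (s, y))))
    (x₀ := s) (s := Metric.ball s 1)
    (bound := fun y => (∑ k, |2 * y k * gau y| * Cs k) + gau y * (2 * |κ| * (|s| + 1) * Ct))
    (Metric.ball_mem_nhds s one_pos) (Eventually.of_forall fun s => (gF_int hF z s).1)
    (gF_int hF z s) ?_ (ae_of_all _ fun y x hx => ?_) ?_ (ae_of_all _ fun y x _ => ?_)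
  · refine key.2.congr_deriv ?_
    symm
    have e1 : ∀ k, ∫ y : E3, 2 * y k * gau y * sdz F k (z + shf κ (s, y)) =
        ∫ y, gau y * (2 * s * sdz (sdz F k) k (z + shf κ (s, y))) := fun k =>
      (ibp_sdz (hF.sdz k) z s k).symm
    have e2 : ∀ y : E3, gau y * ((∑ k, 2 * y k * sdz F k (z + shf κ (s, y))) + 2 * κ * s * tdz F (z + shf κ (s, y)))
      = (∑ k, 2 * y k * gau y * sdz F k (z + shf κ (s, y))) + (2 * κ * s) * (gau y * tdz F (z + shf κ (s, y))) := by
      intro y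
      rw [mul_add, Finset.mul_sum]
      congr 1
      · exact Finset.sum_congr rfl fun k _ => by ring
      · ring
    have e3 : ∀ y : E3, gau y * (κ * tdz F (z + shf κ (s, y)) + ∑ k, sdz (sdz F k) k (z + shf κ (s, y)))
      = κ * (gau y * tdz F (z + shf κ (s, y))) + ∑ k, gau y * sdz (sdz F k) k (z + shf κ (s, y)) := by
      intro y
      rw [mul_add, Finset.mul_sum]
      ring
    simp_rw [e2, e3]
    rw [integral_add (integrable_finsetSum _ fun k _ => hI1 s k) ((gF_int hF.tdz z s).const_mul _),
      integral_add ((gF_int hF.tdz z s).const_mul _)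
        (integrable_finsetSum _ fun k _ => gF_int ((hF.sdz k).sdz k) z s),
      integral_finsetSum _ fun k _ => hI1 s k,
      integral_finsetSum _ fun k _ => gF_int ((hF.sdz k).sdz k) z s]
    simp_rw [e1, integral_const_mul, fun y k => mul_left_comm (gau y) (2 * s) (sdz (sdz F k) k (z + shf κ (s, y))),
      integral_const_mul, ← Finset.mul_sum]
    ring
  · have : Continuous fun y : E3 => gau y * ((∑ k, 2 * y k * sdz F k (z + shf κ (s, y))) + 2 * κ * s * tdz F (z + shf κ (s, y))) := by
      refine gau_cont.mul ((continuous_finsetSum _ fun k _ => ?_).add ?_)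
      · exact (by fun_prop : Continuous fun y : E3 => 2 * y k).mul ((hF.sdz k).cont.comp (shf_cont2 s z))
      · exact continuous_const.mul (hF.tdz.cont.comp (shf_cont2 s z))
    exact this.aestronglyMeasurable
  · have hx' : |x| ≤ |s| + 1 := by
      rw [Metric.mem_ball, Real.dist_eq] at hx
      have := abs_sub_abs_le_abs_sub x s
      linarith
    rw [Real.norm_eq_abs, mul_add, Finset.mul_sum]
    refine (abs_add_le _ _).trans (add_le_add ((Finset.abs_sum_le_sum_abs _ _).trans
      (Finset.sum_le_sum fun k _ => ?_)) ?_)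
    · rw [show gau y * (2 * y k * sdz F k (z + shf κ (x, y))) = (2 * y k * gau y) * sdz F k (z + shf κ (x, y)) by ring, abs_mul]
      exact mul_le_mul_of_nonneg_left (hbs k _) (abs_nonneg _)
    · rw [abs_mul, abs_of_pos (gau_pos y), abs_mul, abs_mul, abs_mul, abs_two]
      refine mul_le_mul_of_nonneg_left ?_ (gau_pos y).le
      gcongr
      exact hbt _
  · refine (integrable_finsetSum _ fun k _ => ((ygau_int k).abs.mul_const _)).add (gau_int.mul_const _)
  · exact (inner_s hF z x y).const_mul _

lemma SK_Lop (hF : Tst F) (z) : SK κ K0 (Lop κ F) z = F z := by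
  set Q : ℝ → ℝ := fun s => ∫ y, gau y * F (z + shf κ (s, y)) with hQ
  obtain ⟨C, hC, hb⟩ := hF.bdd
  have hd : ∀ s, HasDerivAt (fun s => Real.exp (-s ^ 2) * (cG * Q s))
      (- ∫ y, K0 (s, y) * Lop κ F (z + shf κ (s, y))) s := by
    intro s
    have h1 : HasDerivAt (fun s : ℝ => Real.exp (-s ^ 2)) (Real.exp (-s ^ 2) * (-(2 * s))) s := by
      have := ((hasDerivAt_id s).pow 2).neg.exp
      refine this.congr_deriv ?_
      simp
    have h2 := h1.mul ((Pderiv (κ := κ) hF z s).const_mul cG)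
    refine h2.congr_deriv ?_
    symm
    have e : ∀ y, K0 (s, y) * Lop κ F (z + shf κ (s, y)) =
      (2 * s * Real.exp (-s ^ 2) * cG) * (gau y * F (z + shf κ (s, y)) -
        gau y * (κ * tdz F (z + shf κ (s, y)) + ∑ k, sdz (sdz F k) k (z + shf κ (s, y)))) := by
      intro y; simp only [K0, Lop]; ring
    rw [integral_congr_ae (ae_of_all _ e), integral_const_mul, integral_sub (gF_int hF z s) (gF_int ((hF.tdz.const_mul κ).add
      (Tst.sum _ fun k => (hF.sdz k).sdz k)) z s)]
    ring
  have hint := SK_intg (κ := κ) K0_int (hF.Lop κ) z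
  have hint2 : IntegrableOn (fun s => ∫ y, K0 (s, y) * Lop κ F (z + shf κ (s, y))) (Ioi 0) :=
    Integrable.integral_prod_left hint
  have hQb : ∀ s, |cG * Q s| ≤ C := by
    intro s
    have h1 : |Q s| ≤ ∫ y, gau y * C := norm_integral_le_of_norm_le (f := fun y => gau y * F (z + shf κ (s, y))) (gau_int.mul_const C)
      (ae_of_all _ fun y => by
        rw [norm_mul, Real.norm_eq_abs, abs_of_pos (gau_pos y)]
        exact mul_le_mul_of_nonneg_left (hb _) (gau_pos y).le)
    rw [integral_mul_const] at h1
    rw [abs_mul, abs_of_pos cG_pos]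
    calc _ ≤ cG * ((∫ y, gau y) * C) := mul_le_mul_of_nonneg_left h1 cG_pos.le
      _ = C := by rw [← mul_assoc, cG_mul, one_mul]
  have hlim : Tendsto (fun s => Real.exp (-s ^ 2) * (cG * Q s)) atTop (nhds 0) := by
    have h1 : Tendsto (fun s : ℝ => Real.exp (-s ^ 2) * C) atTop (nhds 0) := by
      have : Tendsto (fun s : ℝ => Real.exp (-s ^ 2)) atTop (nhds 0) :=
        Real.tendsto_exp_atBot.comp (tendsto_neg_atTop_atBot.comp (tendsto_pow_atTop two_ne_zero))
      simpa using this.mul_const C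
    refine squeeze_zero_norm (fun s => ?_) h1
    rw [norm_mul, Real.norm_eq_abs, abs_of_pos (Real.exp_pos _)]
    exact mul_le_mul_of_nonneg_left (hQb s) (Real.exp_pos _).le
  have hfin := integral_Ioi_of_hasDerivAt_of_tendsto' (a := 0) (fun s _ => hd s) hint2.neg hlim
  rw [integral_neg] at hfin
  have hQ0 : cG * Q 0 = F z := by
    have : Q 0 = (∫ y, gau y) * F z := by
      have h00 : z + ((0 : E3), (0 : ℝ)) = z := add_zero z
      simp [hQ, shf, integral_mul_const, h00]
    rw [this, ← mul_assoc, cG_mul, one_mul]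
  have hS : SK κ K0 (Lop κ F) z = ∫ s in Ioi 0, ∫ y, K0 (s, y) * Lop κ F (z + shf κ (s, y)) :=
    integral_prod _ hint
  rw [hS]
  simp [hQ0] at hfin
  linarith

lemma SK0_sdz (hF : Tst F) (k) (z) : SK κ K0 (sdz F k) z = SK κ (K1 k) F z := by
  have h1 : SK κ K0 (sdz F k) z = ∫ s in Ioi 0, ∫ y, K0 (s, y) * sdz F k (z + shf κ (s, y)) :=
    integral_prod _ (SK_intg (κ := κ) K0_int (hF.sdz k) z)
  have h2 : SK κ (K1 k) F z = ∫ s in Ioi 0, ∫ y, K1 k (s, y) * F (z + shf κ (s, y)) :=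
    integral_prod _ (SK_intg (κ := κ) (K1_int k) hF z)
  rw [h1, h2]
  congr 1; ext s
  have e1 : ∀ y, K0 (s, y) * sdz F k (z + shf κ (s, y)) =
      (Real.exp (-s ^ 2) * cG) * (gau y * (2 * s * sdz F k (z + shf κ (s, y)))) := by
    intro y; simp only [K0]; ring
  have e2 : ∀ y, K1 k (s, y) * F (z + shf κ (s, y)) =
      (Real.exp (-s ^ 2) * cG) * (2 * y k * gau y * F (z + shf κ (s, y))) := by
    intro y; simp only [K1]; ring
  simp_rw [e1, e2, integral_const_mul, ibp_sdz hF]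
end


/-- solution operator -/
def Sop (κ : ℝ) (F : E3 × ℝ → ℝ) : E3 × ℝ → ℝ := SK κ K0 F

section
variable {κ : ℝ} {F : E3 × ℝ → ℝ}
lemma Sop_smo (hF : Tst F) : Smo (Sop κ F) := SK_smo K0_int hF
lemma Sop_sdz (hF : Tst F) (i) : sdz (Sop κ F) i = Sop κ (sdz F i) := SK_sdz K0_int hF i
lemma Sop_tdz (hF : Tst F) : tdz (Sop κ F) = Sop κ (tdz F) := SK_tdz K0_int hF

lemma Sop_Lop (hF : Tst F) : Lop κ (Sop κ F) = F := by
  have h : Lop κ (Sop κ F) = SK κ K0 (Lop κ F) := by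
    ext z
    have h1 : ∀ i, sdz (sdz (Sop κ F) i) i z = SK κ K0 (sdz (sdz F i) i) z := fun i => by
      rw [Sop_sdz hF, Sop_sdz (hF.sdz i)]; rfl
    simp only [Lop]
    simp only [h1, Sop_tdz hF]
    simp only [Sop, SK]
    rw [← integral_finsetSum _ fun i _ => SK_intg K0_int ((hF.sdz i).sdz i) z, ← integral_const_mul,
      ← integral_sub ((SK_intg K0_int hF.tdz z).const_mul _)
        (integrable_finsetSum _ fun i _ => SK_intg K0_int ((hF.sdz i).sdz i) z),
      ← integral_add _ (SK_intg K0_int hF z)]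
    · congr 1; ext a
      rw [← Finset.mul_sum]; unfold Lop; ring
    · exact ((SK_intg K0_int hF.tdz z).const_mul _).sub
        (integrable_finsetSum _ fun i _ => SK_intg K0_int ((hF.sdz i).sdz i) z)
  rw [h]; ext z; exact SK_Lop hF z

lemma SK_dom {K : ℝ × E3 → ℝ} (hK : ∀ a : ℝ × E3, 0 < a.1 → |K a| ≤ (8 * cG) * wt a) (hF : Tst F) (z) :
    |SK κ K F z| ≤ (8 * cG) * ∫ a, wt a * |F (z + shf κ a)| ∂nuM := by
  obtain ⟨C, hC, hb⟩ := hF.bdd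
  rw [← integral_const_mul]
  refine norm_integral_le_of_norm_le (f := fun a => K a * F (z + shf κ a)) ?_ ?_
  · refine Integrable.const_mul ?_ _
    refine wt_int.mul_bdd (c := C) ?_ (ae_of_all _ fun a => by simpa using hb _)
    exact (hF.cont.abs.comp ((continuous_const).add (shf_cont κ))).aestronglyMeasurable
  · filter_upwards [nuM_pos] with a ha
    rw [norm_mul, ← mul_assoc]
    exact mul_le_mul_of_nonneg_right (hK a ha) (abs_nonneg _)
lemma Sop_dom (hF : Tst F) (z) :
    |Sop κ F z| ≤ (8 * cG) * ∫ a, wt a * |F (z + shf κ a)| ∂nuM := SK_dom K0_le hF z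
lemma Sop_dom' (hF : Tst F) (k) (z) :
    |sdz (Sop κ F) k z| ≤ (8 * cG) * ∫ a, wt a * |F (z + shf κ a)| ∂nuM := by
  rw [Sop_sdz hF]
  unfold Sop; rw [SK0_sdz hF]
  exact SK_dom (K1_le k) hF z

/-- continuous, bounded, integrable on space-time and slices -/
structure BI (f : E3 × ℝ → ℝ) : Prop where
  smo : Smo f
  bdd : ∃ C, 0 ≤ C ∧ ∀ z, |f z| ≤ C
  int : Integrable f
  sl : ∀ t, Integrable (fun x => f (x, t))

lemma Sop_BI (hF : Tst F) : BI (Sop κ F) :=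
  ⟨Sop_smo hF, SK_bdd K0_int hF, SK_int K0_int hF, SK_slice_int K0_int hF⟩
lemma Tst.BI (hF : Tst F) : BI F := ⟨hF.1, hF.bdd, hF.integrable, hF.slice_int⟩

lemma BI.imul {f g} (hf : BI f) (hg : BI g) : Integrable (fun z => f z * g z) := by
  obtain ⟨C, _, hb⟩ := hg.bdd
  exact hf.int.mul_bdd (c := C) hg.smo.continuous.aestronglyMeasurable (ae_of_all _ hb)
lemma BI.smul {f g} (hf : BI f) (hg : BI g) (t) : Integrable (fun x => f (x, t) * g (x, t)) := by
  obtain ⟨C, _, hb⟩ := hg.bdd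
  exact (hf.sl t).mul_bdd (c := C) (Smo.slice hg.smo t).continuous.aestronglyMeasurable
    (ae_of_all _ fun x => hb _)

lemma BI.ibp {f g} (hf : BI f) (hg : BI g) (i) (hf' : BI (sdz f i)) (hg' : BI (sdz g i)) (S : Set ℝ) :
    ∫ z in (univ : Set E3) ×ˢ S, f z * sdz g i z = - ∫ z in (univ : Set E3) ×ˢ S, sdz f i z * g z := by
  rw [slab_swap (hf.imul hg'), slab_swap (hf'.imul hg), ← integral_neg]
  congr 1; ext t
  have h := integral_mul_fderiv_eq_neg_fderiv_mul_of_integrable (μ := (volume : Measure E3))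
    (f := fun x => f (x, t)) (g := fun x => g (x, t)) (v := EuclideanSpace.single i 1) ?_ ?_ (hf.smul hg t)
    (fun x _ => ((Smo.slice hf.smo t).differentiable (by simp)) x)
    (fun x _ => ((Smo.slice hg.smo t).differentiable (by simp)) x)
  · simp_rw [sdz_slice hf.smo, sdz_slice hg.smo] at h
    exact h
  · simp_rw [sdz_slice hf.smo]; exact hf'.smul hg t
  · simp_rw [sdz_slice hg.smo]; exact hf.smul hg' t

lemma BI.tme {f} (hf : BI f) (hf' : BI (tdz f)) {t1 : ℝ} (h0 : ∀ z : E3 × ℝ, t1 ≤ z.2 → f z = 0) (τ : ℝ) :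
    ∫ z in (univ : Set E3) ×ˢ Ioi τ, 2 * (tdz f z * f z) = - ∫ x, f (x, τ) ^ 2 := by
  rw [slab_swap' ((hf'.imul hf).const_mul 2), ← integral_neg]
  congr 1; ext x
  have h1 : ∀ t, HasDerivAt (fun s => f (x, s) ^ 2) (2 * (tdz f (x, t) * f (x, t))) t := by
    intro t
    refine ((tdz_slice hf.smo x t).pow 2).congr_deriv ?_
    simp; ring
  have hc : Continuous fun t => 2 * (tdz f (x, t) * f (x, t)) := by
    have := hf'.smo.continuous; have := hf.smo.continuous; fun_prop
  have hlim : Tendsto (fun s => f (x, s) ^ 2) atTop (nhds 0) := by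
    refine tendsto_const_nhds.congr' ?_
    filter_upwards [eventually_ge_atTop t1] with s hs
    rw [h0 (x, s) hs]; simp
  have hi : IntegrableOn (fun t => 2 * (tdz f (x, t) * f (x, t))) (Ioi τ) := by
    have hI : IntegrableOn (fun t => 2 * (tdz f (x, t) * f (x, t))) (Icc τ t1) :=
      hc.continuousOn.integrableOn_compact isCompact_Icc
    refine hI.of_forall_sdiff_eq_zero measurableSet_Ioi (fun t ht => ?_)
    have : t1 ≤ t := by
      by_contra hcon
      exact ht.2 ⟨le_of_lt ht.1, by linarith⟩
    rw [h0 (x, t) this]; simp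
  simpa using integral_Ioi_of_hasDerivAt_of_tendsto' (a := τ) (fun t _ => h1 t) hi hlim

/-- energy -/
def en (τ : ℝ) (φ : E3 × ℝ → ℝ) : ℝ :=
  (∫ x, φ (x, τ) ^ 2) + ∫ z in (univ : Set E3) ×ˢ Ioi τ, ((∑ i, sdz φ i z ^ 2) + φ z ^ 2)

lemma energy (hF : Tst F) {t1 : ℝ} (h0 : ∀ z : E3 × ℝ, t1 ≤ z.2 → F z = 0) (τ : ℝ) :
    en τ (Sop 1 F) + (∫ z in (univ : Set E3) ×ˢ Ioi τ, ((∑ i, sdz (Sop 1 F) i z ^ 2) + Sop 1 F z ^ 2)) =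
    2 * ∫ z in (univ : Set E3) ×ˢ Ioi τ, F z * Sop 1 F z := by
  set φ := Sop 1 F with hφ
  have b0 : BI φ := Sop_BI hF
  have bi : ∀ i, BI (sdz φ i) := fun i => by rw [hφ, Sop_sdz hF]; exact Sop_BI (hF.sdz i)
  have bii : ∀ i, BI (sdz (sdz φ i) i) := fun i => by
    rw [hφ, Sop_sdz hF, Sop_sdz (hF.sdz i)]; exact Sop_BI ((hF.sdz i).sdz i)
  have bt : BI (tdz φ) := by rw [hφ, Sop_tdz hF]; exact Sop_BI hF.tdz
  have hL : ∀ z, F z = - tdz φ z - (∑ i, sdz (sdz φ i) i z) + φ z := fun z => by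
    have := congrFun (Sop_Lop (κ := 1) hF) z
    rw [← this]; simp [Lop, hφ]
  have h1 := b0.tme bt (fun z hz => SK_zero zero_le_one h0 z hz) τ
  have h2 : ∀ i, ∫ z in (univ : Set E3) ×ˢ Ioi τ, φ z * sdz (sdz φ i) i z =
      - ∫ z in (univ : Set E3) ×ˢ Ioi τ, sdz φ i z * sdz φ i z := fun i =>
    b0.ibp (bi i) i (bi i) (bii i) _
  rw [integral_const_mul] at h1
  set μ := (volume : Measure (E3 × ℝ)).restrict ((univ : Set E3) ×ˢ Ioi τ)
  have i1 : Integrable (fun z => tdz φ z * φ z) μ := (bt.imul b0).integrableOn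
  have i2 : ∀ i, Integrable (fun z => φ z * sdz (sdz φ i) i z) μ := fun i => (b0.imul (bii i)).integrableOn
  have i3 : Integrable (fun z => φ z * φ z) μ := (b0.imul b0).integrableOn
  have i4 : ∀ i, Integrable (fun z => sdz φ i z * sdz φ i z) μ := fun i => ((bi i).imul (bi i)).integrableOn
  have e1 : ∫ z, F z * φ z ∂μ = - (∫ z, tdz φ z * φ z ∂μ) - (∑ i, ∫ z, φ z * sdz (sdz φ i) i z ∂μ)
      + ∫ z, φ z * φ z ∂μ := by
    have i1' : Integrable (fun z => -(tdz φ z * φ z)) μ := i1.neg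
    have i2' : Integrable (fun z => ∑ i, φ z * sdz (sdz φ i) i z) μ := integrable_finsetSum Finset.univ fun i _ => i2 i
    have i3' : Integrable (fun z => -(tdz φ z * φ z) - ∑ i, φ z * sdz (sdz φ i) i z) μ := i1'.sub i2'
    rw [← integral_finsetSum _ fun i _ => i2 i, ← integral_neg, ← integral_sub i1' i2', ← integral_add i3' i3]
    congr 1; ext z; rw [hL z, ← Finset.mul_sum]; ring
  have e2 : ∫ z, ((∑ i, sdz φ i z ^ 2) + φ z ^ 2) ∂μ = (∑ i, ∫ z, sdz φ i z * sdz φ i z ∂μ)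
      + ∫ z, φ z * φ z ∂μ := by
    rw [← integral_finsetSum _ fun i _ => i4 i, ← integral_add (integrable_finsetSum _ fun i _ => i4 i) i3]
    simp only [pow_two]
  unfold en
  change (_ + ∫ z, ((∑ i, sdz φ i z ^ 2) + φ z ^ 2) ∂μ) + ∫ z, ((∑ i, sdz φ i z ^ 2) + φ z ^ 2) ∂μ = _
  rw [e2, e1]
  simp_rw [h2, Finset.sum_neg_distrib]
  linarith

lemma en_le (hF : Tst F) {t1 : ℝ} (h0 : ∀ z : E3 × ℝ, t1 ≤ z.2 → F z = 0) (τ : ℝ) :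
    en τ (Sop 1 F) ≤ 2 * ∫ z, |F z| * |Sop 1 F z| := by
  have h := energy hF h0 τ
  have h1 : 0 ≤ ∫ z in (univ : Set E3) ×ˢ Ioi τ, ((∑ i, sdz (Sop 1 F) i z ^ 2) + Sop 1 F z ^ 2) := by
    positivity
  have hi : Integrable (fun z => F z * Sop 1 F z) := hF.BI.imul (Sop_BI hF)
  have h2 : ∫ z in (univ : Set E3) ×ˢ Ioi τ, F z * Sop 1 F z ≤ ∫ z, |F z| * |Sop 1 F z| := by
    calc _ ≤ ∫ z in (univ : Set E3) ×ˢ Ioi τ, |F z * Sop 1 F z| :=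
          integral_mono hi.integrableOn hi.abs.integrableOn fun z => le_abs_self _
      _ ≤ ∫ z, |F z * Sop 1 F z| := setIntegral_le_integral hi.abs (ae_of_all _ fun z => abs_nonneg _)
      _ = _ := by simp_rw [abs_mul]
  linarith

lemma en_sdz_le (hF : Tst F) {t1 : ℝ} (h0 : ∀ z : E3 × ℝ, t1 ≤ z.2 → F z = 0) (τ : ℝ) (k) :
    en τ (sdz (Sop 1 F) k) ≤ ∫ z, F z ^ 2 := by
  have hz : ∀ z : E3 × ℝ, t1 ≤ z.2 → F z = 0 := h0
  have h0' : ∀ z : E3 × ℝ, t1 + 1 ≤ z.2 → sdz F k z = 0 := by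
    intro z hz
    have : z ∉ tsupport F := by
      intro hc
      have hs : tsupport F ⊆ {z : E3 × ℝ | z.2 ≤ t1} := by
        refine closure_minimal (fun w hw => ?_) (isClosed_le continuous_snd continuous_const)
        by_contra hcon
        exact hw (h0 w (le_of_lt (not_le.1 hcon)))
      have := hs hc
      simp at this; linarith
    exact image_eq_zero_of_notMem_tsupport fun h => this (tsupport_sdz _ _ h)
  have h := energy (hF.sdz k) h0' τ
  rw [Sop_sdz hF]
  set ψ := Sop 1 (sdz F k) with hψ
  have b1 : BI ψ := Sop_BI (hF.sdz k)
  have b2 : ∀ i, BI (sdz ψ i) := fun i => by rw [hψ, Sop_sdz (hF.sdz k)]; exact Sop_BI ((hF.sdz k).sdz i)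
  have h2 := hF.BI.ibp b1 k (hF.sdz k).BI (b2 k) (Ioi τ)
  set μ := (volume : Measure (E3 × ℝ)).restrict ((univ : Set E3) ×ˢ Ioi τ)
  have i1 : Integrable (fun z => F z * F z) μ := (hF.BI.imul hF.BI).integrableOn
  have i2 : ∀ i, Integrable (fun z => sdz ψ i z * sdz ψ i z) μ := fun i => ((b2 i).imul (b2 i)).integrableOn
  have i3 : Integrable (fun z => F z * sdz ψ k z) μ := (hF.BI.imul (b2 k)).integrableOn
  have i4 : Integrable (fun z => ψ z * ψ z) μ := (b1.imul b1).integrableOn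
  have h3 : -(2 * ∫ z, F z * sdz ψ k z ∂μ) ≤ (∫ z, F z * F z ∂μ) + ∫ z, ((∑ i, sdz ψ i z ^ 2) + ψ z ^ 2) ∂μ := by
    have i5 : Integrable (fun z => (∑ i, sdz ψ i z ^ 2) + ψ z ^ 2) μ := by
      simp only [pow_two]
      exact (integrable_finsetSum Finset.univ fun i _ => i2 i).add i4
    have i6 : Integrable (fun z => -(2 * (F z * sdz ψ k z))) μ := (i3.const_mul 2).neg
    rw [← integral_const_mul, ← integral_neg, ← integral_add i1 i5]
    refine integral_mono i6 (i1.add i5) fun z => ?_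
    have : sdz ψ k z ^ 2 ≤ ∑ i, sdz ψ i z ^ 2 :=
      Finset.single_le_sum (f := fun i => sdz ψ i z ^ 2) (fun i _ => sq_nonneg _) (Finset.mem_univ k)
    simp only
    nlinarith [sq_nonneg (F z + sdz ψ k z), sq_nonneg (ψ z)]
  have h4 : ∫ z, F z * F z ∂μ ≤ ∫ z, F z ^ 2 := by
    simp_rw [pow_two]
    exact setIntegral_le_integral (hF.BI.imul hF.BI) (ae_of_all _ fun z => mul_self_nonneg _)
  linarith
end


lemma corr_cont {H V : E3 × ℝ → ℝ} (hH : MemLp H 2) (hV : MemLp V 2) :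
    Continuous (fun y : E3 × ℝ => ∫ z, H z * V (z + y)) := by
  let g : C(E3 × ℝ, C(E3 × ℝ, E3 × ℝ)) := (ContinuousMap.mk (fun a : (E3 × ℝ) × (E3 × ℝ) => a.2 + a.1)
    (by fun_prop)).curry
  have hgm : ∀ y, MeasurePreserving (g y) (volume : Measure (E3 × ℝ)) volume := fun y =>
    measurePreserving_add_right volume y
  have hc := Continuous.compMeasurePreservingLp (μ := (volume : Measure (E3 × ℝ)))
    (ν := (volume : Measure (E3 × ℝ))) (p := 2) (continuous_const (y := hV.toLp V)) g.continuous hgm (by simp)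
  have h2 : Continuous fun y => inner ℝ (hH.toLp H) (Lp.compMeasurePreserving (g y) (hgm y) (hV.toLp V)) :=
    continuous_const.inner hc
  convert h2 using 2 with y
  rw [L2.inner_def]
  refine integral_congr_ae ?_
  have e1 := Lp.coeFn_compMeasurePreserving (hV.toLp V) (hgm y)
  have e2 := (hgm y).quasiMeasurePreserving.ae_eq_comp hV.coeFn_toLp
  filter_upwards [e1, e2, hH.coeFn_toLp] with z h1 h2 h3
  rw [h1, h2, h3]
  simp [g, mul_comm]

open scoped Convolution in
lemma mol_corr {H V ρ : E3 × ℝ → ℝ} (hHm : Measurable H) (hVm : Measurable V) (hH : MemLp H 2) (hV : MemLp V 2)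
    (hρ : Tst ρ) :
    ∫ z, H z * (ρ ⋆[ContinuousLinearMap.lsmul ℝ ℝ] V) z =
      (ρ ⋆[ContinuousLinearMap.lsmul ℝ ℝ] (fun y => ∫ z, H z * V (z + y))) 0 := by
  have hρm := hρ.cont.measurable
  have hVt : ∀ y, MemLp (fun z => V (z + y)) 2 := fun y =>
    hV.comp_measurePreserving (measurePreserving_add_right volume y)
  have hint : Integrable (Function.uncurry fun (t z : E3 × ℝ) => ρ t * (H z * V (z - t)))
      ((volume : Measure (E3 × ℝ)).prod volume) := by
    have hm : AEStronglyMeasurable (Function.uncurry fun (t z : E3 × ℝ) => ρ t * (H z * V (z - t)))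
      ((volume : Measure (E3 × ℝ)).prod volume) := by
      refine Measurable.aestronglyMeasurable ?_
      simp only [Function.uncurry_def]
      fun_prop
    rw [integrable_prod_iff hm]
    constructor
    · refine ae_of_all _ fun t => ?_
      have := hH.integrable_mul (hVt (-t))
      exact (this.const_mul (ρ t))
    · have hc := corr_cont hH.abs hV.abs
      have : Continuous (fun t => |ρ t| * ∫ z, |H| z * |V| (z + -t)) :=
        hρ.cont.abs.mul (hc.comp continuous_neg)
      refine (this.integrable_of_hasCompactSupport (μ := volume) ?_).congr (ae_of_all _ fun t => ?_)
      · exact HasCompactSupport.mul_right (hρ.2.norm)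
      · simp only [Function.uncurry, norm_mul, Real.norm_eq_abs, integral_const_mul]
        simp [sub_eq_add_neg]
  simp only [convolution_def, ContinuousLinearMap.lsmul_apply, smul_eq_mul]
  simp_rw [← integral_const_mul]
  simp_rw [mul_left_comm (H _)]
  rw [← integral_integral_swap hint]
  congr 1; ext t; congr 1; ext z
  rw [zero_sub, sub_eq_add_neg]

open scoped Convolution in
lemma V2 {U : Set (E3 × ℝ)} (hU : IsOpen U) {V D : E3 × ℝ → ℝ} (hVm : Measurable V) (hDm : Measurable D)
    (hV : MemLp V 2) (hD : MemLp D 2) (i : Fin 3)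
    (h1 : ∀ ψ, Tst ψ → tsupport ψ ⊆ U → ∫ z, V z * sdz ψ i z = - ∫ z, D z * ψ z)
    {ψ : E3 × ℝ → ℝ} (hψ : Tst ψ) (hs : tsupport ψ ⊆ U) :
    (∫ z, V z * sdz ψ i z * V z) + (∫ z, V z * ψ z * D z) + (∫ z, D z * ψ z * V z) = 0 := by
  obtain ⟨δ, hδ, hδU⟩ := hψ.2.isCompact.exists_thickening_subset_open hU hs
  have hL2 : ∀ {f g : E3 × ℝ → ℝ}, MemLp f 2 → Tst g → MemLp (fun z => f z * g z) 2 := by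
    intro f g hf hg
    exact (hf.mul (hg.memLp ∞)).ae_eq (ae_of_all _ fun z => mul_comm _ _)
  have m1 := hL2 hV (hψ.sdz i)
  have m2 := hL2 hV hψ
  have m3 := hL2 hD hψ
  have s1 := hψ.cont.measurable
  have s2 := (hψ.sdz i).cont.measurable
  set B : E3 × ℝ → ℝ := fun y => (∫ z, V z * sdz ψ i z * V (z + y)) + (∫ z, V z * ψ z * D (z + y))
    + (∫ z, D z * ψ z * V (z + y)) with hB
  have hBc : Continuous B := ((corr_cont m1 hV).add (corr_cont m2 hD)).add (corr_cont m3 hV)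
  let φ : ℕ → ContDiffBump (0 : E3 × ℝ) := fun n => ⟨δ / 2 / (n + 2), δ / 2 / (n + 1), by positivity, by
    gcongr; linarith⟩
  have hφt : Tendsto (fun n => (φ n).rOut) atTop (nhds 0) := by
    have := tendsto_one_div_add_atTop_nhds_zero_nat (𝕜 := ℝ) |>.const_mul (δ / 2)
    simpa [φ, div_eq_mul_inv] using this
  have key : ∀ n, ((φ n).normed volume ⋆[ContinuousLinearMap.lsmul ℝ ℝ] B) 0 = 0 := by
    intro n
    set ρ := (φ n).normed volume with hρd
    have hρ : Tst ρ := ⟨(φ n).contDiff_normed, (φ n).hasCompactSupport_normed⟩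
    have hρs : tsupport ρ ⊆ Metric.closedBall 0 (δ / 2) := by
      rw [hρd, (φ n).tsupport_normed_eq]
      refine Metric.closedBall_subset_closedBall ?_
      exact div_le_self (by positivity) (by simp)
    set W := ρ ⋆[ContinuousLinearMap.lsmul ℝ ℝ] V with hWd
    have lV := hV.locallyIntegrable (by norm_num)
    have lD := hD.locallyIntegrable (by norm_num)
    have hW : Smo W := hρ.2.contDiff_convolution_left _ hρ.1 lV
    have hdW : ∀ z ∈ tsupport ψ, sdz W i z = (ρ ⋆[ContinuousLinearMap.lsmul ℝ ℝ] D) z := by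
      intro z hz
      have h := (hρ.2.hasFDerivAt_convolution_left (ContinuousLinearMap.lsmul ℝ ℝ) (hρ.1.of_le (by simp)) lV z).fderiv
      have hts : Tst (fun y => ρ (z - y)) := ⟨hρ.1.comp (contDiff_const.sub contDiff_id),
        hρ.2.comp_homeomorph (Homeomorph.subLeft z)⟩
      have hsp : tsupport (fun y => ρ (z - y)) ⊆ U := by
        refine subset_trans ?_ hδU
        intro y hy
        have hy' : z - y ∈ tsupport ρ := by
          have hcl : IsClosed ((fun y => z - y) ⁻¹' tsupport ρ) := (isClosed_tsupport _).preimage (by fun_prop)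
          exact (closure_minimal (t := (fun y => z - y) ⁻¹' tsupport ρ) (fun w hw => subset_tsupport ρ hw) hcl) hy
        have := hρs hy'
        rw [mem_closedBall_zero_iff, ← dist_eq_norm] at this
        rw [Metric.mem_thickening_iff]
        exact ⟨z, hz, by rw [dist_comm]; linarith⟩
      have h2 := h1 _ hts hsp
      rw [convolution_lsmul_swap]
      have e1 : ∀ y, sdz (fun y => ρ (z - y)) i y = - fderiv ℝ ρ (z - y) (EuclideanSpace.single i 1, 0) := by
        intro y
        unfold sdz
        have := ((hρ.1.differentiable (by simp)) (z - y)).hasFDerivAt.comp y ((hasFDerivAt_id y).const_sub z)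
        have := this.fderiv
        simp only [Function.comp_def] at this
        rw [this]; simp
      simp_rw [e1] at h2
      unfold sdz
      rw [hWd, h, convolution_eq_swap, ContinuousLinearMap.integral_apply]
      · simp only [ContinuousLinearMap.precompL_apply, ContinuousLinearMap.lsmul_apply, smul_eq_mul]
        simp only [mul_neg, integral_neg, neg_inj] at h2
        simp_rw [mul_comm _ (V _), mul_comm _ (D _)]
        exact h2
      · have := ((hρ.2.fderiv ℝ).convolutionExists_left ((ContinuousLinearMap.lsmul ℝ ℝ).precompL (E3 × ℝ))
          (hρ.1.continuous_fderiv (by simp)) lV z).integrable_swap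
        exact this
    have ht := h1 _ (hψ.smul hW) ((closure_mono (Function.support_mul_subset_right _ _)).trans hs)
    have hi : ∀ {f g : E3 × ℝ → ℝ}, MemLp f 2 → Tst g → Integrable (fun z => f z * g z) := fun hf hg =>
      hf.integrable_mul (hg.memLp 2)
    have e3 : ∀ z, V z * sdz (fun z => W z * ψ z) i z =
        V z * sdz ψ i z * W z + V z * ψ z * (ρ ⋆[ContinuousLinearMap.lsmul ℝ ℝ] D) z := by
      intro z
      rw [sdz_mul hW hψ.1]
      by_cases hz : z ∈ tsupport ψ
      · rw [hdW z hz]; ring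
      · rw [image_eq_zero_of_notMem_tsupport hz]; ring
    have sD : Smo (ρ ⋆[ContinuousLinearMap.lsmul ℝ ℝ] D) := hρ.2.contDiff_convolution_left _ hρ.1 lD
    have j1 : Integrable (fun z => V z * sdz ψ i z * W z) :=
      (hi hV ((hψ.sdz i).smul hW)).congr (ae_of_all _ fun z => by simp only; ring)
    have j2 : Integrable (fun z => V z * ψ z * (ρ ⋆[ContinuousLinearMap.lsmul ℝ ℝ] D) z) :=
      (hi hV (hψ.smul sD)).congr (ae_of_all _ fun z => by simp only; ring)
    simp_rw [e3] at ht
    have f1 := mol_corr (H := fun z => V z * sdz ψ i z) (hVm.mul s2) hVm m1 hV hρ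
    have f2 := mol_corr (H := fun z => V z * ψ z) (hVm.mul s1) hDm m2 hD hρ
    have f3 := mol_corr (H := fun z => D z * ψ z) (hDm.mul s1) hVm m3 hV hρ
    rw [integral_add j1 j2, f1, f2] at ht
    have e4 : ∫ z, D z * (W z * ψ z) = ∫ z, D z * ψ z * W z := by congr 1; ext z; ring
    rw [e4, f3] at ht
    have cE : ∀ {H V : E3 × ℝ → ℝ}, MemLp H 2 → MemLp V 2 →
        Integrable (fun t => ρ t * ∫ z, H z * V (z + (0 - t))) := by
      intro H V hH hV
      have := (corr_cont hH hV).comp ((continuous_const (y := (0 : E3 × ℝ))).sub continuous_id)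
      exact (hρ.cont.mul this).integrable_of_hasCompactSupport hρ.2.mul_right
    simp only [convolution_def, ContinuousLinearMap.lsmul_apply, smul_eq_mul] at ht ⊢
    simp only [hB, mul_add]
    rw [integral_add _ (cE m3 hV), integral_add (cE m1 hV) (cE m2 hD)]
    · linarith
    · exact (cE m1 hV).add (cE m2 hD)
  have hlim := ContDiffBump.convolution_tendsto_right_of_continuous (μ := volume) hφt hBc 0
  simp_rw [key] at hlim
  have := tendsto_nhds_unique hlim tendsto_const_nhds
  simpa [hB] using this

lemma V1 {Ω : Set E3} {T : ℝ} {v : E3 × ℝ → ℝ} {D : E3 × ℝ → ℝ} (hΩ : IsOpen Ω) (i : Fin 3)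
    (hw : ∀ ψ : E3 → ℝ, ContDiff ℝ (⊤ : ℕ∞) ψ → HasCompactSupport ψ → tsupport ψ ⊆ Ω →
    ∀ᵐ t ∂(volume.restrict (Ioo 0 T)),
      ∫ x in Ω, v (x, t) * fderiv ℝ ψ x (EuclideanSpace.single i 1) =
        - ∫ x in Ω, D (x, t) * ψ x)
    (hv : MemLp ((Ω ×ˢ Ioo 0 T).indicator v) 2) (hD : MemLp ((Ω ×ˢ Ioo 0 T).indicator D) 2)
    {ψ : E3 × ℝ → ℝ} (hψ : Tst ψ) (hs : tsupport ψ ⊆ Ω ×ˢ Ioo 0 T) :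
    ∫ z, (Ω ×ˢ Ioo 0 T).indicator v z * sdz ψ i z = - ∫ z, (Ω ×ˢ Ioo 0 T).indicator D z * ψ z := by
  set V := (Ω ×ˢ Ioo 0 T).indicator v with hVd
  set G := (Ω ×ˢ Ioo 0 T).indicator D with hGd
  have hi1 : Integrable (fun z => V z * sdz ψ i z) := hv.integrable_mul ((hψ.sdz i).memLp 2)
  have hi2 : Integrable (fun z => G z * ψ z) := hD.integrable_mul (hψ.memLp 2)
  rw [show (volume : Measure (E3 × ℝ)) = volume.prod volume from rfl] at hi1 hi2 ⊢
  rw [integral_prod_symm _ hi1, integral_prod_symm _ hi2, ← integral_neg]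
  refine integral_congr_ae ?_
  -- slices of tests
  have hsl : ∀ q : ℝ, tsupport (fun x => ψ (x, q)) ⊆ Ω := by
    intro q x hx
    have : (x, q) ∈ tsupport ψ := by
      have hcl : IsClosed ((fun x : E3 => (x, q)) ⁻¹' tsupport ψ) :=
        (isClosed_tsupport _).preimage (by fun_prop)
      exact (closure_minimal (t := (fun x : E3 => (x, q)) ⁻¹' tsupport ψ)
        (fun y hy => subset_tsupport ψ hy) hcl) hx
    exact (hs this).1
  have hq : ∀ᵐ t ∂(volume : Measure ℝ), ∀ q : ℚ, t ∈ Ioo 0 T →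
      ∫ x in Ω, v (x, t) * sdz ψ i (x, q) = - ∫ x in Ω, D (x, t) * ψ (x, q) := by
    rw [ae_all_iff]; intro q
    have := hw _ (Smo.slice hψ.1 (q : ℝ)) (hψ.slice_cs _) (hsl q)
    rw [ae_restrict_iff' measurableSet_Ioo] at this
    filter_upwards [this] with t ht hm
    simpa only [sdz_slice hψ.1] using ht hm
  have hloc : ∀ {f : E3 × ℝ → ℝ}, MemLp f 2 → ∀ᵐ t ∂(volume : Measure ℝ), LocallyIntegrable (fun x => f (x, t)) := by
    intro f hf
    have hf2 : Integrable (fun z => f z ^ 2) ((volume : Measure E3).prod volume) := hf.integrable_sq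
    have hm := (show AEStronglyMeasurable f ((volume : Measure E3).prod (volume : Measure ℝ)) from hf.1).prod_swap
    filter_upwards [hf2.prod_left_ae, AEStronglyMeasurable.prodMk_left hm] with t h1 h2
    exact MemLp.locallyIntegrable ((memLp_two_iff_integrable_sq h2).2 h1) (by norm_num)
  obtain hK := hψ.2.isCompact.image continuous_fst
  filter_upwards [hq, hloc hv, hloc hD] with t ht l1 l2
  by_cases htT : t ∈ Ioo 0 T
  · have hc : ∀ {f g : E3 × ℝ → ℝ}, LocallyIntegrable (fun x => f (x, t)) → Tst g → tsupport g ⊆ tsupport ψ →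
        Continuous (fun q : ℝ => ∫ x, f (x, t) * g (x, q)) := by
      intro f g hf hg hgs
      rw [← continuousOn_univ]
      refine continuousOn_integral_bilinear_of_locally_integrable_of_compact_support
        (ContinuousLinearMap.mul ℝ ℝ) (f := fun q x => g (x, q)) (g := fun x => f (x, t)) hK ?_ ?_
        (hf.integrableOn_isCompact hK)
      · have := hg.cont
        refine Continuous.continuousOn ?_
        exact this.comp (continuous_snd.prodMk continuous_fst)
      · intro p x _ hx
        exact image_eq_zero_of_notMem_tsupport fun h => hx ⟨(x, p), hgs h, rfl⟩
    have e : ∀ {f g : E3 × ℝ → ℝ} (q : ℝ), ∫ x in Ω, f (x, t) * g (x, q) =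
        ∫ x, (Ω ×ˢ Ioo 0 T).indicator f (x, t) * g (x, q) := by
      intro f g q
      rw [← integral_indicator hΩ.measurableSet]
      congr 1; ext x
      by_cases hx : x ∈ Ω
      · simp only [indicator_of_mem hx]
        rw [indicator_of_mem (show (x, t) ∈ Ω ×ˢ Ioo 0 T from ⟨hx, htT⟩)]
      · rw [indicator_of_notMem hx, indicator_of_notMem (fun h => hx h.1)]; simp
    have c1 := hc l1 (hψ.sdz i) (tsupport_sdz _ _)
    have c2 := (hc l2 hψ subset_rfl).neg
    have := Rat.denseRange_cast.equalizer c1 c2 (by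
      ext q
      have := ht q htT
      rw [e (f := v), e (f := D) (g := ψ)] at this
      exact this)
    exact congrFun this t
  · have : ∀ x, (x, t) ∉ Ω ×ˢ Ioo 0 T := fun x h => htT h.2
    simp [hVd, hGd, this]


/-- local weak form of the equations -/
structure NSF (U : Set (E3 × ℝ)) (v : Fin 3 → E3 × ℝ → ℝ) (W : Fin 3 → Fin 3 → E3 × ℝ → ℝ) : Prop where
  mv : ∀ j, Measurable (v j)
  mW : ∀ i j, Measurable (W i j)
  v2 : ∀ j, MemLp (v j) 2
  W2 : ∀ i j, MemLp (W i j) 2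
  el : ∀ ψ, Tst ψ → tsupport ψ ⊆ U → ∀ a, - ∫ z, v a z * (∑ b, sdz (sdz ψ b) b z) = ∑ b, ∫ z, W b a z * sdz ψ b z
  ve : ∀ ψ, Tst ψ → tsupport ψ ⊆ U → ∀ a b, ∫ z, W b a z * (- tdz ψ z - ∑ j, sdz (sdz ψ j) j z) =
    ∫ z, ((∑ j, v j z * W j a z) * sdz ψ b z - (∑ j, v j z * W j b z) * sdz ψ a z)

lemma comp_fd {φ : E3 × ℝ → E3} (h : ContDiff ℝ (⊤ : ℕ∞) φ) (z e : E3 × ℝ) (i : Fin 3) :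
    (fderiv ℝ φ z e) i = fderiv ℝ (fun w => φ w i) z e := by
  have hd := ((h.differentiable (by simp)) z).hasFDerivAt
  have := ((EuclideanSpace.proj i : E3 →L[ℝ] ℝ).hasFDerivAt.comp z hd).fderiv
  simp only [Function.comp_def] at this
  have e1 : (fun w => (EuclideanSpace.proj i : E3 →L[ℝ] ℝ) (φ w)) = fun w => φ w i := rfl
  rw [e1] at this
  rw [this]; rfl

section
variable {Ω : Set E3} {T : ℝ} {v : E3 × ℝ → E3} {Dv : E3 × ℝ → Fin 3 → Fin 3 → ℝ} {p : E3 × ℝ → ℝ} {v₀ : E3 → E3}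

/-- extension by zero of velocity -/
def Vx (Ω : Set E3) (T : ℝ) (v : E3 × ℝ → E3) (j : Fin 3) : E3 × ℝ → ℝ := (Ω ×ˢ Ioo 0 T).indicator fun z => v z j
/-- extension by zero of gradient -/
def Dx (Ω : Set E3) (T : ℝ) (Dv : E3 × ℝ → Fin 3 → Fin 3 → ℝ) (i j : Fin 3) : E3 × ℝ → ℝ :=
  (Ω ×ˢ Ioo 0 T).indicator fun z => Dv z i j

lemma flow (hΩ : IsOpen Ω) (hsol : IsSuitableWeakSolution Ω T v Dv p v₀) :
    NSF (Ω ×ˢ Ioo 0 T) (Vx Ω T v) (fun i j z => Dx Ω T Dv i j z - Dx Ω T Dv j i z) := by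
  have hQo : IsOpen (Ω ×ˢ Ioo 0 T) := hΩ.prod isOpen_Ioo
  have hQm := hQo.measurableSet
  have mv0 : ∀ j, Measurable fun z => v z j := fun j => by
    exact (EuclideanSpace.proj j : E3 →L[ℝ] ℝ).continuous.measurable.comp hsol.meas_v
  have mD0 : ∀ i j, Measurable fun z => Dv z i j := fun i j =>
    (measurable_pi_apply j).comp ((measurable_pi_apply i).comp hsol.meas_Dv)
  have mv : ∀ j, Measurable (Vx Ω T v j) := fun j => (mv0 j).indicator hQm
  have mD : ∀ i j, Measurable (Dx Ω T Dv i j) := fun i j => (mD0 i j).indicator hQm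
  have hmem : ∀ {f : E3 × ℝ → ℝ}, Measurable f →
      (∀ z, f z ^ 2 ≤ ‖v z‖ ^ 2 + ∑ i, ∑ j, (Dv z i j) ^ 2) → MemLp ((Ω ×ˢ Ioo 0 T).indicator f) 2 := by
    intro f hf hle
    rw [memLp_indicator_iff_restrict hQm, memLp_two_iff_integrable_sq hf.aestronglyMeasurable]
    refine hsol.v_l2_w12.mono' (hf.pow_const 2).aestronglyMeasurable (ae_of_all _ fun z => ?_)
    rw [Real.norm_eq_abs, abs_of_nonneg (sq_nonneg _)]; exact hle z
  have v2 : ∀ j, MemLp (Vx Ω T v j) 2 := fun j => hmem (mv0 j) fun z => by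
    have h1 : v z j ^ 2 ≤ ‖v z‖ ^ 2 := by
      rw [← sq_abs]; exact pow_le_pow_left₀ (abs_nonneg _) (coord_le _ _) 2
    have : 0 ≤ ∑ i, ∑ j, (Dv z i j) ^ 2 := by positivity
    linarith
  have D2 : ∀ i j, MemLp (Dx Ω T Dv i j) 2 := fun i j => hmem (mD0 i j) fun z => by
    have h1 : Dv z i j ^ 2 ≤ ∑ j, Dv z i j ^ 2 :=
      Finset.single_le_sum (f := fun j => Dv z i j ^ 2) (fun i _ => sq_nonneg _) (Finset.mem_univ j)
    have h2 : ∑ j, Dv z i j ^ 2 ≤ ∑ i, ∑ j, Dv z i j ^ 2 :=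
      Finset.single_le_sum (f := fun i => ∑ j, Dv z i j ^ 2) (fun i _ => by positivity) (Finset.mem_univ i)
    nlinarith [sq_nonneg ‖v z‖]
  have hV1 : ∀ i j ψ, Tst ψ → tsupport ψ ⊆ Ω ×ˢ Ioo 0 T →
      ∫ z, Vx Ω T v j z * sdz ψ i z = - ∫ z, Dx Ω T Dv i j z * ψ z := fun i j ψ hψ hs =>
    V1 hΩ i (fun φ h1 h2 h3 => by
      filter_upwards [hsol.weak_grad φ h1 h2 h3] with t ht
      exact ht i j) (v2 j) (D2 i j) hψ hs
  have hV2 : ∀ i j ψ, Tst ψ → tsupport ψ ⊆ Ω ×ˢ Ioo 0 T →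
      2 * ∫ z, Vx Ω T v j z * Dx Ω T Dv i j z * ψ z = - ∫ z, Vx Ω T v j z * Vx Ω T v j z * sdz ψ i z := by
    intro i j ψ hψ hs
    have := V2 hQo (mv j) (mD i j) (v2 j) (D2 i j) i (hV1 i j) hψ hs
    have e1 : ∫ z, Vx Ω T v j z * sdz ψ i z * Vx Ω T v j z = ∫ z, Vx Ω T v j z * Vx Ω T v j z * sdz ψ i z := by
      congr 1; ext z; ring
    have e2 : ∫ z, Vx Ω T v j z * ψ z * Dx Ω T Dv i j z = ∫ z, Vx Ω T v j z * Dx Ω T Dv i j z * ψ z := by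
      congr 1; ext z; ring
    have e3 : ∫ z, Dx Ω T Dv i j z * ψ z * Vx Ω T v j z = ∫ z, Vx Ω T v j z * Dx Ω T Dv i j z * ψ z := by
      congr 1; ext z; ring
    rw [e1, e2, e3] at this; linarith
  have hi : ∀ {f g : E3 × ℝ → ℝ}, MemLp f 2 → Tst g → Integrable (fun z => f z * g z) := fun hf hg =>
    hf.integrable_mul (hg.memLp 2)
  have hi3 : ∀ {f f' g : E3 × ℝ → ℝ}, MemLp f 2 → MemLp f' 2 → Tst g → Integrable (fun z => f z * f' z * g z) := by
    intro f f' g hf hf' hg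
    obtain ⟨C, _, hb⟩ := hg.bdd
    exact (hf.integrable_mul hf').mul_bdd (c := C) hg.cont.aestronglyMeasurable (ae_of_all _ hb)
  have tS : ∀ {ψ : E3 × ℝ → ℝ} (i), tsupport ψ ⊆ Ω ×ˢ Ioo 0 T → tsupport (sdz ψ i) ⊆ Ω ×ˢ Ioo 0 T :=
    fun i h => (tsupport_sdz _ _).trans h
  refine ⟨mv, fun i j => (mD i j).sub (mD j i), v2, fun i j => (D2 i j).sub (D2 j i), ?_, ?_⟩
  · intro ψ hψ hs a
    have h1 : ∫ z, Vx Ω T v a z * (∑ b, sdz (sdz ψ b) b z) = ∑ b, - ∫ z, Dx Ω T Dv b a z * sdz ψ b z := by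
      simp_rw [Finset.mul_sum]
      rw [integral_finsetSum _ fun b _ => hi (v2 a) ((hψ.sdz b).sdz b)]
      exact Finset.sum_congr rfl fun b _ => hV1 b a _ (hψ.sdz b) (tS b hs)
    have h2 : ∑ b, ∫ z, Dx Ω T Dv a b z * sdz ψ b z = 0 := by
      have := hsol.div_free (sdz ψ a) (hψ.sdz a).1 (hψ.sdz a).2 (tS a hs)
      rw [← integral_indicator hQm] at this
      have e : ∀ z, (Ω ×ˢ Ioo 0 T).indicator (fun z => ∑ i, v z i * sdz (sdz ψ a) i z) z =
          ∑ i, Vx Ω T v i z * sdz (sdz ψ i) a z := by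
        intro z
        by_cases hz : z ∈ Ω ×ˢ Ioo 0 T
        · simp only [Vx, indicator_of_mem hz]
          simp_rw [sdz_comm hψ.1 a]
        · simp only [Vx, indicator_of_notMem hz]; simp
      simp_rw [e] at this
      rw [integral_finsetSum _ fun b _ => hi (v2 b) ((hψ.sdz b).sdz a)] at this
      simp_rw [fun b => hV1 a b _ (hψ.sdz b) (tS b hs), Finset.sum_neg_distrib] at this
      linarith
    rw [h1]
    simp only [sub_mul]
    simp_rw [fun b => integral_sub (hi (D2 b a) (hψ.sdz b)) (hi (D2 a b) (hψ.sdz b)), Finset.sum_sub_distrib,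
      h2, Finset.sum_neg_distrib]
    ring
  · intro ψ hψ hs a b
    let φ : E3 × ℝ → E3 := fun z => (sdz ψ b z) • EuclideanSpace.single a (1 : ℝ) - (sdz ψ a z) • EuclideanSpace.single b (1 : ℝ)
    have hφ : ContDiff ℝ (⊤ : ℕ∞) φ :=
      ((hψ.sdz b).1.smul contDiff_const).sub ((hψ.sdz a).1.smul contDiff_const)
    have hφi : ∀ i, (fun z => φ z i) = fun z => (if i = a then 1 else 0) * sdz ψ b z + (-(if i = b then 1 else 0)) * sdz ψ a z := by
      intro i; ext z; simp [φ, sub_eq_add_neg]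
    have hφs : tsupport φ ⊆ tsupport ψ := by
      refine closure_minimal (fun z hz => ?_) (isClosed_tsupport _)
      by_contra hc
      refine hz ?_
      have : ∀ i, sdz ψ i z = 0 := fun i => image_eq_zero_of_notMem_tsupport fun h => hc (tsupport_sdz _ _ h)
      simp [φ, this]
    have hφc : HasCompactSupport φ := hψ.2.of_isClosed_subset (isClosed_tsupport _) hφs
    have hw := hsol.weak_nse φ hφ hφc ((hφs.trans hs).trans (prod_mono subset_rfl Ioo_subset_Iio_self))
    have hs' : ∀ j z i, sdz φ j z i = (if i = a then 1 else 0) * sdz (sdz ψ b) j z + (-(if i = b then 1 else 0)) * sdz (sdz ψ a) j z := by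
      intro j z i
      have := comp_fd hφ z (EuclideanSpace.single j 1, 0) i
      rw [hφi] at this
      refine this.trans ?_
      change sdz _ j z = _
      rw [sdz_add (((hψ.sdz b).const_mul _).1) (((hψ.sdz a).const_mul _).1), sdz_cmul _ (hψ.sdz b).1, sdz_cmul _ (hψ.sdz a).1]
    have ht' : ∀ z i, tdz φ z i = (if i = a then 1 else 0) * tdz (sdz ψ b) z + (-(if i = b then 1 else 0)) * tdz (sdz ψ a) z := by
      intro z i
      have := comp_fd hφ z (0, 1) i
      rw [hφi] at this
      refine this.trans ?_
      change tdz _ z = _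
      rw [tdz_add (((hψ.sdz b).const_mul _).1) (((hψ.sdz a).const_mul _).1), tdz_cmul _ (hψ.sdz b).1, tdz_cmul _ (hψ.sdz a).1]
    have hr : ∫ x in Ω, ∑ i, v₀ x i * φ (x, 0) i = 0 := by
      have : ∀ x, φ (x, 0) = 0 := fun x => image_eq_zero_of_notMem_tsupport fun h => by
        have := (hs (hφs h)).2.1
        simp at this
      simp [this]
    rw [hr, ← integral_indicator hQm] at hw
    set V := Vx Ω T v
    set D := Dx Ω T Dv
    have e : ∀ z, (Ω ×ˢ Ioo 0 T).indicator (fun z => (-(∑ i, v z i * tdz φ z i) + (∑ i, ∑ j, v z j * Dv z j i * φ z i)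
          + (∑ i, ∑ j, Dv z j i * sdz φ j z i) - p z * ∑ i, sdz φ i z i)) z =
        ((V b z * sdz (tdz ψ) a z - V a z * sdz (tdz ψ) b z)
          + ∑ j, (V j z * D j a z * sdz ψ b z - V j z * D j b z * sdz ψ a z))
          + ∑ j, (D j a z * sdz (sdz ψ j) b z - D j b z * sdz (sdz ψ j) a z) := by
      intro z
      by_cases hz : z ∈ Ω ×ˢ Ioo 0 T
      · have q1 : ∀ i, φ z i = (if i = a then 1 else 0) * sdz ψ b z + (-(if i = b then 1 else 0)) * sdz ψ a z :=
          fun i => congrFun (hφi i) z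
        have q2 : ∑ i, sdz φ i z i = 0 := by
          simp only [hs', Finset.sum_add_distrib]
          simp [sdz_comm hψ.1 b a]
        rw [indicator_of_mem hz, q2]
        simp only [hs', ht', q1, V, D, Vx, Dx, indicator_of_mem hz, sdz_tdz hψ.1, sdz_comm hψ.1 _ a, sdz_comm hψ.1 _ b]
        simp only [mul_add, Finset.sum_add_distrib, Finset.sum_sub_distrib]
        rw [Finset.sum_comm (f := fun i j => v z j * Dv z j i * ((if i = a then 1 else 0) * sdz ψ b z)),
          Finset.sum_comm (f := fun i j => v z j * Dv z j i * (-(if i = b then 1 else 0) * sdz ψ a z)),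
          Finset.sum_comm (f := fun i j => Dv z j i * ((if i = a then 1 else 0) * sdz (sdz ψ b) j z)),
          Finset.sum_comm (f := fun i j => Dv z j i * (-(if i = b then 1 else 0) * sdz (sdz ψ a) j z))]
        simp
        ring
      · simp only [V, D, Vx, Dx, indicator_of_notMem hz]; simp
    simp_rw [e] at hw
    have iB : ∀ j, Integrable fun z => V j z * D j a z * sdz ψ b z - V j z * D j b z * sdz ψ a z := fun j =>
      (hi3 (v2 j) (D2 j a) (hψ.sdz b)).sub (hi3 (v2 j) (D2 j b) (hψ.sdz a))
    have iC : ∀ j, Integrable fun z => D j a z * sdz (sdz ψ j) b z - D j b z * sdz (sdz ψ j) a z := fun j =>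
      (hi (D2 j a) ((hψ.sdz j).sdz b)).sub (hi (D2 j b) ((hψ.sdz j).sdz a))
    have iA : Integrable fun z => V b z * sdz (tdz ψ) a z - V a z * sdz (tdz ψ) b z :=
      (hi (v2 b) (hψ.tdz.sdz a)).sub (hi (v2 a) (hψ.tdz.sdz b))
    have iB' := integrable_finsetSum Finset.univ fun j _ => iB j
    have iC' := integrable_finsetSum Finset.univ fun j _ => iC j
    have eA : ∫ z, (V b z * sdz (tdz ψ) a z - V a z * sdz (tdz ψ) b z) = ∫ z, (D b a z - D a b z) * tdz ψ z := by
      rw [integral_sub (hi (v2 b) (hψ.tdz.sdz a)) (hi (v2 a) (hψ.tdz.sdz b)),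
        hV1 a b _ hψ.tdz ((tsupport_tdz _).trans hs), hV1 b a _ hψ.tdz ((tsupport_tdz _).trans hs)]
      simp only [sub_mul]
      rw [integral_sub (hi (D2 b a) hψ.tdz) (hi (D2 a b) hψ.tdz)]
      ring
    have eC : ∀ j, ∫ z, (D j a z * sdz (sdz ψ j) b z - D j b z * sdz (sdz ψ j) a z) =
        ∫ z, (D b a z - D a b z) * sdz (sdz ψ j) j z := by
      intro j
      have q : ∀ a b, ∫ z, D j a z * sdz (sdz ψ j) b z = ∫ z, D b a z * sdz (sdz ψ j) j z := by
        intro a b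
        have r1 := hV1 j a _ ((hψ.sdz j).sdz b) (tS _ (tS _ hs))
        have r2 := hV1 b a _ ((hψ.sdz j).sdz j) (tS _ (tS _ hs))
        rw [sdz_comm (hψ.sdz j).1 b j] at r1
        linarith
      rw [integral_sub (hi (D2 j a) ((hψ.sdz j).sdz b)) (hi (D2 j b) ((hψ.sdz j).sdz a)), q a b, q b a]
      simp only [sub_mul]
      rw [integral_sub (hi (D2 b a) ((hψ.sdz j).sdz j)) (hi (D2 a b) ((hψ.sdz j).sdz j))]
    have eB : ∀ j, ∫ z, (V j z * D j a z * sdz ψ b z - V j z * D j b z * sdz ψ a z) =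
        ∫ z, (V j z * (D j a z - D a j z) * sdz ψ b z - V j z * (D j b z - D b j z) * sdz ψ a z) := by
      intro j
      have r1 := hV2 a j _ (hψ.sdz b) (tS _ hs)
      have r2 := hV2 b j _ (hψ.sdz a) (tS _ hs)
      rw [sdz_comm hψ.1 b a] at r1
      have k1 := hi3 (v2 j) (D2 a j) (hψ.sdz b)
      have k2 := hi3 (v2 j) (D2 b j) (hψ.sdz a)
      have k3 : Integrable fun z => V j z * D a j z * sdz ψ b z - V j z * D b j z * sdz ψ a z := k1.sub k2
      have : ∫ z, (V j z * D a j z * sdz ψ b z - V j z * D b j z * sdz ψ a z) = 0 := by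
        rw [integral_sub k1 k2]; linarith
      rw [← sub_zero (∫ z, (V j z * D j a z * sdz ψ b z - V j z * D j b z * sdz ψ a z)), ← this, ← integral_sub (iB j) k3]
      congr 1; ext z; ring
    have iB2 : ∀ j, Integrable fun z => (V j z * (D j a z - D a j z) * sdz ψ b z - V j z * (D j b z - D b j z) * sdz ψ a z) := fun j =>
      (hi3 (v2 j) ((D2 j a).sub (D2 a j)) (hψ.sdz b)).sub (hi3 (v2 j) ((D2 j b).sub (D2 b j)) (hψ.sdz a))
    have iAB : Integrable fun z => (V b z * sdz (tdz ψ) a z - V a z * sdz (tdz ψ) b z) +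
        ∑ j, (V j z * D j a z * sdz ψ b z - V j z * D j b z * sdz ψ a z) := iA.add iB'
    rw [integral_add iAB iC', integral_add iA iB', integral_finsetSum _ fun j _ => iB j,
      integral_finsetSum _ fun j _ => iC j, eA] at hw
    simp_rw [eB, eC] at hw
    have dW := (D2 b a).sub (D2 a b)
    have dWi : ∀ j, Integrable fun z => (D b a z - D a b z) * sdz (sdz ψ j) j z := fun j => hi dW ((hψ.sdz j).sdz j)
    rw [← integral_finsetSum _ fun j _ => iB2 j, ← integral_finsetSum _ fun j _ => dWi j] at hw
    have f1 : ∫ z, (D b a z - D a b z) * (-tdz ψ z - ∑ j, sdz (sdz ψ j) j z) =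
        - (∫ z, (D b a z - D a b z) * tdz ψ z) - ∫ z, ∑ j, (D b a z - D a b z) * sdz (sdz ψ j) j z := by
      rw [← integral_neg, ← integral_sub]
      · congr 1; ext z; rw [← Finset.mul_sum]; ring
      · exact (hi dW hψ.tdz).neg
      · exact integrable_finsetSum Finset.univ fun j _ => hi dW ((hψ.sdz j).sdz j)
    have f2 : ∀ z, ((∑ j, V j z * (D j a z - D a j z)) * sdz ψ b z - (∑ j, V j z * (D j b z - D b j z)) * sdz ψ a z) =
        ∑ j, (V j z * (D j a z - D a j z) * sdz ψ b z - V j z * (D j b z - D b j z) * sdz ψ a z) := by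
      intro z; rw [Finset.sum_sub_distrib, Finset.sum_mul, Finset.sum_mul]
    simp_rw [f2]
    rw [f1]
    linarith
end


lemma pcyl_open (z : E3 × ℝ) (r : ℝ) : IsOpen (pcyl z r) := Metric.isOpen_ball.prod isOpen_Ioo

/-- cutoff functions -/
structure Cut (z₀ : E3 × ℝ) (ρ' ρ : ℝ) (η : E3 × ℝ → ℝ) : Prop where
  tst : Tst η
  nn : ∀ z, 0 ≤ η z
  le : ∀ z, η z ≤ 1
  one : ∀ z ∈ pcyl z₀ ρ', η z = 1
  sup : ∀ z ∈ tsupport η, z.2 < z₀.2 → z ∈ pcyl z₀ ρ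

lemma cutoff (z₀ : E3 × ℝ) {ρ' ρ : ℝ} (h0 : 0 < ρ') (h1 : ρ' < ρ) : ∃ η, Cut z₀ ρ' ρ η := by
  set m := (ρ' + ρ) / 2 with hm
  have m1 : ρ' < m := by rw [hm]; linarith
  have m2 : m < ρ := by rw [hm]; linarith
  have q1 : ρ' ^ 2 < m ^ 2 := by gcongr
  have q2 : m ^ 2 < ρ ^ 2 := by have := h0.trans m1; gcongr
  let a : ContDiffBump z₀.1 := ⟨ρ', m, h0, m1⟩
  let b : ContDiffBump z₀.2 := ⟨ρ' ^ 2, m ^ 2, by positivity, q1⟩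
  have hs : ∀ z : E3 × ℝ, a z.1 * b z.2 ≠ 0 → z ∈ Metric.closedBall z₀.1 m ×ˢ Metric.closedBall z₀.2 (m ^ 2) := by
    intro z hz
    have e1 : a z.1 ≠ 0 := left_ne_zero_of_mul hz
    have e2 : b z.2 ≠ 0 := right_ne_zero_of_mul hz
    refine ⟨?_, ?_⟩
    · have : z.1 ∈ Function.support a := e1
      rw [a.support_eq] at this; exact Metric.ball_subset_closedBall this
    · have : z.2 ∈ Function.support b := e2
      rw [b.support_eq] at this; exact Metric.ball_subset_closedBall this
  have hts : tsupport (fun z : E3 × ℝ => a z.1 * b z.2) ⊆ Metric.closedBall z₀.1 m ×ˢ Metric.closedBall z₀.2 (m ^ 2) :=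
    closure_minimal (fun z hz => hs z hz) (Metric.isClosed_closedBall.prod Metric.isClosed_closedBall)
  refine ⟨fun z => a z.1 * b z.2, ⟨?_, ?_⟩, fun z => mul_nonneg a.nonneg b.nonneg,
    fun z => mul_le_one₀ a.le_one b.nonneg b.le_one, ?_, ?_⟩
  · exact (a.contDiff.comp contDiff_fst).mul (b.contDiff.comp contDiff_snd)
  · exact ((isCompact_closedBall _ _).prod (isCompact_closedBall _ _)).of_isClosed_subset (isClosed_tsupport _) hts
  · rintro z ⟨hz1, hz2⟩
    have e1 : a z.1 = 1 := a.one_of_mem_closedBall (Metric.ball_subset_closedBall hz1)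
    have e2 : b z.2 = 1 := b.one_of_mem_closedBall (by
      rw [Metric.mem_closedBall, Real.dist_eq, abs_le]; constructor <;> simp only [b] <;> linarith [hz2.1, hz2.2])
    simp [e1, e2]
  · intro z hz h2
    obtain ⟨c1, c2⟩ := hts hz
    rw [Metric.mem_closedBall, Real.dist_eq, abs_le] at c2
    exact ⟨lt_of_le_of_lt c1 m2, by linarith, h2⟩

/-- local form of a scalar equation -/
structure LF (κ : ℝ) (Q : Set (E3 × ℝ)) (u : E3 × ℝ → ℝ) (k : Fin 3 → E3 × ℝ → ℝ) : Prop where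
  mu : Measurable u
  mkk : ∀ b, Measurable (k b)
  u1 : IntegrableOn u Q
  k1 : ∀ b, IntegrableOn (k b) Q
  eq : ∀ ψ, Tst ψ → tsupport ψ ⊆ Q → ∫ z in Q, u z * (- κ * tdz ψ z - ∑ b, sdz (sdz ψ b) b z) =
    ∫ z in Q, ∑ b, k b z * sdz ψ b z

lemma LF_loc {κ ρ ρ' : ℝ} {z₀ : E3 × ℝ} {u η F : E3 × ℝ → ℝ} {k : Fin 3 → E3 × ℝ → ℝ} (hκ : 0 ≤ κ)
    (h : LF κ (pcyl z₀ ρ) u k) (hη : Cut z₀ ρ' ρ η) (hF : Tst F) {t1 : ℝ} (ht : t1 < z₀.2)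
    (hF0 : ∀ z : E3 × ℝ, t1 ≤ z.2 → F z = 0) :
    ∫ z in pcyl z₀ ρ, η z * u z * F z = (∫ z in pcyl z₀ ρ, ∑ b, k b z * (η z * sdz (Sop κ F) b z)) +
      ∫ z in pcyl z₀ ρ, (u z * ((η z + κ * tdz η z + ∑ i, sdz (sdz η i) i z) * Sop κ F z + ∑ i, 2 * sdz η i z * sdz (Sop κ F) i z)
        + ∑ b, k b z * (sdz η b z * Sop κ F z)) := by
  set φ := Sop κ F with hφ
  have sφ : Smo φ := Sop_smo hF
  have sη : Smo η := hη.tst.1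
  have tψ : Tst fun z => η z * φ z := ⟨sη.mul sφ, hη.tst.2.mul_right⟩
  have z0 : ∀ z : E3 × ℝ, t1 ≤ z.2 → φ z = 0 := fun z hz => SK_zero hκ hF0 z hz
  have ts : tsupport (fun z => η z * φ z) ⊆ pcyl z₀ ρ := by
    intro z hz
    have c1 : z ∈ tsupport η := tsupport_mul_subset_left hz
    have c2 : z ∈ tsupport φ := tsupport_mul_subset_right hz
    have c3 : tsupport φ ⊆ (Prod.snd : E3 × ℝ → ℝ) ⁻¹' (Iic t1) :=
      closure_minimal (fun w hw => by
        by_contra hc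
        simp only [mem_preimage, mem_Iic, not_le] at hc
        exact hw (z0 w hc.le)) (isClosed_Iic.preimage continuous_snd)
    exact hη.sup z c1 (lt_of_le_of_lt (c3 c2) ht)
  have key := h.eq _ tψ ts
  have d1 : ∀ b, sdz (fun z => η z * φ z) b = fun z => η z * sdz φ b z + sdz η b z * φ z := fun b => by
    ext z; rw [sdz_mul sη sφ]; ring
  have d2 : ∀ b z, sdz (sdz (fun z => η z * φ z) b) b z =
      η z * sdz (sdz φ b) b z + 2 * sdz η b z * sdz φ b z + sdz (sdz η b) b z * φ z := fun b z => by
    rw [d1, sdz_add (sη.mul (sφ.sdz b)) ((sη.sdz b).mul sφ), sdz_mul sη (sφ.sdz b), sdz_mul (sη.sdz b) sφ]; ring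
  have d3 : ∀ z, F z = - κ * tdz φ z - (∑ i, sdz (sdz φ i) i z) + φ z := fun z => by
    have := congrFun (Sop_Lop (κ := κ) hF) z
    rw [← this]; rfl
  -- integrability
  have bi : ∀ {w : E3 × ℝ → ℝ}, IntegrableOn w (pcyl z₀ ρ) → ∀ {f : E3 × ℝ → ℝ}, Tst f → IntegrableOn (fun z => w z * f z) (pcyl z₀ ρ) := by
    intro w hw f hf
    obtain ⟨C, _, hb⟩ := hf.bdd
    exact hw.mul_bdd (c := C) hf.cont.aestronglyMeasurable (ae_of_all _ hb)
  have tm : ∀ {f g : E3 × ℝ → ℝ}, Tst f → Smo g → Tst fun z => f z * g z := fun hf hg => ⟨hf.1.mul hg, hf.2.mul_right⟩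
  have iA : IntegrableOn (fun z => u z * ((η z + κ * tdz η z + ∑ i, sdz (sdz η i) i z) * φ z + ∑ i, 2 * sdz η i z * sdz φ i z)) (pcyl z₀ ρ) := by
    apply bi h.u1
    apply Tst.add
    · exact tm ((hη.tst.add (hη.tst.tdz.const_mul κ)).add (Tst.sum _ fun i => (hη.tst.sdz i).sdz i)) sφ
    · exact Tst.sum _ fun i => tm ((hη.tst.sdz i).const_mul 2) (sφ.sdz i)
  have iB : IntegrableOn (fun z => ∑ b, k b z * (sdz η b z * φ z)) (pcyl z₀ ρ) :=
    integrable_finsetSum Finset.univ fun b _ => bi (h.k1 b) (tm (hη.tst.sdz b) sφ)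
  have iC : IntegrableOn (fun z => ∑ b, k b z * (η z * sdz φ b z)) (pcyl z₀ ρ) :=
    integrable_finsetSum Finset.univ fun b _ => bi (h.k1 b) (tm hη.tst (sφ.sdz b))
  have iD : IntegrableOn (fun z => u z * (- κ * tdz (fun z => η z * φ z) z - ∑ b, sdz (sdz (fun z => η z * φ z) b) b z)) (pcyl z₀ ρ) := by
    apply bi h.u1
    exact (tψ.tdz.const_mul _).sub (Tst.sum _ fun b => (tψ.sdz b).sdz b)
  have e1 : ∀ z, η z * u z * F z = u z * (- κ * tdz (fun z => η z * φ z) z - ∑ b, sdz (sdz (fun z => η z * φ z) b) b z) +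
      u z * ((η z + κ * tdz η z + ∑ i, sdz (sdz η i) i z) * φ z + ∑ i, 2 * sdz η i z * sdz φ i z) := by
    intro z
    simp only [d2, d3, tdz_mul sη sφ, Finset.sum_add_distrib, ← Finset.mul_sum, ← Finset.sum_mul]
    ring
  simp_rw [e1]
  rw [integral_add iD iA, key, integral_add iA iB]
  have e2 : ∀ z, ∑ b, k b z * sdz (fun z => η z * φ z) b z = (∑ b, k b z * (η z * sdz φ b z)) + ∑ b, k b z * (sdz η b z * φ z) := by
    intro z
    rw [← Finset.sum_add_distrib]
    refine Finset.sum_congr rfl fun b _ => ?_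
    rw [d1]; ring
  simp_rw [e2]
  rw [integral_add iC iB]
  ring


section
variable {α : Type*} [MeasurableSpace α] {μ : Measure α}
/-- real L2 norm -/
def l2 (f : E3 × ℝ → ℝ) : ℝ := (eLpNorm f 2 volume).toReal

lemma l2_nn (f : E3 × ℝ → ℝ) : 0 ≤ l2 f := toReal_nonneg
lemma l2_sq {f : E3 × ℝ → ℝ} (h : MemLp f 2) : l2 f ^ 2 = ∫ z, f z ^ 2 := by
  have h1 : eLpNorm f 2 volume ^ 2 = ENNReal.ofReal (∫ z, f z ^ 2) := by
    rw [eLpNorm_eq_lintegral_rpow_enorm_toReal (by norm_num) (by norm_num), ofReal_integral_eq_lintegral_ofReal h.integrable_sq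
      (ae_of_all _ fun z => sq_nonneg _), ← ENNReal.rpow_natCast, ← ENNReal.rpow_mul]
    norm_num
    refine lintegral_congr fun z => ?_
    rw [← ofReal_norm, ← ENNReal.ofReal_pow (norm_nonneg _)]; simp
  unfold l2
  rw [← ENNReal.toReal_pow, h1, toReal_ofReal (integral_nonneg fun z => sq_nonneg _)]
lemma l2_add {f g : E3 × ℝ → ℝ} (hf : MemLp f 2) (hg : MemLp g 2) : l2 (fun z => f z + g z) ≤ l2 f + l2 g := by
  unfold l2
  rw [← toReal_add hf.2.ne hg.2.ne]
  exact toReal_mono (add_ne_top.2 ⟨hf.2.ne, hg.2.ne⟩) (eLpNorm_add_le hf.1 hg.1 (by norm_num))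
lemma l2_le {f : E3 × ℝ → ℝ} (h : MemLp f 2) {M : ℝ} (hM : 0 ≤ M) (h2 : ∫ z, f z ^ 2 ≤ M ^ 2) : l2 f ≤ M := by
  rw [← l2_sq h] at h2
  exact (pow_le_pow_iff_left₀ (l2_nn f) hM two_ne_zero).1 h2
lemma l2_mono {f g : E3 × ℝ → ℝ} (hg : MemLp g 2) (h : ∀ z, |f z| ≤ |g z|) : l2 f ≤ l2 g :=
  toReal_mono hg.2.ne (eLpNorm_mono h)
lemma mul_i {f g : E3 × ℝ → ℝ} (hf : MemLp f 2) (hg : MemLp g 2) : Integrable fun z => f z * g z := hf.integrable_mul hg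
lemma cs {f g : E3 × ℝ → ℝ} (hf : MemLp f 2) (hg : MemLp g 2) : ∫ z, |f z * g z| ≤ l2 f * l2 g := by
  have h1 := eLpNorm_smul_le_mul_eLpNorm (p := 2) (q := 2) (r := 1) hg.1 hf.1
  have h3 : eLpNorm (f • g) 1 volume = ENNReal.ofReal (∫ z, |f z * g z|) := by
    rw [eLpNorm_one_eq_lintegral_enorm, ofReal_integral_eq_lintegral_ofReal (mul_i hf hg).abs (ae_of_all _ fun z => abs_nonneg _)]
    refine lintegral_congr fun z => ?_
    rw [← ofReal_norm]; simp
  rw [h3] at h1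
  have := toReal_mono (mul_ne_top hf.2.ne hg.2.ne) h1
  rwa [toReal_ofReal (integral_nonneg fun z => abs_nonneg _), toReal_mul] at this
lemma cs' {f g : E3 × ℝ → ℝ} (hf : MemLp f 2) (hg : MemLp g 2) : |∫ z, f z * g z| ≤ l2 f * l2 g :=
  abs_integral_le_integral_abs.trans (cs hf hg)
end

/-- vanishing for times after some t1 < t0 -/
def Pre (t0 : ℝ) (F : E3 × ℝ → ℝ) : Prop := ∃ t1 < t0, ∀ z : E3 × ℝ, t1 ≤ z.2 → F z = 0

lemma dens {F : E3 × ℝ → ℝ} {t0 δ : ℝ} (hF : MemLp F 2) (h0 : ∀ z : E3 × ℝ, t0 ≤ z.2 → F z = 0) (hδ : 0 < δ) :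
    ∃ F', Tst F' ∧ Pre t0 F' ∧ MemLp F' 2 ∧ l2 (fun z => F z - F' z) ≤ δ := by
  obtain ⟨g, hg1, hg2, hg3⟩ := hF.exist_eLpNorm_sub_le (by norm_num) (by norm_num) (ε := δ / 2) (by positivity)
  have tg : Tst g := ⟨hg2, hg1⟩
  let χ : ℕ → ℝ → ℝ := fun n t => Real.smoothTransition ((n + 1) * (t0 - t) - 1)
  have sχ : ∀ n, Smo fun z => χ n z.2 := fun n =>
    Real.smoothTransition.contDiff.comp (((contDiff_const).mul (contDiff_const.sub contDiff_snd)).sub contDiff_const)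
  have χ0 : ∀ n t, 0 ≤ χ n t := fun n t => Real.smoothTransition.nonneg _
  have χ1 : ∀ n t, χ n t ≤ 1 := fun n t => Real.smoothTransition.le_one _
  have tF : ∀ n, Tst fun z => χ n z.2 * g z := fun n => tg.smul (sχ n)
  let e : ℕ → E3 × ℝ → ℝ := fun n => ((univ : Set E3) ×ˢ Iio t0).indicator fun z => (1 - χ n z.2) * g z
  have ms : MeasurableSet ((univ : Set E3) ×ˢ Iio t0) := MeasurableSet.univ.prod measurableSet_Iio
  have me : ∀ n, MemLp (e n) 2 := fun n => by
    have : Tst fun z => (1 - χ n z.2) * g z := tg.smul (contDiff_const.sub (sχ n))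
    exact (this.memLp 2).indicator ms
  have le : ∀ n z, |e n z| ≤ |g z| := fun n z => by
    simp only [e, indicator]; split_ifs
    · rw [abs_mul, abs_of_nonneg (by linarith [χ1 n z.2])]
      exact mul_le_of_le_one_left (abs_nonneg _) (by linarith [χ0 n z.2])
    · simp
  have lim : Tendsto (fun n => ∫ z, e n z ^ 2) atTop (nhds (∫ z : E3 × ℝ, (0 : ℝ))) := by
    refine tendsto_integral_of_dominated_convergence (fun z => g z ^ 2) (fun n => ((me n).1.pow 2)) (tg.memLp 2).integrable_sq
      (fun n => ae_of_all _ fun z => ?_) (ae_of_all _ fun z => ?_)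
    · rw [Real.norm_eq_abs, abs_pow, ← sq_abs (g z)]; exact pow_le_pow_left₀ (abs_nonneg _) (le n z) 2
    · by_cases hz : z.2 < t0
      · refine tendsto_const_nhds.congr' ?_
        obtain ⟨N, hN⟩ := exists_nat_gt (2 / (t0 - z.2))
        filter_upwards [eventually_ge_atTop N] with n hn
        have hp : 0 < t0 - z.2 := by linarith
        have : χ n z.2 = 1 := by
          apply Real.smoothTransition.one_of_one_le
          have h1 : (2 : ℝ) < N * (t0 - z.2) := (div_lt_iff₀ hp).1 hN
          have h2 : (N : ℝ) ≤ n := by exact_mod_cast hn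
          nlinarith
        simp [e, indicator, this]
      · refine tendsto_const_nhds.congr fun n => ?_
        simp [e, indicator, hz]
  rw [integral_zero] at lim
  obtain ⟨n, hn⟩ := (lim.eventually (gt_mem_nhds (show (0 : ℝ) < (δ / 2) ^ 2 by positivity))).exists
  refine ⟨_, tF n, ⟨t0 - 1 / (n + 1), by simp; positivity, fun z hz => ?_⟩, (tF n).memLp 2, ?_⟩
  · have : χ n z.2 = 0 := by
      apply Real.smoothTransition.zero_of_nonpos
      have : t0 - z.2 ≤ 1 / (n + 1) := by linarith
      have := (le_div_iff₀ (by positivity)).1 this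
      linarith
    simp [this]
  · have hd : MemLp (fun z => F z - g z) 2 := hF.sub (tg.memLp 2)
    have hi : MemLp (((univ : Set E3) ×ˢ Iio t0).indicator fun z => F z - g z) 2 := hd.indicator ms
    have e1 : (fun z => F z - χ n z.2 * g z) = fun z => (((univ : Set E3) ×ˢ Iio t0).indicator (fun z => F z - g z)) z + e n z := by
      ext z
      by_cases hz : z.2 < t0
      · simp [e, indicator, hz]; ring
      · have : χ n z.2 = 0 := by
          apply Real.smoothTransition.zero_of_nonpos
          have : t0 - z.2 ≤ 0 := by linarith
          nlinarith [(n.cast_nonneg : (0:ℝ) ≤ n)]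
        simp [e, indicator, hz, this, h0 z (not_lt.1 hz)]
    rw [e1]
    have a1 := l2_add hi (me n)
    have a2 := l2_le (me n) (by positivity) hn.le
    have a3 : l2 (((univ : Set E3) ×ˢ Iio t0).indicator fun z => F z - g z) ≤ δ / 2 := by
      refine (l2_mono hd fun z => ?_).trans (toReal_le_of_le_ofReal (by positivity) hg3)
      simp only [indicator]; split_ifs <;> simp
    linarith


/-- energy bound -/
def EB (F : E3 × ℝ → ℝ) (M : ℝ) : Prop := ∀ τ, en τ (Sop 1 F) ≤ M ^ 2

section
variable {F : E3 × ℝ → ℝ} {M t0 : ℝ}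

lemma BI.memLp {f : E3 × ℝ → ℝ} (h : BI f) : MemLp f 2 := by
  rw [memLp_two_iff_integrable_sq h.smo.continuous.aestronglyMeasurable]
  simpa [sq] using h.imul h

lemma Sop_m (hF : Tst F) : MemLp (Sop 1 F) 2 := (Sop_BI hF).memLp
lemma Sop_m' (hF : Tst F) (i) : MemLp (sdz (Sop 1 F) i) 2 := by
  rw [Sop_sdz hF]; exact Sop_m (hF.sdz i)

lemma EB_sum (hF : Tst F) (h : EB F M) : ∫ z, ((∑ i, sdz (Sop 1 F) i z ^ 2) + Sop 1 F z ^ 2) ≤ M ^ 2 := by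
  have hi : Integrable fun z => ((∑ i, sdz (Sop 1 F) i z ^ 2) + Sop 1 F z ^ 2) :=
    (integrable_finsetSum Finset.univ fun i _ => (Sop_m' hF i).integrable_sq).add (Sop_m hF).integrable_sq
  have h1 := tendsto_setIntegral_of_monotone (μ := volume) (s := fun n : ℕ => (univ : Set E3) ×ˢ Ioi (-(n : ℝ)))
    (fun n => MeasurableSet.univ.prod measurableSet_Ioi)
    (fun m n hmn => prod_mono subset_rfl (Ioi_subset_Ioi (by simpa using hmn))) hi.integrableOn
  have h2 : (⋃ n : ℕ, (univ : Set E3) ×ˢ Ioi (-(n : ℝ))) = univ := by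
    ext z
    obtain ⟨n, hn⟩ := exists_nat_gt (- z.2)
    simp only [mem_iUnion, mem_prod, mem_univ, true_and, mem_Ioi, iff_true]
    exact ⟨n, by linarith⟩
  rw [h2, setIntegral_univ] at h1
  refine le_of_tendsto' h1 fun n => ?_
  have h3 := h (-(n : ℝ))
  unfold en at h3
  have : 0 ≤ ∫ x, Sop 1 F (x, -(n : ℝ)) ^ 2 := by positivity
  linarith

lemma EB_l2 (hF : Tst F) (hM : 0 ≤ M) (h : EB F M) : l2 (Sop 1 F) ≤ M := by
  refine l2_le (Sop_m hF) hM (le_trans (integral_mono (Sop_m hF).integrable_sq ?_ fun z => ?_) (EB_sum hF h))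
  · exact (integrable_finsetSum Finset.univ fun i _ => (Sop_m' hF i).integrable_sq).add (Sop_m hF).integrable_sq
  · have : 0 ≤ ∑ i, sdz (Sop 1 F) i z ^ 2 := by positivity
    simpa using this
lemma EB_l2' (hF : Tst F) (hM : 0 ≤ M) (h : EB F M) (k) : l2 (sdz (Sop 1 F) k) ≤ M := by
  refine l2_le (Sop_m' hF k) hM (le_trans (integral_mono (Sop_m' hF k).integrable_sq ?_ fun z => ?_) (EB_sum hF h))
  · exact (integrable_finsetSum Finset.univ fun i _ => (Sop_m' hF i).integrable_sq).add (Sop_m hF).integrable_sq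
  · have := Finset.single_le_sum (f := fun i => sdz (Sop 1 F) i z ^ 2) (fun i _ => sq_nonneg _) (Finset.mem_univ k)
    simp only at this ⊢; linarith [sq_nonneg (Sop 1 F z)]
lemma EB_sl (h : EB F M) (τ) : ∫ x, Sop 1 F (x, τ) ^ 2 ≤ M ^ 2 := by
  have := h τ
  unfold en at this
  have : 0 ≤ ∫ z in (univ : Set E3) ×ˢ Ioi τ, ((∑ i, sdz (Sop 1 F) i z ^ 2) + Sop 1 F z ^ 2) := by positivity
  linarith
lemma EB_sdz (hF : Tst F) (hP : Pre t0 F) (k) : EB (sdz F k) (l2 F) := fun τ => by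
  obtain ⟨t1, _, h0⟩ := hP
  rw [l2_sq (hF.memLp 2), ← Sop_sdz hF]; exact en_sdz_le hF h0 τ k

lemma EB_self (hF : Tst F) (hP : Pre t0 F) {A : ℝ} (hA : 0 ≤ A)
    (h : ∀ M, 0 ≤ M → EB F M → ∫ z, |F z| * |Sop 1 F z| ≤ A * M) : EB F (2 * A) := by
  obtain ⟨t1, _, h0⟩ := hP
  set X := ∫ z, |F z| * |Sop 1 F z| with hX
  have X0 : 0 ≤ X := by positivity
  have e1 : EB F (Real.sqrt (2 * X)) := fun τ => by
    rw [Real.sq_sqrt (by positivity)]; exact en_le hF h0 τ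
  have h1 := h _ (Real.sqrt_nonneg _) e1
  have hs := Real.sq_sqrt (show 0 ≤ 2 * X by positivity)
  intro τ
  refine (en_le hF h0 τ).trans ?_
  rw [← hX, ← hs]
  have s0 := Real.sqrt_nonneg (2 * X)
  refine pow_le_pow_left₀ s0 ?_ 2
  rcases s0.eq_or_lt with h | h
  · rw [← h]; positivity
  · nlinarith
end

/-- multiplier bound -/
def Mlt (Q : Set (E3 × ℝ)) (G : E3 × ℝ → ℝ) (ε : ℝ) : Prop := ∀ F, Tst F → ∀ M, 0 ≤ M → EB F M →
  MemLp (Q.indicator fun z => G z * Sop 1 F z) 2 ∧ l2 (Q.indicator fun z => G z * Sop 1 F z) ≤ ε * M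

/-- abstract duality structure for the contraction -/
structure Ctr (t0 : ℝ) (Q : Set (E3 × ℝ)) (G : E3 × ℝ → ℝ) (U : Fin 3 → E3 × ℝ → ℝ) (C : ℝ) : Prop where
  U2 : ∀ c, MemLp (U c) 2
  Q0 : ∀ z ∈ Q, z.2 < t0
  G0 : ∀ z, 0 ≤ G z
  C0 : 0 ≤ C
  mlt : Mlt Q G (1 / 100)
  rep : ∀ F : Fin 3 → E3 × ℝ → ℝ, (∀ c, Tst (F c)) → (∀ c, Pre t0 (F c)) → ∃ H : Fin 3 → E3 × ℝ → ℝ,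
    (∀ c, AEStronglyMeasurable (H c) volume) ∧
    (∀ c z, |H c z| ≤ Q.indicator (fun z => G z * ∑ c', ∑ b, |sdz (Sop 1 (F c')) b z|) z) ∧
    ∀ M, 0 ≤ M → (∀ c, EB (F c) M) → |(∑ c, ∫ z, U c z * F c z) - ∑ c, ∫ z, U c z * H c z| ≤ C * M

section
variable {t0 C : ℝ} {Q : Set (E3 × ℝ)} {G : E3 × ℝ → ℝ} {U : Fin 3 → E3 × ℝ → ℝ}

lemma Ctr.step (h : Ctr t0 Q G U C) {F : Fin 3 → E3 × ℝ → ℝ} (hF : ∀ c, Tst (F c)) (hP : ∀ c, Pre t0 (F c))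
    {M N : ℝ} (hM : 0 < M) (hN : 0 < N) (hE : ∀ c, EB (F c) M) (hL : ∀ c, l2 (F c) ≤ N) :
    ∃ F' : Fin 3 → E3 × ℝ → ℝ, (∀ c, Tst (F' c)) ∧ (∀ c, Pre t0 (F' c)) ∧ (∀ c, EB (F' c) (M / 2)) ∧ (∀ c, l2 (F' c) ≤ N / 2) ∧
      |∑ c, ∫ z, U c z * F c z| ≤ |∑ c, ∫ z, U c z * F' c z| + (C + 1) * M := by
  obtain ⟨H, mH, bH, hH⟩ := h.rep F hF hP
  have g1 : ∀ c b, MemLp (Q.indicator fun z => G z * |sdz (Sop 1 (F c)) b z|) 2 ∧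
      l2 (Q.indicator fun z => G z * |sdz (Sop 1 (F c)) b z|) ≤ N / 100 := by
    intro c b
    obtain ⟨a1, a2⟩ := h.mlt (sdz (F c) b) ((hF c).sdz b) _ (l2_nn _) (EB_sdz (hF c) (hP c) b)
    rw [← Sop_sdz (hF c)] at a1 a2
    have e1 : (Q.indicator fun z => G z * |sdz (Sop 1 (F c)) b z|) = fun z => ‖(Q.indicator fun z => G z * sdz (Sop 1 (F c)) b z) z‖ := by
      ext z; simp only [indicator]; split_ifs <;> simp [abs_mul, abs_of_nonneg (h.G0 z)]
    rw [e1]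
    refine ⟨a1.norm, (l2_mono a1 fun z => by simp).trans (a2.trans ?_)⟩
    linarith [hL c]
  set B : E3 × ℝ → ℝ := fun z => ∑ c, ∑ b, (Q.indicator (fun z => G z * |sdz (Sop 1 (F c)) b z|)) z with hB
  have eB : ∀ z, Q.indicator (fun z => G z * ∑ c', ∑ b, |sdz (Sop 1 (F c')) b z|) z = B z := by
    intro z; simp only [hB, indicator]; split_ifs <;> simp [Finset.mul_sum]
  have B0 : ∀ z, 0 ≤ B z := fun z => by
    rw [← eB]; exact indicator_nonneg (fun z _ => mul_nonneg (h.G0 z) (by positivity)) z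
  have mB : MemLp B 2 := memLp_finsetSum _ fun c _ => memLp_finsetSum _ fun b _ => (g1 c b).1
  have lB : l2 B ≤ 9 / 100 * N := by
    have hs : ∀ c, MemLp (fun z => ∑ b, (Q.indicator (fun z => G z * |sdz (Sop 1 (F c)) b z|)) z) 2 := fun c => memLp_finsetSum _ fun b _ => (g1 c b).1
    have t3 : ∀ f : Fin 3 → E3 × ℝ → ℝ, (∀ i, MemLp (f i) 2) → l2 (fun z => ∑ i, f i z) ≤ ∑ i, l2 (f i) := by
      intro f hf
      simp only [Fin.sum_univ_three]
      have := l2_add ((hf 0).add (hf 1)) (hf 2)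
      have h2 := l2_add (hf 0) (hf 1)
      simp only [Pi.add_apply] at this
      have h3 : l2 (f 0 + f 1) = l2 (fun z => f 0 z + f 1 z) := rfl
      linarith
    calc l2 B ≤ ∑ c, l2 (fun z => ∑ b, (Q.indicator (fun z => G z * |sdz (Sop 1 (F c)) b z|)) z) := t3 _ hs
      _ ≤ ∑ c : Fin 3, ∑ b : Fin 3, N / 100 := Finset.sum_le_sum fun c _ => (t3 _ fun b => (g1 c b).1).trans (Finset.sum_le_sum fun b _ => (g1 c b).2)
      _ = 9 / 100 * N := by simp; ring
  have mH2 : ∀ c, MemLp (H c) 2 := fun c => mB.of_le (mH c) (ae_of_all _ fun z => by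
    rw [Real.norm_eq_abs, Real.norm_eq_abs, abs_of_nonneg (B0 z), ← eB]; exact bH c z)
  have lH : ∀ c, l2 (H c) ≤ 9 / 100 * N := fun c => (l2_mono mB fun z => by
    rw [abs_of_nonneg (B0 z), ← eB]; exact bH c z).trans lB
  have H0 : ∀ c (z : E3 × ℝ), t0 ≤ z.2 → H c z = 0 := fun c z hz => by
    have hq : z ∉ Q := fun hq => absurd (h.Q0 z hq) (not_lt.2 hz)
    have := bH c z
    rw [indicator_of_notMem hq] at this
    exact abs_nonpos_iff.1 this
  set S := ∑ c, l2 (U c) with hS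
  have S0 : 0 ≤ S := Finset.sum_nonneg fun c _ => l2_nn _
  obtain ⟨δ, hδ, d1, d2, d3⟩ : ∃ δ : ℝ, 0 < δ ∧ δ ≤ M / 100 ∧ δ ≤ N / 100 ∧ δ * S ≤ M := by
    refine ⟨min (min (M / 100) (N / 100)) (M / (S + 1)), by positivity, (min_le_left _ _).trans (min_le_left _ _), (min_le_left _ _).trans (min_le_right _ _), ?_⟩
    calc _ ≤ M / (S + 1) * S := by gcongr; exact min_le_right _ _
      _ ≤ M := by rw [div_mul_eq_mul_div, div_le_iff₀ (by positivity)]; nlinarith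
  choose F' tF pF mF lF using fun c => dens (mH2 c) (H0 c) hδ
  refine ⟨F', tF, pF, fun c => ?_, fun c => ?_, ?_⟩
  · have : EB (F' c) (2 * (δ + 9 / 100 * M)) := by
      refine EB_self (tF c) (pF c) (by positivity) fun M1 hM1 hE1 => ?_
      obtain ⟨a1, a2⟩ := h.mlt _ (tF c) M1 hM1 hE1
      set φ := Sop 1 (F' c) with hφ
      have mφ : MemLp φ 2 := Sop_m (tF c)
      have md : MemLp (fun z => H c z - F' c z) 2 := (mH2 c).sub (mF c)
      have p1 : ∀ z, |F' c z| * |φ z| ≤ |(H c z - F' c z) * φ z| + ∑ c', ∑ b, |sdz (Sop 1 (F c')) b z * (Q.indicator (fun z => G z * φ z)) z| := by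
        intro z
        have q1 : |H c z| * |φ z| ≤ ∑ c', ∑ b, |sdz (Sop 1 (F c')) b z * (Q.indicator (fun z => G z * φ z)) z| := by
          refine (mul_le_mul_of_nonneg_right (bH c z) (abs_nonneg _)).trans (le_of_eq ?_)
          simp only [indicator]; split_ifs
          · simp only [abs_mul, abs_of_nonneg (h.G0 z), ← Finset.sum_mul]; ring
          · simp
        have q2 : |F' c z| ≤ |H c z - F' c z| + |H c z| := by
          have := abs_sub_abs_le_abs_sub (F' c z) (H c z)
          rw [abs_sub_comm] at this; linarith
        rw [abs_mul]
        nlinarith [abs_nonneg (φ z)]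
      have i1 : Integrable fun z => |(H c z - F' c z) * φ z| := (mul_i md mφ).abs
      have i2 : ∀ c' b, Integrable fun z => |sdz (Sop 1 (F c')) b z * (Q.indicator (fun z => G z * φ z)) z| := fun c' b =>
        (mul_i (Sop_m' (hF c') b) a1).abs
      have i3 : ∀ c', Integrable fun z => ∑ b, |sdz (Sop 1 (F c')) b z * (Q.indicator (fun z => G z * φ z)) z| := fun c' =>
        integrable_finsetSum Finset.univ fun b _ => i2 c' b
      have i4 : Integrable fun z => ∑ c', ∑ b, |sdz (Sop 1 (F c')) b z * (Q.indicator (fun z => G z * φ z)) z| :=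
        integrable_finsetSum Finset.univ fun c' _ => i3 c'
      calc ∫ z, |F' c z| * |φ z| ≤ ∫ z, (|(H c z - F' c z) * φ z| + ∑ c', ∑ b, |sdz (Sop 1 (F c')) b z * (Q.indicator (fun z => G z * φ z)) z|) := by
            refine integral_mono_of_nonneg (ae_of_all _ fun z => by positivity) (i1.add i4) (ae_of_all _ p1)
        _ = (∫ z, |(H c z - F' c z) * φ z|) + ∑ c', ∑ b, ∫ z, |sdz (Sop 1 (F c')) b z * (Q.indicator (fun z => G z * φ z)) z| := by
            rw [integral_add i1 i4, integral_finsetSum _ fun c' _ => i3 c']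
            congr 1; exact Finset.sum_congr rfl fun c' _ => integral_finsetSum _ fun b _ => i2 c' b
        _ ≤ δ * M1 + ∑ c' : Fin 3, ∑ b : Fin 3, M * (1 / 100 * M1) := by
            gcongr with c' _ b _
            · exact (cs md mφ).trans (mul_le_mul (lF c) (EB_l2 (tF c) hM1 hE1) (l2_nn _) hδ.le)
            · exact (cs (Sop_m' (hF c') b) a1).trans (mul_le_mul (EB_l2' (hF c') hM.le (hE c') b) a2 (l2_nn _) hM.le)
        _ = _ := by simp; ring
    intro τ
    refine (this τ).trans (pow_le_pow_left₀ (by positivity) (by linarith) 2)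
  · have e1 : F' c = fun z => (F' c z - H c z) + H c z := by ext z; ring
    have e2 : l2 (fun z => F' c z - H c z) ≤ δ := by
      refine (l2_mono ((mH2 c).sub (mF c)) fun z => ?_).trans (lF c)
      simp only [Pi.sub_apply]; rw [abs_sub_comm]
    have := l2_add ((mF c).sub (mH2 c)) (mH2 c)
    simp only [Pi.sub_apply] at this
    rw [← e1] at this
    have e3 : l2 (F' c - H c) = l2 (fun z => F' c z - H c z) := rfl
    linarith [lH c]
  · have k1 := hH M hM.le hE
    have k2 : |(∑ c, ∫ z, U c z * H c z) - ∑ c, ∫ z, U c z * F' c z| ≤ δ * S := by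
      rw [← Finset.sum_sub_distrib, hS, Finset.mul_sum]
      refine (Finset.abs_sum_le_sum_abs _ _).trans (Finset.sum_le_sum fun c _ => ?_)
      rw [← integral_sub (mul_i (h.U2 c) (mH2 c)) (mul_i (h.U2 c) (mF c))]
      have := cs' (h.U2 c) ((mH2 c).sub (mF c))
      simp only [Pi.sub_apply, mul_sub] at this
      refine this.trans ?_
      rw [mul_comm]
      exact mul_le_mul_of_nonneg_right (lF c) (l2_nn _)
    have k3 := abs_sub_abs_le_abs_sub (∑ c, ∫ z, U c z * F c z) (∑ c, ∫ z, U c z * H c z)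
    have k4 := abs_sub_abs_le_abs_sub (∑ c, ∫ z, U c z * H c z) (∑ c, ∫ z, U c z * F' c z)
    linarith

lemma Ctr.bound (h : Ctr t0 Q G U C) {F : Fin 3 → E3 × ℝ → ℝ} (hF : ∀ c, Tst (F c)) (hP : ∀ c, Pre t0 (F c))
    {M : ℝ} (hM : 0 < M) (hE : ∀ c, EB (F c) M) : |∑ c, ∫ z, U c z * F c z| ≤ 2 * (C + 1) * M := by
  set S := ∑ c, l2 (U c) with hS
  have S0 : 0 ≤ S := Finset.sum_nonneg fun c _ => l2_nn _
  have key : ∀ n : ℕ, ∀ F : Fin 3 → E3 × ℝ → ℝ, (∀ c, Tst (F c)) → (∀ c, Pre t0 (F c)) → ∀ M N : ℝ, 0 < M → 0 < N →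
      (∀ c, EB (F c) M) → (∀ c, l2 (F c) ≤ N) → |∑ c, ∫ z, U c z * F c z| ≤ 2 * (C + 1) * M + (1 / 2) ^ n * (S * N) := by
    intro n
    induction n with
    | zero =>
      intro F hF hP M N hM hN hE hL
      have : |∑ c, ∫ z, U c z * F c z| ≤ S * N := by
        rw [hS, Finset.sum_mul]
        refine (Finset.abs_sum_le_sum_abs _ _).trans (Finset.sum_le_sum fun c _ => ?_)
        exact (cs' (h.U2 c) ((hF c).memLp 2)).trans (mul_le_mul_of_nonneg_left (hL c) (l2_nn _))
      have := h.C0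
      have : 0 ≤ 2 * (C + 1) * M := by positivity
      simp; linarith
    | succ n ih =>
      intro F hF hP M N hM hN hE hL
      obtain ⟨F', t', p', e', l', b'⟩ := h.step hF hP hM hN hE hL
      have := ih F' t' p' (M / 2) (N / 2) (by positivity) (by positivity) e' l'
      rw [pow_succ]; linarith
  set N := 1 + ∑ c, l2 (F c) with hN
  have N0 : 0 < N := by
    have : 0 ≤ ∑ c, l2 (F c) := Finset.sum_nonneg fun c _ => l2_nn _
    linarith
  have lim : Tendsto (fun n : ℕ => 2 * (C + 1) * M + (1 / 2 : ℝ) ^ n * (S * N)) atTop (nhds (2 * (C + 1) * M + 0 * (S * N))) :=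
    tendsto_const_nhds.add ((_root_.tendsto_pow_atTop_nhds_zero_of_lt_one (by norm_num) (by norm_num)).mul_const _)
  rw [zero_mul, add_zero] at lim
  refine ge_of_tendsto' lim fun n => key n F hF hP M N hM N0 hE fun c => ?_
  have := Finset.single_le_sum (f := fun c => l2 (F c)) (fun c _ => l2_nn _) (Finset.mem_univ c)
  linarith
end


lemma eps_le {x a b : ℝ} (hb : 0 ≤ b) (h : ∀ δ > 0, x ≤ a + δ * b) : x ≤ a := by
  by_contra hc
  push Not at hc
  have h1 := h ((x - a) / (2 * (b + 1))) (by apply div_pos <;> linarith)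
  have h2 : (x - a) / (2 * (b + 1)) * b ≤ (x - a) / 2 := by
    rw [div_mul_eq_mul_div, div_le_div_iff₀ (by positivity) (by positivity)]
    nlinarith
  linarith

lemma Tst.ind {c : Fin 3} {F : E3 × ℝ → ℝ} (h : Tst F) (i) : Tst (Function.update (fun _ _ => 0) c F i : E3 × ℝ → ℝ) := by
  by_cases hi : i = c
  · subst hi; simpa using h
  · simpa [hi] using Tst.zero

lemma EB_zero (M : ℝ) : EB (fun _ => 0) M := by
  have h1 : EB (fun _ => 0) (2 * 0) := EB_self (t0 := 1) Tst.zero ⟨0, by norm_num, fun _ _ => rfl⟩ le_rfl fun M _ _ => by simp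
  intro τ
  exact (h1 τ).trans (by norm_num; positivity)

/-- squared slice norm -/
def sl2 (u : E3 × ℝ → ℝ) (t : ℝ) : ℝ≥0∞ := ∫⁻ x, ‖u (x, t)‖ₑ ^ 2

section
variable {t0 C : ℝ} {Q : Set (E3 × ℝ)} {G : E3 × ℝ → ℝ} {U : Fin 3 → E3 × ℝ → ℝ}

lemma sl2_meas {u : E3 × ℝ → ℝ} (hu : Measurable u) : Measurable (sl2 u) := by
  have : Measurable fun q : ℝ × E3 => ‖u (q.2, q.1)‖ₑ ^ 2 := (hu.comp measurable_swap).enorm.pow_const 2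
  exact this.lintegral_prod_right'

lemma sl2_int {u : E3 × ℝ → ℝ} (hu : Measurable u) : ∫⁻ z, ‖u z‖ₑ ^ 2 = ∫⁻ t, sl2 u t := by
  rw [Measure.volume_eq_prod, lintegral_prod_symm' _ (hu.enorm.pow_const 2)]; rfl

lemma sl2_cs {f g : E3 × ℝ → ℝ} (hf : Measurable f) (hg : Measurable g) :
    ∫⁻ z, ‖f z‖ₑ * ‖g z‖ₑ ≤ ∫⁻ t, sl2 f t ^ (1 / 2 : ℝ) * sl2 g t ^ (1 / 2 : ℝ) := by
  rw [Measure.volume_eq_prod, lintegral_prod_symm' (fun z => ‖f z‖ₑ * ‖g z‖ₑ) (hf.enorm.mul hg.enorm)]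
  refine lintegral_mono fun t => ?_
  have hs : Measurable fun x : E3 => (x, t) := measurable_prodMk_right
  have := ENNReal.lintegral_mul_le_Lp_mul_Lq volume Real.HolderConjugate.two_two
    (f := fun x => ‖f (x, t)‖ₑ) (g := fun x => ‖g (x, t)‖ₑ) (hf.comp hs).enorm.aemeasurable (hg.comp hs).enorm.aemeasurable
  simpa [sl2] using this

lemma Ctr.linf (h : Ctr t0 Q G U C) (mU : ∀ c, Measurable (U c)) (U0 : ∀ c (z : E3 × ℝ), t0 ≤ z.2 → U c z = 0) (c : Fin 3) :
    ∀ᵐ t, sl2 (U c) t ≤ ENNReal.ofReal ((8 * (C + 1)) ^ 2) := by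
  have C0 := h.C0
  set K := 8 * (C + 1) with hK
  have K0 : 0 < K := by positivity
  set u := U c with hu
  set E := {t | ENNReal.ofReal (K ^ 2) < sl2 u t} with hE
  have mN := sl2_meas (mU c)
  have mE : MeasurableSet E := measurableSet_lt measurable_const mN
  set F : E3 × ℝ → ℝ := ((univ : Set E3) ×ˢ E).indicator u with hFd
  have mS : MeasurableSet ((univ : Set E3) ×ˢ E) := MeasurableSet.univ.prod mE
  have mF : Measurable F := (mU c).indicator mS
  have mF2 : MemLp F 2 := (h.U2 c).indicator mS
  have F0 : ∀ z : E3 × ℝ, t0 ≤ z.2 → F z = 0 := fun z hz => by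
    simp only [hFd, indicator]; split_ifs; exacts [U0 c z hz, rfl]
  have sF : ∀ t, sl2 F t = E.indicator (sl2 u) t := fun t => by
    by_cases ht : t ∈ E <;> simp [sl2, hFd, indicator, ht]
  have kE : ∀ t ∈ E, ENNReal.ofReal K ≤ sl2 u t ^ (1 / 2 : ℝ) := fun t ht => by
    have h1 : ENNReal.ofReal (K ^ 2) ≤ sl2 u t := le_of_lt ht
    calc ENNReal.ofReal K = (ENNReal.ofReal (K ^ 2)) ^ (1 / 2 : ℝ) := by
          rw [ENNReal.ofReal_rpow_of_pos (by positivity), ← Real.sqrt_eq_rpow, Real.sqrt_sq K0.le]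
      _ ≤ _ := by gcongr
  have sqr : ∀ a : ℝ≥0∞, a ^ (1 / 2 : ℝ) * a ^ (1 / 2 : ℝ) = a := fun a => by
    rw [← ENNReal.rpow_add_of_nonneg _ _ (by norm_num) (by norm_num)]; norm_num
  set m' := ∫⁻ t, sl2 F t ^ (1 / 2 : ℝ) with hm'
  have up : ENNReal.ofReal K * m' ≤ ∫⁻ t, sl2 F t := by
    rw [hm', ← lintegral_const_mul _ ((sl2_meas mF).pow_const _)]
    refine lintegral_mono fun t => ?_
    simp only [sF, indicator]
    split_ifs with ht
    · exact (mul_le_mul_left (kE t ht) _).trans (le_of_eq (sqr _))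
    · simp
  have eF : ∫⁻ z, ‖F z‖ₑ ^ 2 = ENNReal.ofReal (∫ z, u z * F z) := by
    have e1 : ∀ z, u z * F z = F z ^ 2 := fun z => by
      simp only [hFd, indicator]; split_ifs <;> simp [sq]
    simp_rw [e1]
    rw [ofReal_integral_eq_lintegral_ofReal mF2.integrable_sq (ae_of_all _ fun z => sq_nonneg _)]
    refine lintegral_congr fun z => ?_
    rw [← ofReal_norm, ← ENNReal.ofReal_pow (norm_nonneg _)]; simp
  rw [← sl2_int mF, eF] at up
  have m'f : m' ≠ ∞ := by
    intro hc
    rw [hc, ENNReal.mul_top (by simpa using K0)] at up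
    exact absurd up (by simp)
  set m := m'.toReal with hm
  have m0 : 0 ≤ m := toReal_nonneg
  have main : ∫ z, u z * F z ≤ 4 * (C + 1) * m := by
    refine eps_le (b := 4 * (C + 1) + l2 u) (by have := l2_nn u; positivity) fun δ hδ => ?_
    obtain ⟨F', tF', pF', mF', lF'⟩ := dens mF2 F0 hδ
    have md : MemLp (fun z => F z - F' z) 2 := mF2.sub mF'
    have eb : EB F' (2 * (m + δ)) := by
      refine EB_self tF' pF' (by positivity) fun M hM hEM => ?_
      set φ := Sop 1 F' with hφ
      have mφ : MemLp φ 2 := Sop_m tF'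
      have φm : Measurable φ := (Sop_smo tF').continuous.measurable
      have q1 : ∫ z, |F z| * |φ z| ≤ m * M := by
        have hi : Integrable fun z => |F z| * |φ z| := by
          simpa [abs_mul] using (mul_i mF2 mφ).abs
        have : ENNReal.ofReal (∫ z, |F z| * |φ z|) ≤ m' * ENNReal.ofReal M := by
          rw [ofReal_integral_eq_lintegral_ofReal hi (ae_of_all _ fun z => by positivity)]
          have e1 : ∀ z, ENNReal.ofReal (|F z| * |φ z|) = ‖F z‖ₑ * ‖φ z‖ₑ := fun z => by
            rw [ENNReal.ofReal_mul (abs_nonneg _), ← ofReal_norm, ← ofReal_norm]; simp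
          simp_rw [e1]
          refine (sl2_cs mF φm).trans ?_
          rw [hm', ← lintegral_mul_const _ ((sl2_meas mF).pow_const _)]
          refine lintegral_mono fun t => ?_
          dsimp only
          gcongr
          have s1 : sl2 φ t ≤ ENNReal.ofReal (M ^ 2) := by
            have hb := Sop_BI (κ := 1) tF'
            have hi : Integrable fun x => φ (x, t) ^ 2 := by
              simpa [sq] using hb.smul hb t
            have := EB_sl hEM t
            refine le_trans (le_of_eq ?_) (ENNReal.ofReal_le_ofReal this)
            rw [ofReal_integral_eq_lintegral_ofReal hi (ae_of_all _ fun z => sq_nonneg _)]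
            refine lintegral_congr fun z => ?_
            rw [← ofReal_norm, ← ENNReal.ofReal_pow (norm_nonneg _)]; simp [hφ]
          calc sl2 φ t ^ (1 / 2 : ℝ) ≤ ENNReal.ofReal (M ^ 2) ^ (1 / 2 : ℝ) := by gcongr
            _ = ENNReal.ofReal M := by
              rw [ENNReal.ofReal_rpow_of_nonneg (by positivity) (by norm_num), ← Real.sqrt_eq_rpow, Real.sqrt_sq hM]
        have := toReal_mono (mul_ne_top m'f ofReal_ne_top) this
        rwa [toReal_ofReal (integral_nonneg fun z => by positivity), toReal_mul, toReal_ofReal hM] at this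
      have hi : Integrable fun z => |F z| * |φ z| := by
          simpa [abs_mul] using (mul_i mF2 mφ).abs
      calc ∫ z, |F' z| * |φ z| ≤ ∫ z, (|(F z - F' z) * φ z| + |F z| * |φ z|) := by
            refine integral_mono_of_nonneg (ae_of_all _ fun z => by positivity) ((mul_i md mφ).abs.add hi) (ae_of_all _ fun z => ?_)
            have := abs_sub_abs_le_abs_sub (F' z) (F z)
            rw [abs_sub_comm] at this
            simp only
            rw [abs_mul, ← add_mul]; gcongr; linarith
        _ ≤ δ * M + m * M := by
            rw [integral_add (mul_i md mφ).abs hi]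
            refine add_le_add ((cs md mφ).trans (mul_le_mul lF' (EB_l2 tF' hM hEM) (l2_nn _) hδ.le)) q1
        _ = _ := by ring
    have b1 := h.bound (F := Function.update (fun _ _ => 0) c F') (fun i => tF'.ind i) (fun i => by
        by_cases hi : i = c
        · subst hi; simpa using pF'
        · simp only [Function.update_of_ne hi]; exact ⟨t0 - 1, by linarith, fun _ _ => rfl⟩)
      (M := 2 * (m + δ)) (by positivity) (fun i => by
        by_cases hi : i = c
        · subst hi; simpa using eb
        · simp only [Function.update_of_ne hi]; exact EB_zero _)
    rw [Finset.sum_eq_single c (fun i _ hi => by simp [Function.update_of_ne hi]) (by simp)] at b1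
    simp only [Function.update_self] at b1
    have b2 := cs' (h.U2 c) md
    have e3 : ∫ z, u z * (F z - F' z) = (∫ z, u z * F z) - ∫ z, u z * F' z := by
      rw [← integral_sub (mul_i (h.U2 c) mF2) (mul_i (h.U2 c) mF')]; congr 1; ext z; ring
    rw [← hu, e3] at b2
    have b3 := abs_le.1 b1
    have b4 := abs_le.1 b2
    have b5 : l2 u * l2 (fun z => F z - F' z) ≤ l2 u * δ := mul_le_mul_of_nonneg_left lF' (l2_nn _)
    rw [← hu] at b3
    linarith [b3.2, b4.2]
  have up2 : K * m ≤ ∫ z, u z * F z := by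
    have := toReal_mono ofReal_ne_top up
    rwa [toReal_mul, toReal_ofReal K0.le, toReal_ofReal] at this
    refine integral_nonneg fun z => ?_
    simp only [hFd, indicator]; split_ifs <;> simp [mul_self_nonneg]
  have mz : m = 0 := by nlinarith
  have m'z : m' = 0 := by
    rcases (toReal_eq_zero_iff _).1 mz with h | h
    exacts [h, absurd h m'f]
  rw [hm', lintegral_eq_zero_iff ((sl2_meas mF).pow_const _)] at m'z
  filter_upwards [m'z] with t ht
  by_contra hc
  push Not at hc
  have htE : t ∈ E := hc
  simp only [sF, indicator, htE, if_true, Pi.zero_apply] at ht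
  have := kE t htE
  rw [ht] at this
  simp at this; linarith
end


lemma fd_sl_le {φ : E3 × ℝ → ℝ} (h : Smo φ) (x : E3) (t : ℝ) :
    ‖fderiv ℝ (fun y => φ (y, t)) x‖ ≤ ∑ i, |sdz φ i (x, t)| := by
  refine ContinuousLinearMap.opNorm_le_bound _ (by positivity) fun y => ?_
  have : HasFDerivAt (fun y : E3 => (y, t)) (ContinuousLinearMap.inl ℝ E3 ℝ) x :=
    (hasFDerivAt_id x).prodMk (hasFDerivAt_const t x)
  have h2 := (h.da (x, t)).hasFDerivAt.comp x this
  have h3 : fderiv ℝ (fun y => φ (y, t)) x y = fderiv ℝ φ (x, t) (y, 0) := by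
    have := h2.fderiv
    simp only [Function.comp_def] at this
    rw [this]; simp
  rw [h3, fd_decomp, zero_mul, add_zero, Finset.sum_mul]
  refine (Finset.abs_sum_le_sum_abs _ _).trans (Finset.sum_le_sum fun i _ => ?_)
  rw [abs_mul, mul_comm]; gcongr; exact coord_le y i

lemma gns (x₀ : E3) {r : ℝ} (hr : 0 < r) : ∃ C : ℝ≥0∞, C ≠ ∞ ∧ 1 ≤ C ∧ ∀ φ, Smo φ → ∀ t,
    (∫⁻ x in Metric.ball x₀ r, ‖φ (x, t)‖ₑ ^ (6 : ℝ)) ^ (1 / 3 : ℝ) ≤ C * ∫⁻ x, ENNReal.ofReal ((∑ i, sdz φ i (x, t) ^ 2) + φ (x, t) ^ 2) := by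
  let a : ContDiffBump x₀ := ⟨r, r + 1, hr, by linarith⟩
  have ac : ContDiff ℝ (⊤ : ℕ∞) a := a.contDiff
  obtain ⟨K, hK⟩ := (ac.continuous_fderiv (by simp)).bounded_above_of_compact_support (a.hasCompactSupport.fderiv ℝ)
  set C0 := SNormLESNormFDerivOfEqConst ℝ (volume : Measure E3) (2 : NNReal) with hC0
  refine ⟨1 + (C0 : ℝ≥0∞) ^ 2 * ENNReal.ofReal (4 * (1 + K ^ 2)), by finiteness, le_self_add, fun φ hφ t => ?_⟩
  set ψ : E3 → ℝ := fun x => a x * φ (x, t) with hψ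
  have cψ : ContDiff ℝ (⊤ : ℕ∞) ψ := ac.mul (hφ.slice t)
  have sψ : HasCompactSupport ψ := a.hasCompactSupport.mul_right
  have g1 := eLpNorm_le_eLpNorm_fderiv_of_eq (volume : Measure E3) (cψ.of_le (by simp)) sψ (p := 2) (p' := 6) (by norm_num)
    (by simp) (by simp; norm_num)
  have g2 : eLpNorm ψ 6 volume ^ 2 ≤ (C0 : ℝ≥0∞) ^ 2 * eLpNorm (fderiv ℝ ψ) 2 volume ^ 2 := by
    rw [← mul_pow]; exact pow_le_pow_left' g1 2
  have g3 : eLpNorm (fderiv ℝ ψ) 2 volume ^ 2 = ∫⁻ x, ‖fderiv ℝ ψ x‖ₑ ^ 2 := by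
    rw [eLpNorm_eq_lintegral_rpow_enorm_toReal (by norm_num) (by norm_num), ← ENNReal.rpow_natCast, ← ENNReal.rpow_mul]
    norm_num
  have g4 : (∫⁻ x in Metric.ball x₀ r, ‖φ (x, t)‖ₑ ^ (6 : ℝ)) ^ (1 / 3 : ℝ) ≤ eLpNorm ψ 6 volume ^ 2 := by
    rw [eLpNorm_eq_lintegral_rpow_enorm_toReal (by norm_num) (by norm_num), ← ENNReal.rpow_natCast, ← ENNReal.rpow_mul]
    have e1 : (1 / (6 : ℝ≥0∞).toReal * ((2 : ℕ) : ℝ)) = 1 / 3 := by norm_num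
    rw [e1]
    refine ENNReal.rpow_le_rpow ?_ (by norm_num)
    rw [← lintegral_indicator Metric.isOpen_ball.measurableSet]
    refine lintegral_mono fun x => ?_
    simp only [indicator]; split_ifs with hx
    · have : a x = 1 := a.one_of_mem_closedBall (Metric.ball_subset_closedBall hx)
      simp [hψ, this]
    · simp
  have g5 : ∫⁻ x, ‖fderiv ℝ ψ x‖ₑ ^ 2 ≤ ENNReal.ofReal (4 * (1 + K ^ 2)) * ∫⁻ x, ENNReal.ofReal ((∑ i, sdz φ i (x, t) ^ 2) + φ (x, t) ^ 2) := by
    rw [← lintegral_const_mul' _ _ ofReal_ne_top]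
    refine lintegral_mono fun x => ?_
    dsimp only
    rw [← ENNReal.ofReal_mul (by positivity), ← ofReal_norm, ← ENNReal.ofReal_pow (norm_nonneg _)]
    apply ENNReal.ofReal_le_ofReal
    have d1 : fderiv ℝ ψ x = a x • fderiv ℝ (fun y => φ (y, t)) x + φ (x, t) • fderiv ℝ a x :=
      fderiv_mul ((ac.differentiable (by simp)) x) (((hφ.slice t).differentiable (by simp)) x)
    have n1 : ‖fderiv ℝ ψ x‖ ≤ (∑ i, |sdz φ i (x, t)|) + K * |φ (x, t)| := by
      rw [d1]
      refine (norm_add_le _ _).trans (add_le_add ?_ ?_)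
      · rw [norm_smul, Real.norm_eq_abs, abs_of_nonneg a.nonneg]
        exact (mul_le_of_le_one_left (norm_nonneg _) a.le_one).trans (fd_sl_le hφ x t)
      · rw [norm_smul, mul_comm, Real.norm_eq_abs]
        gcongr; exact hK x
    refine (pow_le_pow_left₀ (norm_nonneg _) n1 2).trans ?_
    simp only [Fin.sum_univ_three]
    rw [← sq_abs (sdz φ 0 (x, t)), ← sq_abs (sdz φ 1 (x, t)), ← sq_abs (sdz φ 2 (x, t)), ← sq_abs (φ (x, t))]
    generalize |sdz φ 0 (x, t)| = p; generalize |sdz φ 1 (x, t)| = q; generalize |sdz φ 2 (x, t)| = s; generalize |φ (x, t)| = w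
    nlinarith [sq_nonneg (p - q), sq_nonneg (p - s), sq_nonneg (q - s), sq_nonneg (p - K * w), sq_nonneg (q - K * w), sq_nonneg (s - K * w), mul_nonneg (sq_nonneg K) (sq_nonneg p), mul_nonneg (sq_nonneg K) (sq_nonneg q), mul_nonneg (sq_nonneg K) (sq_nonneg s), sq_nonneg w]
  calc _ ≤ (C0 : ℝ≥0∞) ^ 2 * (ENNReal.ofReal (4 * (1 + K ^ 2)) * ∫⁻ x, ENNReal.ofReal ((∑ i, sdz φ i (x, t) ^ 2) + φ (x, t) ^ 2)) := by
        refine g4.trans (g2.trans ?_); rw [g3]; gcongr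
    _ ≤ _ := by rw [← mul_assoc]; gcongr; exact le_add_self

lemma slice_hold {μ : Measure E3} {γ : ℝ≥0∞} (hγ : 3 < γ) {g : E3 → E3} (hg : Measurable g) {φ : E3 → ℝ} (hφ : Measurable φ) :
    ∫⁻ x, ‖g x‖ₑ ^ 2 * ‖φ x‖ₑ ^ 2 ∂μ ≤ eLpNorm g γ μ ^ 2 * ((∫⁻ x, ‖φ x‖ₑ ^ 2 ∂μ) ^ (1 - 3 / γ.toReal) * (∫⁻ x, ‖φ x‖ₑ ^ (6 : ℝ) ∂μ) ^ (1 / γ.toReal)) := by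
  by_cases ht : γ = ∞
  · subst ht
    simp only [eLpNorm_exponent_top, toReal_top, _root_.div_zero, _root_.sub_zero, ENNReal.rpow_one, ENNReal.rpow_zero, _root_.mul_one]
    rw [← lintegral_const_mul _ (hφ.enorm.pow_const 2)]
    refine lintegral_mono_ae ?_
    filter_upwards [ae_le_eLpNormEssSup (f := g) (μ := μ)] with x hx
    gcongr
  · have h3 : 3 < γ.toReal := by
      have := (toReal_lt_toReal (by norm_num) ht).2 hγ; simpa using this
    rw [eLpNorm_eq_lintegral_rpow_enorm_toReal (pos_of_gt hγ).ne' ht]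
    set s := γ.toReal with hs
    have s0 : 0 < s := by linarith
    have hl : 3 / s ≤ 1 := by rw [div_le_one s0]; linarith
    have key := ENNReal.lintegral_prod_norm_pow_le (μ := μ) (Finset.univ : Finset (Fin 3))
      (f := ![fun x => ‖g x‖ₑ ^ s, fun x => ‖φ x‖ₑ ^ 2, fun x => ‖φ x‖ₑ ^ (6 : ℝ)])
      (by
        intro i _
        fin_cases i
        · exact (hg.enorm.pow_const s).aemeasurable
        · exact (hφ.enorm.pow_const 2).aemeasurable
        · exact (hφ.enorm.pow_const (6 : ℝ)).aemeasurable) (p := ![2 / s, 1 - 3 / s, 1 / s])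
      (by simp [Fin.sum_univ_three]; field_simp; ring)
      (by
        intro i _
        fin_cases i
        · simp; positivity
        · simpa using hl
        · simp; positivity)
    simp only [Fin.prod_univ_three, Matrix.cons_val_zero, Matrix.cons_val_one, Matrix.cons_val_two, Matrix.cons_val] at key
    have e1 : ∀ x, ‖g x‖ₑ ^ 2 * ‖φ x‖ₑ ^ 2 = (‖g x‖ₑ ^ s) ^ (2 / s) * (‖φ x‖ₑ ^ 2) ^ (1 - 3 / s) * (‖φ x‖ₑ ^ (6 : ℝ)) ^ (1 / s) := by
      intro x
      rw [mul_assoc, ← ENNReal.rpow_mul, ← ENNReal.rpow_mul, ← ENNReal.rpow_two (‖φ x‖ₑ), ← ENNReal.rpow_mul,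
        ← ENNReal.rpow_add_of_nonneg _ _ (by nlinarith) (by positivity), ← ENNReal.rpow_two]
      congr 2
      · field_simp
      · field_simp; ring
    simp_rw [e1]
    refine key.trans (le_of_eq ?_)
    rw [mul_assoc]
    congr 1
    rw [← ENNReal.rpow_two, ← ENNReal.rpow_mul]; congr 1; field_simp

lemma mlt_exists {z₀ : E3 × ℝ} {r : ℝ} (hr : 0 < r) {g : E3 × ℝ → E3} (hg : Measurable g) {γ α : ℝ≥0∞} (hγ : 3 < γ) (hα₁ : 2 ≤ α) (hα₂ : α ≠ ∞)
    (hexp : 3 / γ + 2 / α ≤ 1) (hf : MemMixed g (Metric.ball z₀.1 r) (z₀.2 - r ^ 2) z₀.2 γ α) {ε : ℝ} (hε : 0 < ε) :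
    ∃ ρ, 0 < ρ ∧ ρ < r ∧ Mlt (pcyl z₀ ρ) (fun z => ‖g z‖) ε := by
  set B := Metric.ball z₀.1 r with hB
  set θ := 3 / γ.toReal with hθ
  have θ0 : 0 ≤ θ := by positivity
  have θ1 : θ < 1 := by
    by_cases ht : γ = ∞
    · simp [hθ, ht]
    · have := (toReal_lt_toReal (by norm_num) ht).2 hγ
      simp only [toReal_ofNat] at this
      rw [hθ, div_lt_one (by linarith)]; linarith
  have a2 : 2 ≤ α.toReal := by have := toReal_mono hα₂ hα₁; simpa using this
  set α0 := 2 / (1 - θ) with hα0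
  have α00 : 0 < α0 := div_pos two_pos (by linarith)
  have αle : α0 ≤ α.toReal := by
    have h1 := toReal_mono one_ne_top hexp
    have n1 : (3 / γ) ≠ ∞ := (ENNReal.div_lt_top (by norm_num) (pos_of_gt hγ).ne').ne
    have n2 : (2 / α) ≠ ∞ := (ENNReal.div_lt_top (by norm_num) (lt_of_lt_of_le (by norm_num) hα₁).ne').ne
    rw [toReal_add n1 n2, toReal_div, toReal_div] at h1
    simp only [toReal_ofNat, toReal_one] at h1
    rw [hα0, div_le_iff₀ (by linarith)]
    have h2 : 2 / α.toReal ≤ 1 - θ := by rw [hθ]; linarith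
    rw [div_le_iff₀ (by linarith)] at h2
    linarith
  set A : ℝ → ℝ≥0∞ := fun t => eLpNorm (fun x => g (x, t)) γ (volume.restrict B) with hA
  have fin : ∫⁻ t in Ioo (z₀.2 - r ^ 2) z₀.2, A t ^ α.toReal ≠ ∞ := by
    unfold MemMixed mixedNorm at hf
    rw [if_neg hα₂] at hf
    intro hc
    rw [hc, ENNReal.top_rpow_of_pos (by positivity)] at hf
    exact lt_irrefl _ hf
  have fin2 : ∫⁻ t in Ioo (z₀.2 - r ^ 2) z₀.2, (1 + A t ^ α.toReal) ≠ ∞ := by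
    rw [lintegral_add_left measurable_const]
    refine add_ne_top.2 ⟨?_, fin⟩
    simp
  obtain ⟨C, hC, hC1, hG⟩ := gns z₀.1 hr
  have C0 : C ≠ 0 := (lt_of_lt_of_le one_pos hC1).ne'
  set κ : ℝ≥0∞ := (ENNReal.ofReal (ε ^ 2) / C) ^ (1 / (1 - θ)) with hκ
  have e0 : ENNReal.ofReal (ε ^ 2) / C ≠ 0 := (ENNReal.div_pos (by simpa using hε.ne') hC).ne'
  have κ0 : κ ≠ 0 := by
    rw [hκ]; simp only [ne_eq, ENNReal.rpow_eq_zero_iff, not_or, not_and]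
    exact ⟨fun h => absurd h e0, fun h => absurd h (ENNReal.div_lt_top ofReal_ne_top C0).ne⟩
  obtain ⟨δ, hδ, hs⟩ := exists_pos_setLIntegral_lt_of_measure_lt fin2 κ0
  obtain ⟨ρ, ρ0, ρr, ρδ⟩ : ∃ ρ, 0 < ρ ∧ ρ < r ∧ ENNReal.ofReal (ρ ^ 2) < δ := by
    have t1 : Tendsto (fun ρ : ℝ => ENNReal.ofReal (ρ ^ 2)) (nhdsWithin 0 (Ioi 0)) (nhds 0) := by
      have : Tendsto (fun ρ : ℝ => ENNReal.ofReal (ρ ^ 2)) (nhds 0) (nhds (ENNReal.ofReal (0 ^ 2))) :=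
        (ENNReal.continuous_ofReal.comp (continuous_pow 2)).tendsto 0
      simp at this
      exact this.mono_left nhdsWithin_le_nhds
    obtain ⟨ρ, h1, h2, h3⟩ := (((t1.eventually (gt_mem_nhds hδ)).and ((Ioo_mem_nhdsGT hr))).exists)
    exact ⟨ρ, h2, h3, h1⟩
  set I := Ioo (z₀.2 - ρ ^ 2) z₀.2 with hI
  have Isub : I ⊆ Ioo (z₀.2 - r ^ 2) z₀.2 := Ioo_subset_Ioo_left (by gcongr)
  have small : ∫⁻ t in I, A t ^ α0 ≤ κ := by
    have h1 := hs I (lt_of_le_of_lt (Measure.restrict_apply_le _ _) (by rw [hI, Real.volume_Ioo]; simpa using ρδ))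
    rw [Measure.restrict_restrict measurableSet_Ioo, inter_eq_left.2 Isub] at h1
    refine (lintegral_mono fun t => ?_).trans h1.le
    rcases le_total (A t) 1 with h | h
    · exact (ENNReal.rpow_le_one h α00.le).trans le_self_add
    · exact (ENNReal.rpow_le_rpow_of_exponent_le h αle).trans le_add_self
  refine ⟨ρ, ρ0, ρr, fun F hF M hM hE => ?_⟩
  set φ := Sop 1 F with hφ
  have sφ : Smo φ := Sop_smo hF
  have mφ : Measurable φ := sφ.continuous.measurable
  have Qm : MeasurableSet (pcyl z₀ ρ) := (pcyl_open _ _).measurableSet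
  set n : ℝ → ℝ≥0∞ := fun t => ∫⁻ x, ENNReal.ofReal ((∑ i, sdz φ i (x, t) ^ 2) + φ (x, t) ^ 2) with hn
  have md : Measurable fun z => ENNReal.ofReal ((∑ i, sdz φ i z ^ 2) + φ z ^ 2) :=
    (ENNReal.continuous_ofReal.comp ((continuous_finsetSum _ fun i _ => (sφ.sdz i).continuous.pow 2).add (sφ.continuous.pow 2))).measurable
  have mn : Measurable n := by
    have : Measurable fun q : ℝ × E3 => ENNReal.ofReal ((∑ i, sdz φ i (q.2, q.1) ^ 2) + φ (q.2, q.1) ^ 2) := md.comp measurable_swap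
    exact this.lintegral_prod_right'
  have ni : ∫⁻ t, n t ≤ ENNReal.ofReal (M ^ 2) := by
    have h1 : ∫⁻ t, n t = ∫⁻ z, ENNReal.ofReal ((∑ i, sdz φ i z ^ 2) + φ z ^ 2) := by
      rw [Measure.volume_eq_prod, lintegral_prod_symm' _ md]
    have hi : Integrable fun z => ((∑ i, sdz φ i z ^ 2) + φ z ^ 2) :=
      (integrable_finsetSum Finset.univ fun i _ => (Sop_m' hF i).integrable_sq).add (Sop_m hF).integrable_sq
    rw [h1, ← ofReal_integral_eq_lintegral_ofReal hi (ae_of_all _ fun z => by positivity)]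
    exact ENNReal.ofReal_le_ofReal (EB_sum hF hE)
  have s1 : ∀ t, ∫⁻ x, ‖φ (x, t)‖ₑ ^ 2 ≤ ENNReal.ofReal (M ^ 2) := fun t => by
    have hb := Sop_BI (κ := 1) hF
    have hi : Integrable fun x => φ (x, t) ^ 2 := by
      simpa [sq] using hb.smul hb t
    refine le_trans (le_of_eq ?_) (ENNReal.ofReal_le_ofReal (EB_sl hE t))
    rw [ofReal_integral_eq_lintegral_ofReal hi (ae_of_all _ fun z => sq_nonneg _)]
    refine lintegral_congr fun z => ?_
    rw [← ofReal_norm, ← ENNReal.ofReal_pow (norm_nonneg _)]; simp [hφ]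
  have hold : ∫⁻ t in I, A t ^ 2 * n t ^ θ ≤ (∫⁻ t in I, A t ^ α0) ^ (1 - θ) * (∫⁻ t in I, n t) ^ θ := by
    have e2 : ∀ t, A t ^ 2 = (A t ^ α0) ^ (1 - θ) := fun t => by
      rw [← ENNReal.rpow_mul, ← ENNReal.rpow_two]; congr 1
      rw [hα0]; field_simp [(by linarith : 1 - θ ≠ 0)]
    by_cases ht : γ = ∞
    · have : θ = 0 := by simp [hθ, ht]
      simp [this, e2]
    · have mA : Measurable A := by
        have : A = fun t => (∫⁻ x in B, ‖g (x, t)‖ₑ ^ γ.toReal) ^ (1 / γ.toReal) := by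
          ext t; rw [hA]; exact eLpNorm_eq_lintegral_rpow_enorm_toReal (pos_of_gt hγ).ne' ht
        rw [this]
        have : Measurable fun q : ℝ × E3 => ‖g (q.2, q.1)‖ₑ ^ γ.toReal := (hg.comp measurable_swap).enorm.pow_const _
        exact (this.lintegral_prod_right').pow_const _
      simp_rw [e2]
      exact ENNReal.lintegral_mul_norm_pow_le (mA.pow_const _).aemeasurable mn.aemeasurable (by linarith) θ0 (by ring)
  have tot : ∫⁻ z in pcyl z₀ ρ, ‖g z‖ₑ ^ 2 * ‖φ z‖ₑ ^ 2 ≤ ENNReal.ofReal (ε ^ 2) * ENNReal.ofReal (M ^ 2) := by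
    have mm : Measurable fun z => ‖g z‖ₑ ^ 2 * ‖φ z‖ₑ ^ 2 := (hg.enorm.pow_const 2).mul (mφ.enorm.pow_const 2)
    calc ∫⁻ z in pcyl z₀ ρ, ‖g z‖ₑ ^ 2 * ‖φ z‖ₑ ^ 2 ≤ ∫⁻ z in B ×ˢ I, ‖g z‖ₑ ^ 2 * ‖φ z‖ₑ ^ 2 :=
          lintegral_mono_set (prod_mono (Metric.ball_subset_ball ρr.le) subset_rfl)
      _ = ∫⁻ t in I, ∫⁻ x in B, ‖g (x, t)‖ₑ ^ 2 * ‖φ (x, t)‖ₑ ^ 2 := by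
          rw [Measure.volume_eq_prod, ← Measure.prod_restrict, lintegral_prod_symm' _ mm]
      _ ≤ ∫⁻ t in I, (ENNReal.ofReal (M ^ 2) ^ (1 - θ) * C ^ θ) * (A t ^ 2 * n t ^ θ) := by
          refine lintegral_mono fun t => ?_
          have hs : Measurable fun x : E3 => (x, t) := measurable_prodMk_right
          refine (slice_hold hγ (hg.comp hs) (mφ.comp hs)).trans ?_
          have u1 : (∫⁻ x in B, ‖φ (x, t)‖ₑ ^ 2) ^ (1 - θ) ≤ ENNReal.ofReal (M ^ 2) ^ (1 - θ) :=
            ENNReal.rpow_le_rpow ((setLIntegral_le_lintegral _ _).trans (s1 t)) (by linarith)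
          have u2 : (∫⁻ x in B, ‖φ (x, t)‖ₑ ^ (6 : ℝ)) ^ (1 / γ.toReal) ≤ C ^ θ * n t ^ θ := by
            rw [← ENNReal.mul_rpow_of_nonneg _ _ θ0]
            have := ENNReal.rpow_le_rpow (hG φ sφ t) θ0
            rw [← ENNReal.rpow_mul] at this
            refine le_trans (le_of_eq ?_) this
            congr 1; rw [hθ]; ring
          calc _ ≤ A t ^ 2 * (ENNReal.ofReal (M ^ 2) ^ (1 - θ) * (C ^ θ * n t ^ θ)) := by
                refine mul_le_mul' le_rfl (mul_le_mul' u1 u2)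
            _ = _ := by ring
      _ = (ENNReal.ofReal (M ^ 2) ^ (1 - θ) * C ^ θ) * ∫⁻ t in I, (A t ^ 2 * n t ^ θ) :=
          lintegral_const_mul' _ _ (mul_ne_top (ENNReal.rpow_ne_top_of_nonneg (by linarith) ofReal_ne_top) (ENNReal.rpow_ne_top_of_nonneg θ0 hC))
      _ ≤ (ENNReal.ofReal (M ^ 2) ^ (1 - θ) * C) * (κ ^ (1 - θ) * ENNReal.ofReal (M ^ 2) ^ θ) := by
          gcongr
          · calc C ^ θ ≤ C ^ (1 : ℝ) := ENNReal.rpow_le_rpow_of_exponent_le hC1 θ1.le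
              _ = C := ENNReal.rpow_one C
          · refine hold.trans (mul_le_mul' (ENNReal.rpow_le_rpow small (by linarith)) (ENNReal.rpow_le_rpow ?_ θ0))
            exact (setLIntegral_le_lintegral _ _).trans ni
      _ = (C * κ ^ (1 - θ)) * (ENNReal.ofReal (M ^ 2) ^ (1 - θ) * ENNReal.ofReal (M ^ 2) ^ θ) := by ring
      _ = _ := by
          rw [← ENNReal.rpow_add_of_nonneg _ _ (by linarith) θ0, hκ, ← ENNReal.rpow_mul,
            one_div_mul_cancel (by linarith : 1 - θ ≠ 0)]
          simp only [sub_add_cancel, ENNReal.rpow_one]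
          rw [ENNReal.mul_div_cancel C0 hC]
  have ms : Measurable ((pcyl z₀ ρ).indicator fun z => ‖g z‖ * φ z) := (hg.norm.mul mφ).indicator Qm
  have eN : eLpNorm ((pcyl z₀ ρ).indicator fun z => ‖g z‖ * φ z) 2 volume ≤ ENNReal.ofReal (ε * M) := by
    rw [eLpNorm_eq_lintegral_rpow_enorm_toReal (by norm_num) (by norm_num)]
    have e1 : ∫⁻ z, ‖((pcyl z₀ ρ).indicator fun z => ‖g z‖ * φ z) z‖ₑ ^ (2 : ℝ≥0∞).toReal = ∫⁻ z in pcyl z₀ ρ, ‖g z‖ₑ ^ 2 * ‖φ z‖ₑ ^ 2 := by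
      rw [← lintegral_indicator Qm]
      refine lintegral_congr fun z => ?_
      simp only [indicator]; split_ifs
      · simp [mul_pow]
      · simp
    rw [e1]
    calc _ ≤ (ENNReal.ofReal (ε ^ 2) * ENNReal.ofReal (M ^ 2)) ^ (1 / (2 : ℝ≥0∞).toReal) := by gcongr
      _ = ENNReal.ofReal (ε * M) := by
        rw [← ENNReal.ofReal_mul (by positivity), ← mul_pow, ENNReal.ofReal_rpow_of_nonneg (by positivity) (by simp)]
        simp only [toReal_ofNat]
        rw [← Real.sqrt_eq_rpow, Real.sqrt_sq (by positivity)]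
  exact ⟨⟨ms.aestronglyMeasurable, lt_of_le_of_lt eN ofReal_lt_top⟩, toReal_le_of_le_ofReal (by positivity) eN⟩


lemma Cut.K {z₀ : E3 × ℝ} {ρ' ρ : ℝ} {η : E3 × ℝ → ℝ} (h : Cut z₀ ρ' ρ η) (κ : ℝ) : ∃ K, 0 ≤ K ∧ ∀ z,
    |η z| ≤ K ∧ |η z + κ * tdz η z + ∑ i, sdz (sdz η i) i z| ≤ K ∧ ∀ i, |2 * sdz η i z| ≤ K ∧ |sdz η i z| ≤ K := by
  obtain ⟨A, A0, hA⟩ := ((h.tst.add (h.tst.tdz.const_mul κ)).add (Tst.sum Finset.univ fun i => (h.tst.sdz i).sdz i)).bdd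
  choose B B0 hB using fun i => (h.tst.sdz i).bdd
  have hs : ∀ i, B i ≤ ∑ j, B j := fun i => Finset.single_le_sum (fun j _ => B0 j) (Finset.mem_univ i)
  have S0 : 0 ≤ ∑ j, B j := Finset.sum_nonneg fun j _ => B0 j
  refine ⟨1 + A + 2 * ∑ i, B i, by positivity, fun z => ⟨?_, ?_, fun i => ⟨?_, ?_⟩⟩⟩
  · rw [abs_of_nonneg (h.nn z)]; linarith [h.le z]
  · linarith [hA z]
  · rw [abs_mul, abs_two]; linarith [hB i z, hs i]
  · linarith [hB i z, hs i]

/-- vorticity setup -/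
structure VS (z₀ : E3 × ℝ) (ρ : ℝ) (w : Fin 3 → E3 × ℝ → ℝ) (n G : E3 × ℝ → ℝ) (e : Fin 3 → E3 × ℝ → ℝ)
    (ka : Fin 3 → Fin 3 → E3 × ℝ → ℝ) : Prop where
  lf : ∀ c, LF 1 (pcyl z₀ ρ) (w c) (fun b z => n z * ka c b z)
  w2 : ∀ c, MemLp (w c) 2
  n2 : MemLp n 2
  me : ∀ c, Measurable (e c)
  mka : ∀ c b, Measurable (ka c b)
  n0 : ∀ z, 0 ≤ n z
  we : ∀ c z, w c z = n z * e c z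
  ee : ∀ z, n z * ∑ c, e c z ^ 2 = n z
  e1 : ∀ c z, |e c z| ≤ 1
  kG : ∀ c b z, |ka c b z| ≤ G z

lemma VS.ctr {z₀ : E3 × ℝ} {ρ' ρ : ℝ} {w : Fin 3 → E3 × ℝ → ℝ} {n G η : E3 × ℝ → ℝ} {e : Fin 3 → E3 × ℝ → ℝ}
    {ka : Fin 3 → Fin 3 → E3 × ℝ → ℝ} (h : VS z₀ ρ w n G e ka) (hη : Cut z₀ ρ' ρ η) (hm : Mlt (pcyl z₀ ρ) G (1 / 100)) :
    ∃ C, Ctr z₀.2 (pcyl z₀ ρ) G (fun c => (pcyl z₀ ρ).indicator fun z => η z * w c z) C := by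
  set Q := pcyl z₀ ρ with hQ
  have mQ : MeasurableSet Q := (pcyl_open z₀ ρ).measurableSet
  obtain ⟨K, K0, hK⟩ := hη.K 1
  have G0 : ∀ z, 0 ≤ G z := fun z => (abs_nonneg _).trans (h.kG 0 0 z)
  have L0 : 0 ≤ ∑ c, l2 (w c) := Finset.sum_nonneg fun c _ => l2_nn _
  have N0 := l2_nn n
  refine ⟨∑ c, K * (l2 (w c) + 3 * l2 (w c) + 3 * l2 n), fun c => ?_, fun z hz => hz.2.2, G0,
    Finset.sum_nonneg fun c _ => mul_nonneg K0 (by linarith [l2_nn (w c)]), hm, fun F hF hP => ?_⟩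
  · refine MemLp.indicator mQ ((h.w2 c).mono (hη.tst.cont.aestronglyMeasurable.mul (h.w2 c).1) (ae_of_all _ fun z => ?_))
    rw [norm_mul]
    refine mul_le_of_le_one_left (norm_nonneg _) ?_
    rw [Real.norm_eq_abs, abs_of_nonneg (hη.nn z)]; exact hη.le z
  set φ := fun c => Sop 1 (F c) with hφ
  have bφ : ∀ c b, BI (sdz (φ c) b) := fun c b => by rw [hφ, Sop_sdz (hF c)]; exact Sop_BI ((hF c).sdz b)
  set Y : E3 × ℝ → ℝ := fun z => ∑ c', ∑ b, ka c' b z * sdz (φ c') b z with hY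
  have mY : Measurable Y := Finset.measurable_fun_sum _ fun c _ => Finset.measurable_fun_sum _ fun b _ =>
    (h.mka c b).mul (bφ c b).smo.continuous.measurable
  have iB : ∀ (c b : Fin 3) (s : E3 × ℝ → ℝ) (D : ℝ), Measurable s → (∀ z, |s z| ≤ D) →
      IntegrableOn (fun z => n z * ka c b z * s z) Q := fun c b s D ms hs =>
    ((h.lf c).k1 b).mul_bdd (c := D) ms.aestronglyMeasurable (ae_of_all _ hs)
  have iM : ∀ (s : E3 × ℝ → ℝ) (D : ℝ), Measurable s → (∀ z, |s z| ≤ D) →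
      IntegrableOn (fun z => s z * (n z * Y z)) Q := fun s D ms hs => by
    have : (fun z => s z * (n z * Y z)) = fun z => ∑ c', ∑ b, n z * ka c' b z * (s z * sdz (φ c') b z) := by
      ext z; simp only [hY, Finset.mul_sum]
      refine Finset.sum_congr rfl fun c _ => Finset.sum_congr rfl fun b _ => by ring
    rw [this]
    refine integrable_finsetSum Finset.univ fun c _ => integrable_finsetSum Finset.univ fun b _ => ?_
    obtain ⟨B, B0, hB⟩ := (bφ c b).bdd
    exact iB c b _ (D * B) (ms.mul (bφ c b).smo.continuous.measurable) fun z => by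
      rw [abs_mul]; exact mul_le_mul (hs z) (hB z) (abs_nonneg _) ((abs_nonneg _).trans (hs z))
  refine ⟨fun c => Q.indicator fun z => e c z * Y z, fun c => (((h.me c).mul mY).indicator mQ).aestronglyMeasurable, fun c z => ?_, fun M hM hE => ?_⟩
  · simp only [indicator]; split_ifs with hz
    · rw [abs_mul]
      refine (mul_le_of_le_one_left (abs_nonneg _) (h.e1 c z)).trans ?_
      simp only [hY, Finset.mul_sum]
      refine (Finset.abs_sum_le_sum_abs _ _).trans (Finset.sum_le_sum fun c' _ =>
        (Finset.abs_sum_le_sum_abs _ _).trans (Finset.sum_le_sum fun b _ => ?_))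
      rw [abs_mul]; gcongr; exact h.kG c' b z
    · simp
  have e1 : ∀ c, ∫ z, (Q.indicator (fun z => η z * w c z) z) * F c z = ∫ z in Q, η z * w c z * F c z := fun c => by
    rw [← integral_indicator mQ]; congr 1; ext z; simp only [indicator]; split_ifs <;> simp
  have e2 : ∑ c, ∫ z, (Q.indicator (fun z => η z * w c z) z) * (Q.indicator (fun z => e c z * Y z) z) =
      ∑ c, ∫ z in Q, ∑ b, n z * ka c b z * (η z * sdz (φ c) b z) := by
    have : ∀ c, ∫ z, (Q.indicator (fun z => η z * w c z) z) * (Q.indicator (fun z => e c z * Y z) z) = ∫ z in Q, (η z * e c z ^ 2) * (n z * Y z) := fun c => by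
      rw [← integral_indicator mQ]; congr 1; ext z; simp only [indicator]; split_ifs
      · rw [h.we]; ring
      · simp
    simp_rw [this]
    rw [← integral_finsetSum Finset.univ, ← integral_finsetSum Finset.univ]
    · congr 1; ext z
      have := h.ee z
      calc _ = η z * (n z * ∑ c, e c z ^ 2) * Y z := by simp only [Fin.sum_univ_three (fun c => e c z ^ 2), Fin.sum_univ_three (fun c => η z * e c z ^ 2 * (n z * Y z))]; ring
        _ = _ := by
          rw [this]; simp only [hY, Finset.mul_sum]
          refine Finset.sum_congr rfl fun c _ => Finset.sum_congr rfl fun b _ => by ring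
    · intro c _
      refine integrable_finsetSum Finset.univ fun b _ => ?_
      obtain ⟨B, B0, hB⟩ := (bφ c b).bdd
      exact iB c b _ (K * B) (hη.tst.cont.measurable.mul (bφ c b).smo.continuous.measurable) fun z => by
        rw [abs_mul]; exact mul_le_mul (hK z).1 (hB z) (abs_nonneg _) K0
    · intro c _
      refine iM _ K (hη.tst.cont.measurable.mul ((h.me c).pow_const 2)) fun z => ?_
      rw [abs_mul, abs_pow]
      exact (mul_le_of_le_one_right (abs_nonneg _) (pow_le_one₀ (abs_nonneg _) (h.e1 c z))).trans (hK z).1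
  rw [e2]; simp_rw [e1]
  rw [← Finset.sum_sub_distrib, Finset.sum_mul]
  refine (Finset.abs_sum_le_sum_abs _ _).trans (Finset.sum_le_sum fun c _ => ?_)
  obtain ⟨t1, ht1, hF0⟩ := hP c
  rw [LF_loc zero_le_one (h.lf c) hη (hF c) ht1 hF0, add_sub_cancel_left]
  obtain ⟨m1, m2⟩ := hm (F c) (hF c) M hM (hE c)
  set P : E3 × ℝ → ℝ := Q.indicator fun z => G z * Sop 1 (F c) z with hPd
  have i1 := (mul_i (h.w2 c) (Sop_m (hF c))).abs
  have i2 := fun i => (mul_i (h.w2 c) (Sop_m' (hF c) i)).abs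
  have i3 := (mul_i h.n2 m1).abs
  have i23 : Integrable fun z => ∑ i, |w c z * sdz (Sop 1 (F c)) i z| := integrable_finsetSum Finset.univ fun i _ => i2 i
  have ib : Integrable fun z => K * (|w c z * Sop 1 (F c) z| + (∑ i, |w c z * sdz (Sop 1 (F c)) i z|) + 3 * |n z * P z|) :=
    ((i1.add i23).add (i3.const_mul 3)).const_mul K
  have b1 := norm_integral_le_of_norm_le (μ := volume.restrict Q) (f := fun z => (w c z * ((η z + 1 * tdz η z + ∑ i, sdz (sdz η i) i z) * Sop 1 (F c) z + ∑ i, 2 * sdz η i z * sdz (Sop 1 (F c)) i z)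
        + ∑ b, n z * ka c b z * (sdz η b z * Sop 1 (F c) z))) ib.integrableOn (by
    filter_upwards [ae_restrict_mem mQ] with z hz
    obtain ⟨k1, k2, k3⟩ := hK z
    have p1 : P z = G z * Sop 1 (F c) z := indicator_of_mem hz _
    rw [Real.norm_eq_abs, p1, mul_add, Finset.mul_sum]
    refine (abs_add_le _ _).trans ?_
    rw [mul_add, mul_add]
    refine add_le_add ((abs_add_le _ _).trans (add_le_add ?_ ?_)) ?_
    · rw [abs_mul, abs_mul, abs_mul]
      calc _ = |η z + 1 * tdz η z + ∑ i, sdz (sdz η i) i z| * (|w c z| * |Sop 1 (F c) z|) := by ring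
        _ ≤ _ := by gcongr
    · rw [Finset.mul_sum]
      refine (Finset.abs_sum_le_sum_abs _ _).trans (Finset.sum_le_sum fun i _ => ?_)
      rw [abs_mul, abs_mul, abs_mul (w c z)]
      calc _ = |2 * sdz η i z| * (|w c z| * |sdz (Sop 1 (F c)) i z|) := by ring
        _ ≤ _ := by have := (k3 i).1; gcongr
    · have : K * (3 * |n z * (G z * Sop 1 (F c) z)|) = ∑ b : Fin 3, K * |n z * (G z * Sop 1 (F c) z)| := by
        simp; ring
      rw [this]
      refine (Finset.abs_sum_le_sum_abs _ _).trans (Finset.sum_le_sum fun i _ => ?_)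
      rw [abs_mul, abs_mul, abs_mul, abs_mul (n z), abs_mul (G z), abs_of_nonneg (G0 z)]
      calc _ = |sdz η i z| * (|n z| * (|ka c i z| * |Sop 1 (F c) z|)) := by ring
        _ ≤ _ := by have := (k3 i).2; have := h.kG c i z; gcongr)
  refine b1.trans ((setIntegral_le_integral ib (ae_of_all _ fun z => by positivity)).trans ?_)
  have s1 : Integrable fun z => |w c z * Sop 1 (F c) z| + ∑ i, |w c z * sdz (Sop 1 (F c)) i z| := i1.add i23
  rw [integral_const_mul, integral_add s1 (i3.const_mul 3), integral_add i1 i23, integral_finsetSum Finset.univ fun i _ => i2 i, integral_const_mul, mul_assoc]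
  refine mul_le_mul_of_nonneg_left ?_ K0
  have W0 := l2_nn (w c)
  have q1 := (cs (h.w2 c) (Sop_m (hF c))).trans (mul_le_mul_of_nonneg_left (EB_l2 (hF c) hM (hE c)) W0)
  have q2 := fun i => (cs (h.w2 c) (Sop_m' (hF c) i)).trans (mul_le_mul_of_nonneg_left (EB_l2' (hF c) hM (hE c) i) W0)
  have q3 := (cs h.n2 m1).trans (mul_le_mul_of_nonneg_left (m2.trans (by linarith : _ ≤ M)) N0)
  rw [Fin.sum_univ_three]
  linarith [q2 0, q2 1, q2 2]


/-- flux of the vorticity equation -/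
def kfl (v : Fin 3 → E3 × ℝ → ℝ) (W : Fin 3 → Fin 3 → E3 × ℝ → ℝ) (c b : Fin 3) (z : E3 × ℝ) : ℝ :=
  if b = c + 1 then ∑ j, v j z * W j (c + 2) z else if b = c + 2 then - ∑ j, v j z * W j (c + 1) z else 0

section
variable {U : Set (E3 × ℝ)} {v : Fin 3 → E3 × ℝ → ℝ} {W : Fin 3 → Fin 3 → E3 × ℝ → ℝ} {z₀ : E3 × ℝ} {ρ : ℝ}

lemma nt_sdz {ψ : E3 × ℝ → ℝ} {Q : Set (E3 × ℝ)} (h : tsupport ψ ⊆ Q) (i) {z} (hz : z ∉ Q) : sdz ψ i z = 0 :=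
  image_eq_zero_of_notMem_tsupport fun h' => hz (h (tsupport_sdz ψ i h'))
lemma nt_tdz {ψ : E3 × ℝ → ℝ} {Q : Set (E3 × ℝ)} (h : tsupport ψ ⊆ Q) {z} (hz : z ∉ Q) : tdz ψ z = 0 :=
  image_eq_zero_of_notMem_tsupport fun h' => hz (h (tsupport_tdz ψ h'))

lemma NSF.lfv (h : NSF U v W) (hQ : pcyl z₀ ρ ⊆ U) (a : Fin 3) : LF 0 (pcyl z₀ ρ) (v a) (fun b => W b a) := by
  have fin : IsFiniteMeasure (volume.restrict (pcyl z₀ ρ)) := ⟨by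
    rw [Measure.restrict_apply_univ]
    exact ((Metric.isBounded_ball.prod (Metric.isBounded_Ioo _ _)).measure_lt_top)⟩
  have i2 : ∀ f : E3 × ℝ → ℝ, MemLp f 2 → IntegrableOn f (pcyl z₀ ρ) := fun f hf =>
    (hf.restrict _).integrable (by norm_num)
  refine ⟨h.mv a, fun b => h.mW b a, i2 _ (h.v2 a), fun b => i2 _ (h.W2 b a), fun ψ hψ hs => ?_⟩
  have := h.el ψ hψ (hs.trans hQ) a
  have s1 := fun (b : Fin 3) {z} (hz : z ∉ pcyl z₀ ρ) => nt_sdz hs b hz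
  have s2 : ∀ b, tsupport (sdz ψ b) ⊆ pcyl z₀ ρ := fun b => (tsupport_sdz ψ b).trans hs
  rw [setIntegral_eq_integral_of_forall_compl_eq_zero, setIntegral_eq_integral_of_forall_compl_eq_zero, integral_finsetSum Finset.univ, ← this, ← integral_neg]
  · congr 1; ext z; simp
  · intro b _; exact mul_i (h.W2 b a) ((hψ.sdz b).memLp 2)
  · intro z hz; simp [s1 _ hz]
  · intro z hz; simp [nt_sdz (s2 _) _ hz]

lemma NSF.lfw (h : NSF U v W) (hQ : pcyl z₀ ρ ⊆ U) (c : Fin 3) :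
    LF 1 (pcyl z₀ ρ) (W (c + 1) (c + 2)) (kfl v W c) := by
  have ih : ∀ a, Integrable fun z => ∑ j, v j z * W j a z := fun a =>
    integrable_finsetSum Finset.univ fun j _ => mul_i (h.v2 j) (h.W2 j a)
  have mh : ∀ a, Measurable fun z => ∑ j, v j z * W j a z := fun a =>
    Finset.measurable_fun_sum _ fun j _ => (h.mv j).mul (h.mW j a)
  refine ⟨h.mW _ _, fun b => ?_, (h.lfv hQ (c + 2)).k1 (c + 1), fun b => ?_, fun ψ hψ hs => ?_⟩
  · unfold kfl; split_ifs
    exacts [mh _, (mh _).neg, measurable_const]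
  · unfold kfl; split_ifs
    exacts [(ih _).integrableOn, (ih _).neg.integrableOn, (integrable_zero _ _ _).integrableOn]
  have := h.ve ψ hψ (hs.trans hQ) (c + 2) (c + 1)
  have s1 := fun (b : Fin 3) {z} (hz : z ∉ pcyl z₀ ρ) => nt_sdz hs b hz
  have s2 : ∀ b, tsupport (sdz ψ b) ⊆ pcyl z₀ ρ := fun b => (tsupport_sdz ψ b).trans hs
  rw [setIntegral_eq_integral_of_forall_compl_eq_zero, setIntegral_eq_integral_of_forall_compl_eq_zero]
  · simp only [neg_mul, one_mul]
    rw [this]; congr 1; ext z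
    fin_cases c <;> simp [kfl, Fin.sum_univ_three] <;> ring
  · intro z hz; simp [s1 _ hz]
  · intro z hz; simp [nt_sdz (s2 _) _ hz, nt_tdz hs hz]

/-- velocity and vorticity vectors -/
def vvec (v : Fin 3 → E3 × ℝ → ℝ) (z : E3 × ℝ) : E3 := vec3 (v 0 z) (v 1 z) (v 2 z)
def wvec (W : Fin 3 → Fin 3 → E3 × ℝ → ℝ) (z : E3 × ℝ) : E3 := vec3 (W 1 2 z) (W 2 0 z) (W 0 1 z)
def gvec (v : Fin 3 → E3 × ℝ → ℝ) (W : Fin 3 → Fin 3 → E3 × ℝ → ℝ) (z : E3 × ℝ) : E3 := cross3 (vvec v z) (unitd (wvec W z))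
def kap (v : Fin 3 → E3 × ℝ → ℝ) (W : Fin 3 → Fin 3 → E3 × ℝ → ℝ) (c b : Fin 3) (z : E3 × ℝ) : ℝ :=
  if b = c + 1 then - gvec v W z (c + 2) else if b = c + 2 then gvec v W z (c + 1) else 0

lemma vec3_m {a b c : E3 × ℝ → ℝ} (ha : Measurable a) (hb : Measurable b) (hc : Measurable c) : Measurable fun z => vec3 (a z) (b z) (c z) := by
  have : Measurable fun z => ![a z, b z, c z] := by
    refine measurable_pi_iff.2 fun i => ?_
    fin_cases i <;> simpa
  exact (PiLp.continuous_toLp 2 fun _ : Fin 3 => ℝ).measurable.comp this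
lemma co_m {f : E3 × ℝ → E3} (hf : Measurable f) (i : Fin 3) : Measurable fun z => f z i :=
  (EuclideanSpace.proj i : E3 →L[ℝ] ℝ).continuous.measurable.comp hf
lemma unitd_m {f : E3 × ℝ → E3} (hf : Measurable f) : Measurable fun z => unitd (f z) := hf.norm.inv.smul hf
lemma cross3_m {f g : E3 × ℝ → E3} (hf : Measurable f) (hg : Measurable g) : Measurable fun z => cross3 (f z) (g z) := by
  have := co_m hf; have := co_m hg
  exact vec3_m (by fun_prop) (by fun_prop) (by fun_prop)

lemma norm_unitd (x : E3) : ‖x‖ * ∑ c, unitd x c ^ 2 = ‖x‖ := by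
  by_cases hx : x = 0
  · simp [hx]
  · have h1 : ‖unitd x‖ = 1 := by
      unfold unitd; rw [norm_smul, norm_inv, norm_norm, inv_mul_cancel₀ (norm_ne_zero_iff.2 hx)]
    have h2 := EuclideanSpace.norm_sq_eq (unitd x)
    rw [h1] at h2; simp only [Real.norm_eq_abs, sq_abs] at h2
    rw [← h2]; simp
lemma unitd_mul (x : E3) (i) : ‖x‖ * unitd x i = x i := by
  by_cases hx : x = 0
  · simp [hx]
  · simp only [unitd, PiLp.smul_apply, smul_eq_mul]; rw [mul_inv_cancel_left₀ (norm_ne_zero_iff.2 hx)]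

lemma NSF.vs (h : NSF U v W) (anti : ∀ i j z, W i j z = - W j i z) (hQ : pcyl z₀ ρ ⊆ U) :
    VS z₀ ρ (fun c => W (c + 1) (c + 2)) (fun z => ‖wvec W z‖) (fun z => ‖gvec v W z‖) (fun c z => unitd (wvec W z) c) (kap v W) := by
  have mw : Measurable (wvec W) := vec3_m (h.mW _ _) (h.mW _ _) (h.mW _ _)
  have mg : Measurable (gvec v W) := cross3_m (vec3_m (h.mv 0) (h.mv 1) (h.mv 2)) (unitd_m mw)
  have wc : ∀ c z, wvec W z c = W (c + 1) (c + 2) z := fun c z => by fin_cases c <;> simp [wvec, vec3]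
  refine ⟨fun c => ?_, fun c => h.W2 _ _, ?_, fun c => co_m (unitd_m mw) c, fun c b => ?_, fun z => norm_nonneg _,
    fun c z => by rw [unitd_mul, wc], fun z => norm_unitd _, fun c z => ?_, fun c b z => ?_⟩
  · convert h.lfw hQ c using 1
    ext b z
    have key : ∀ a, ‖wvec W z‖ * gvec v W z a = - ∑ j, v j z * W j a z := fun a => by
      have a0 := unitd_mul (wvec W z) 0
      have a1 := unitd_mul (wvec W z) 1
      have a2 := unitd_mul (wvec W z) 2
      have d0 : W 0 0 z = 0 := by linarith [anti 0 0 z]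
      have d1 : W 1 1 z = 0 := by linarith [anti 1 1 z]
      have d2 : W 2 2 z = 0 := by linarith [anti 2 2 z]
      have b0 : wvec W z 0 = W 1 2 z := wc 0 z
      have b1 : wvec W z 1 = W 2 0 z := wc 1 z
      have b2 : wvec W z 2 = W 0 1 z := wc 2 z
      rw [b0] at a0; rw [b1] at a1; rw [b2] at a2
      have c0 : gvec v W z 0 = v 1 z * unitd (wvec W z) 2 - v 2 z * unitd (wvec W z) 1 := by simp [gvec, cross3, vvec, vec3]
      have c1 : gvec v W z 1 = v 2 z * unitd (wvec W z) 0 - v 0 z * unitd (wvec W z) 2 := by simp [gvec, cross3, vvec, vec3]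
      have c2 : gvec v W z 2 = v 0 z * unitd (wvec W z) 1 - v 1 z * unitd (wvec W z) 0 := by simp [gvec, cross3, vvec, vec3]
      rw [Fin.sum_univ_three]
      fin_cases a
      · change ‖wvec W z‖ * gvec v W z 0 = -(v 0 z * W 0 0 z + v 1 z * W 1 0 z + v 2 z * W 2 0 z)
        rw [c0, d0, anti 1 0, ← a1, ← a2]; ring
      · change ‖wvec W z‖ * gvec v W z 1 = -(v 0 z * W 0 1 z + v 1 z * W 1 1 z + v 2 z * W 2 1 z)
        rw [c1, d1, anti 2 1, ← a0, ← a2]; ring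
      · change ‖wvec W z‖ * gvec v W z 2 = -(v 0 z * W 0 2 z + v 1 z * W 1 2 z + v 2 z * W 2 2 z)
        rw [c2, d2, anti 0 2, ← a0, ← a1]; ring
    unfold kap kfl
    split_ifs
    · rw [mul_neg, key, neg_neg]
    · rw [key]
    · simp
  · refine (memLp_finsetSum Finset.univ fun c _ => (h.W2 (c + 1) (c + 2)).norm).mono mw.norm.aestronglyMeasurable (ae_of_all _ fun z => ?_)
    rw [norm_norm]
    refine le_trans ?_ (le_abs_self _)
    have : wvec W z = ∑ c, EuclideanSpace.single c (wvec W z c) := by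
      ext i; simp [Finset.sum_apply]
    rw [this]
    refine (norm_sum_le _ _).trans (Finset.sum_le_sum fun c _ => ?_)
    rw [PiLp.norm_single, wc]
  · unfold kap; split_ifs
    exacts [(co_m mg _).neg, co_m mg _, measurable_const]
  · refine (coord_le _ c).trans ?_
    unfold unitd; rw [norm_smul, norm_inv, norm_norm]; exact inv_mul_le_one
  · unfold kap; split_ifs
    · rw [abs_neg]; exact coord_le _ _
    · exact coord_le _ _
    · simp
end


/-- positive majorant operator -/
def Rop (κ : ℝ) (m : E3 × ℝ → ℝ≥0∞) (z : E3 × ℝ) : ℝ≥0∞ := ∫⁻ a, ENNReal.ofReal (wt a) * m (z - shf κ a) ∂nuM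

lemma wt_meas : Measurable fun a => ENNReal.ofReal (wt a) := by
  have : Continuous wt := by unfold wt wts wty; fun_prop
  exact this.measurable.ennreal_ofReal

lemma sh_meas {κ : ℝ} {m : E3 × ℝ → ℝ≥0∞} (hm : Measurable m) :
    Measurable fun q : (E3 × ℝ) × (ℝ × E3) => m (q.1 - shf κ q.2) := by
  have := shf_cont κ
  exact hm.comp (by fun_prop : Continuous fun q : (E3 × ℝ) × (ℝ × E3) => q.1 - shf κ q.2).measurable

lemma Rop_meas {κ : ℝ} {m : E3 × ℝ → ℝ≥0∞} (hm : Measurable m) : Measurable (Rop κ m) :=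
  Measurable.lintegral_prod_right' (f := fun q : (E3 × ℝ) × (ℝ × E3) => ENNReal.ofReal (wt q.2) * m (q.1 - shf κ q.2))
    ((wt_meas.comp measurable_snd).mul (sh_meas hm))

lemma dual0 {κ : ℝ} {m : E3 × ℝ → ℝ≥0∞} (hm : Measurable m) {F : E3 × ℝ → ℝ} (hF : Tst F) {f : E3 × ℝ → ℝ}
    (hf : ∀ z, |f z| ≤ (8 * cG) * ∫ a, wt a * |F (z + shf κ a)| ∂nuM) :
    ∫⁻ z, m z * ‖f z‖ₑ ≤ ENNReal.ofReal (8 * cG) * ∫⁻ z, Rop κ m z * ‖F z‖ₑ := by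
  have mF : Measurable fun z => ‖F z‖ₑ := hF.cont.measurable.enorm
  have b1 : ∀ z, m z * ‖f z‖ₑ ≤ ENNReal.ofReal (8 * cG) * ∫⁻ a, ENNReal.ofReal (wt a) * (m z * ‖F (z + shf κ a)‖ₑ) ∂nuM := by
    intro z
    have c1 : ‖f z‖ₑ ≤ ENNReal.ofReal (8 * cG) * ∫⁻ a, ENNReal.ofReal (wt a) * ‖F (z + shf κ a)‖ₑ ∂nuM := by
      rw [Real.enorm_eq_ofReal_abs]
      refine (ENNReal.ofReal_le_ofReal (hf z)).trans ?_
      rw [ENNReal.ofReal_mul (by have := cG_pos; positivity)]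
      gcongr
      rw [← Real.enorm_of_nonneg (integral_nonneg fun a => mul_nonneg (wt_pos a).le (abs_nonneg _))]
      refine (enorm_integral_le_lintegral_enorm _).trans (le_of_eq (lintegral_congr fun a => ?_))
      rw [enorm_mul, Real.enorm_abs, Real.enorm_of_nonneg (wt_pos a).le]
    calc _ ≤ m z * (ENNReal.ofReal (8 * cG) * ∫⁻ a, ENNReal.ofReal (wt a) * ‖F (z + shf κ a)‖ₑ ∂nuM) := by gcongr
      _ = ENNReal.ofReal (8 * cG) * (m z * ∫⁻ a, ENNReal.ofReal (wt a) * ‖F (z + shf κ a)‖ₑ ∂nuM) := by ring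
      _ = _ := by
        rw [← lintegral_const_mul]
        · congr 2; ext a; ring
        · have := shf_cont κ
          exact wt_meas.mul (mF.comp (by fun_prop : Continuous fun a => z + shf κ a).measurable)
  refine (lintegral_mono b1).trans ?_
  have m2 : Measurable (Function.uncurry fun (z : E3 × ℝ) (a : ℝ × E3) => ENNReal.ofReal (wt a) * (m z * ‖F (z + shf κ a)‖ₑ)) := by
    have := shf_cont κ
    exact (wt_meas.comp measurable_snd).mul ((hm.comp measurable_fst).mul
      (mF.comp (by fun_prop : Continuous fun q : (E3 × ℝ) × (ℝ × E3) => q.1 + shf κ q.2).measurable))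
  rw [lintegral_const_mul' _ _ ofReal_ne_top]
  refine mul_le_mul' le_rfl ?_
  rw [lintegral_lintegral_swap m2.aemeasurable]
  have e1 : ∀ a, ∫⁻ z, ENNReal.ofReal (wt a) * (m z * ‖F (z + shf κ a)‖ₑ) = ∫⁻ z, ENNReal.ofReal (wt a) * (m (z - shf κ a) * ‖F z‖ₑ) := fun a => by
    rw [← lintegral_sub_right_eq_self _ (shf κ a)]; simp
  simp_rw [e1]
  rw [lintegral_lintegral_swap]
  · refine le_of_eq (lintegral_congr fun z => ?_)
    unfold Rop
    rw [mul_comm, ← lintegral_const_mul' _ _ (by finiteness)]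
    congr 1; ext a; ring
  · exact ((wt_meas.comp measurable_fst).mul (((sh_meas hm).comp measurable_swap).mul (mF.comp measurable_snd))).aemeasurable

lemma pw {u P : E3 × ℝ → ℝ} {t0 : ℝ} (hu : MemLp u 2) (hP : MemLp P 2) (P0 : ∀ z, 0 ≤ P z)
    (h : ∀ F, Tst F → Pre t0 F → |∫ z, u z * F z| ≤ ∫ z, P z * |F z|) : ∀ᵐ z, z.2 < t0 → |u z| ≤ P z := by
  set F0 : E3 × ℝ → ℝ := fun z => SignType.sign (u z) * max (|u z| - P z) 0 with hF0
  set F : E3 × ℝ → ℝ := ((univ : Set E3) ×ˢ Iio t0).indicator F0 with hF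
  have mS : MeasurableSet ((univ : Set E3) ×ˢ Iio t0) := MeasurableSet.univ.prod measurableSet_Iio
  have aF : ∀ z, |F0 z| = max (|u z| - P z) 0 := by
    intro z
    simp only [hF0, abs_mul, abs_of_nonneg (le_max_right (|u z| - P z) 0)]
    rcases eq_or_ne (u z) 0 with h0 | h0
    · rw [h0]; simp [P0 z]
    · have : |((SignType.sign (u z) : SignType) : ℝ)| = 1 := by
        rcases lt_or_gt_of_ne h0 with h1 | h1
        · rw [sign_neg h1]; simp
        · rw [sign_pos h1]; simp
      rw [this, one_mul]
  have uF : ∀ z, u z * F0 z = |u z| * |F0 z| := fun z => by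
    rw [aF]; simp only [hF0]; rw [← mul_assoc, mul_comm (u z), sign_mul_self]
  have m0 : MemLp F0 2 := by
    refine hu.mono ?_ (ae_of_all _ fun z => ?_)
    · have a1 : AEMeasurable F0 := by
        have ms : Measurable fun x : ℝ => ((SignType.sign x : SignType) : ℝ) := by
          have : (fun x : ℝ => ((SignType.sign x : SignType) : ℝ)) = fun x => if 0 < x then 1 else if x < 0 then -1 else 0 := by
            ext x; rw [sign_apply]; split_ifs <;> simp
          rw [this]
          exact Measurable.ite measurableSet_Ioi measurable_const (Measurable.ite measurableSet_Iio measurable_const measurable_const)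
        exact (ms.comp_aemeasurable hu.1.aemeasurable).mul ((hu.1.aemeasurable.abs.sub hP.1.aemeasurable).max aemeasurable_const)
      exact a1.aestronglyMeasurable
    · rw [Real.norm_eq_abs, aF, Real.norm_eq_abs]
      exact max_le (by linarith [P0 z]) (abs_nonneg _)
  have mF : MemLp F 2 := m0.indicator mS
  have F0' : ∀ z : E3 × ℝ, t0 ≤ z.2 → F z = 0 := fun z hz => indicator_of_notMem (by simp [hz]) _
  have main : |∫ z, u z * F z| ≤ ∫ z, P z * |F z| := by
    refine eps_le (b := l2 u + l2 P) (add_nonneg (l2_nn _) (l2_nn _)) fun δ hδ => ?_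
    obtain ⟨F', t1, p1, m1, d1⟩ := dens mF F0' hδ
    have md : MemLp (fun z => F z - F' z) 2 := mF.sub m1
    have c1 := cs' hu md
    have c2 := cs hP md
    have e1 : ∫ z, u z * (F z - F' z) = (∫ z, u z * F z) - ∫ z, u z * F' z := by
      rw [← integral_sub (mul_i hu mF) (mul_i hu m1)]; congr 1; ext z; ring
    have i1 : Integrable fun z => P z * |F' z| := mul_i hP m1.norm
    have i2 : Integrable fun z => P z * |F z| := mul_i hP mF.norm
    have e2 : ∫ z, P z * |F' z| ≤ (∫ z, P z * |F z|) + ∫ z, |P z * (F z - F' z)| := by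
      rw [← integral_add i2 (mul_i hP md).abs]
      refine integral_mono i1 (i2.add (mul_i hP md).abs) fun z => ?_
      simp only
      rw [abs_mul, abs_of_nonneg (P0 z), ← mul_add]
      refine mul_le_mul_of_nonneg_left ?_ (P0 z)
      have := abs_sub_abs_le_abs_sub (F' z) (F z)
      rw [abs_sub_comm] at this; linarith
    have h2 := h F' t1 p1
    have q1 := mul_le_mul_of_nonneg_left d1 (l2_nn u)
    have q2 := mul_le_mul_of_nonneg_left d1 (l2_nn P)
    rw [e1] at c1
    have := abs_sub_abs_le_abs_sub (∫ z, u z * F z) (∫ z, u z * F' z)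
    linarith
  have i2 : Integrable fun z => P z * |F z| := mul_i hP mF.norm
  have k1 : ∫ z, F z ^ 2 ≤ 0 := by
    calc _ ≤ ∫ z, (u z * F z - P z * |F z|) := by
          refine integral_mono mF.integrable_sq ((mul_i hu mF).sub i2) fun z => ?_
          by_cases hz : z ∈ (univ : Set E3) ×ˢ Iio t0
          · simp only [hF, indicator_of_mem hz]
            rw [uF, ← sub_mul, ← sq_abs, sq]
            by_cases hh : 0 ≤ |u z| - P z
            · rw [aF, max_eq_left hh]
            · rw [aF, max_eq_right (by linarith)]; simp
          · simp [hF, indicator_of_notMem hz]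
      _ ≤ 0 := by
          rw [integral_sub (mul_i hu mF) i2]
          linarith [le_abs_self (∫ z, u z * F z)]
  have k2 := (integral_eq_zero_iff_of_nonneg (fun z => sq_nonneg (F z)) mF.integrable_sq).1 (le_antisymm k1 (integral_nonneg fun z => sq_nonneg _))
  filter_upwards [k2] with z hz ht
  have hz' : F z = 0 := by simpa using hz
  rw [hF, indicator_of_mem (by simpa using ht)] at hz'
  have := aF z
  rw [hz', abs_zero] at this
  linarith [le_max_left (|u z| - P z) 0]


lemma pcyl_mono {z₀ : E3 × ℝ} {ρ' ρ : ℝ} (h0 : 0 < ρ') (h1 : ρ' < ρ) : pcyl z₀ ρ' ⊆ pcyl z₀ ρ := by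
  have : ρ' ^ 2 ≤ ρ ^ 2 := by gcongr
  exact prod_mono (Metric.ball_subset_ball h1.le) (Ioo_subset_Ioo (by linarith) le_rfl)

lemma rep_pt {κ ρ ρ' : ℝ} {z₀ : E3 × ℝ} {u : E3 × ℝ → ℝ} {k : Fin 3 → E3 × ℝ → ℝ} (hκ : 0 ≤ κ)
    (h : LF κ (pcyl z₀ ρ) u k) (hu : MemLp u 2) (h0 : 0 < ρ') (h1 : ρ' < ρ) {m : E3 × ℝ → ℝ≥0∞} (hm : Measurable m)
    (hmu : ∀ᵐ z, z ∈ pcyl z₀ ρ → ENNReal.ofReal (|u z| + ∑ b, |k b z|) ≤ m z)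
    (hR : ∫⁻ z in (univ : Set E3) ×ˢ Iio z₀.2, Rop κ m z ^ 2 ≠ ∞) :
    ∃ C : ℝ≥0∞, C ≠ ∞ ∧ ∀ᵐ z, z ∈ pcyl z₀ ρ' → ‖u z‖ₑ ≤ C * Rop κ m z := by
  obtain ⟨η, hη⟩ := cutoff z₀ h0 h1
  obtain ⟨K, K0, hK⟩ := hη.K κ
  set Q := pcyl z₀ ρ with hQ
  have mQ : MeasurableSet Q := (pcyl_open z₀ ρ).measurableSet
  set S := (univ : Set E3) ×ˢ Iio z₀.2 with hS
  have mS : MeasurableSet S := MeasurableSet.univ.prod measurableSet_Iio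
  have mR := Rop_meas (κ := κ) hm
  set C : ℝ≥0∞ := 2 * ENNReal.ofReal K * (4 * ENNReal.ofReal (8 * cG)) with hC
  have C1 : C ≠ ∞ := by rw [hC]; finiteness
  refine ⟨C, C1, ?_⟩
  set P : E3 × ℝ → ℝ := fun z => (S.indicator (fun z => C * Rop κ m z) z).toReal with hPd
  have mP : Measurable P := (((measurable_const.mul mR).indicator mS)).ennreal_toReal
  have P2 : MemLp P 2 := by
    refine ⟨mP.aestronglyMeasurable, ?_⟩
    rw [eLpNorm_lt_top_iff_lintegral_rpow_enorm_lt_top (by norm_num) (by norm_num)]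
    have : ∫⁻ z, ‖P z‖ₑ ^ (2 : ℝ≥0∞).toReal ≤ C ^ 2 * ∫⁻ z in S, Rop κ m z ^ 2 := by
      rw [← lintegral_const_mul' _ _ (by finiteness), ← lintegral_indicator mS]
      refine lintegral_mono fun z => ?_
      simp only [toReal_ofNat, ENNReal.rpow_ofNat]
      by_cases hz : z ∈ S
      · rw [indicator_of_mem hz, ← mul_pow]
        refine pow_le_pow_left' ?_ 2
        rw [Real.enorm_of_nonneg toReal_nonneg]
        refine ofReal_toReal_le.trans ?_
        rw [indicator_of_mem hz]
      · rw [indicator_of_notMem hz]; simp [hPd, indicator_of_notMem hz]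
    exact this.trans_lt (ENNReal.mul_lt_top (by finiteness) hR.lt_top)
  have fin : ∀ᵐ z, z ∈ S → Rop κ m z < ∞ := by
    rw [← ae_restrict_iff' mS]
    filter_upwards [ae_lt_top (mR.pow_const 2) hR] with z hz
    by_contra hc
    rw [not_lt, top_le_iff] at hc
    rw [hc] at hz; simp at hz
  have U2 : MemLp (Q.indicator fun z => η z * u z) 2 := by
    refine MemLp.indicator mQ (hu.mono (hη.tst.cont.aestronglyMeasurable.mul hu.1) (ae_of_all _ fun z => ?_))
    rw [norm_mul]
    refine mul_le_of_le_one_left (norm_nonneg _) ?_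
    rw [Real.norm_eq_abs, abs_of_nonneg (hη.nn z)]; exact hη.le z
  have key := pw (t0 := z₀.2) U2 P2 (fun z => toReal_nonneg) fun F hF hP => by
    obtain ⟨t1, ht1, hF0⟩ := hP
    have e1 : ∫ z, (Q.indicator (fun z => η z * u z) z) * F z = ∫ z in Q, η z * u z * F z := by
      rw [← integral_indicator mQ]; congr 1; ext z; simp only [indicator]; split_ifs <;> simp
    have iP : Integrable fun z => P z * |F z| := mul_i P2 (hF.memLp 2).norm
    rw [e1, LF_loc hκ h hη hF ht1 hF0]
    set T : E3 × ℝ → ℝ := fun z => |Sop κ F z| + ∑ i, |sdz (Sop κ F) i z| with hT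
    have T0 : ∀ z, 0 ≤ T z := fun z => by positivity
    have mT : Measurable fun z => ‖Sop κ F z‖ₑ := (Sop_smo hF).continuous.measurable.enorm
    have mT' : ∀ i, Measurable fun z => ‖sdz (Sop κ F) i z‖ₑ := fun i => (Smo.sdz (Sop_smo hF) i).continuous.measurable.enorm
    have bT : ∫⁻ z, m z * ENNReal.ofReal (T z) ≤ 4 * ENNReal.ofReal (8 * cG) * ∫⁻ z, Rop κ m z * ‖F z‖ₑ := by
      have e2 : ∀ z, m z * ENNReal.ofReal (T z) = m z * ‖Sop κ F z‖ₑ + ∑ i, m z * ‖sdz (Sop κ F) i z‖ₑ := fun z => by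
        simp only [hT, Real.enorm_eq_ofReal_abs]
        rw [ENNReal.ofReal_add (abs_nonneg _) (by positivity), ENNReal.ofReal_sum_of_nonneg fun i _ => abs_nonneg _, mul_add, Finset.mul_sum]
      simp_rw [e2]
      rw [lintegral_add_left (show Measurable fun z => m z * ‖Sop κ F z‖ₑ from hm.mul mT), lintegral_finsetSum _ fun i _ => (show Measurable fun z => m z * ‖sdz (Sop κ F) i z‖ₑ from hm.mul (mT' i)), Fin.sum_univ_three]
      have d := dual0 (κ := κ) hm hF (Sop_dom hF)
      have d' := fun i => dual0 (κ := κ) hm hF (Sop_dom' hF i)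
      calc _ ≤ _ := add_le_add d (add_le_add (add_le_add (d' 0) (d' 1)) (d' 2))
        _ = _ := by ring
    have bnd : ∀ f : E3 × ℝ → ℝ, (∀ z, |f z| ≤ K * ((|u z| + ∑ b, |k b z|) * T z)) →
        ‖∫ z in Q, f z‖ₑ ≤ ENNReal.ofReal K * (4 * ENNReal.ofReal (8 * cG) * ∫⁻ z, Rop κ m z * ‖F z‖ₑ) := fun f hf => by
      refine (enorm_integral_le_lintegral_enorm _).trans (le_trans ?_ (mul_le_mul' le_rfl bT))
      rw [← lintegral_const_mul' _ _ ofReal_ne_top]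
      refine le_trans (lintegral_mono_ae ?_) (setLIntegral_le_lintegral Q _)
      filter_upwards [ae_restrict_mem mQ, ae_restrict_of_ae hmu] with z hz hz'
      rw [Real.enorm_eq_ofReal_abs]
      refine (ENNReal.ofReal_le_ofReal (hf z)).trans ?_
      rw [ENNReal.ofReal_mul K0, ENNReal.ofReal_mul (by positivity)]
      gcongr; exact hz' hz
    have f1 := bnd (fun z => ∑ b, k b z * (η z * sdz (Sop κ F) b z)) fun z => by
      obtain ⟨k1, k2, k3⟩ := hK z
      refine (Finset.abs_sum_le_sum_abs _ _).trans ?_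
      calc _ ≤ ∑ b, K * (|k b z| * T z) := Finset.sum_le_sum fun b _ => by
            rw [abs_mul, abs_mul]
            have : |sdz (Sop κ F) b z| ≤ T z := by
              have := Finset.single_le_sum (f := fun i => |sdz (Sop κ F) i z|) (fun i _ => abs_nonneg _) (Finset.mem_univ b)
              simp only [hT]; linarith [abs_nonneg (Sop κ F z)]
            calc _ = |η z| * (|k b z| * |sdz (Sop κ F) b z|) := by ring
              _ ≤ _ := by gcongr
        _ ≤ _ := by
            rw [← Finset.mul_sum, ← Finset.sum_mul]
            have := T0 z
            gcongr; linarith [abs_nonneg (u z)]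
    have f2 := bnd (fun z => (u z * ((η z + κ * tdz η z + ∑ i, sdz (sdz η i) i z) * Sop κ F z + ∑ i, 2 * sdz η i z * sdz (Sop κ F) i z)
        + ∑ b, k b z * (sdz η b z * Sop κ F z))) fun z => by
      obtain ⟨k1, k2, k3⟩ := hK z
      refine (abs_add_le _ _).trans ?_
      rw [show K * ((|u z| + ∑ b, |k b z|) * T z) = K * (|u z| * T z) + K * ((∑ b, |k b z|) * T z) by ring]
      refine add_le_add ?_ ?_
      · rw [abs_mul]
        calc _ ≤ |u z| * (K * T z) := by
              gcongr
              refine (abs_add_le _ _).trans ?_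
              simp only [hT]; rw [mul_add, Finset.mul_sum]
              refine add_le_add ?_ ((Finset.abs_sum_le_sum_abs _ _).trans (Finset.sum_le_sum fun i _ => ?_))
              · rw [abs_mul]; gcongr
              · rw [abs_mul]; have := (k3 i).1; gcongr
          _ = _ := by ring
      · rw [Finset.sum_mul, Finset.mul_sum]
        refine (Finset.abs_sum_le_sum_abs _ _).trans (Finset.sum_le_sum fun i _ => ?_)
        rw [abs_mul, abs_mul]
        have t1 : |Sop κ F z| ≤ T z := le_add_of_nonneg_right (by positivity)
        have t2 := (k3 i).2
        calc _ = |sdz η i z| * (|k i z| * |Sop κ F z|) := by ring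
          _ ≤ _ := by gcongr
    have e3 : C * ∫⁻ z, Rop κ m z * ‖F z‖ₑ = ENNReal.ofReal (∫ z, P z * |F z|) := by
      rw [ofReal_integral_eq_lintegral_ofReal iP (ae_of_all _ fun z => by positivity), ← lintegral_const_mul' _ _ C1]
      refine lintegral_congr_ae ?_
      filter_upwards [fin] with z hz
      by_cases hs : z ∈ S
      · simp only [hPd, indicator_of_mem hs]
        rw [ENNReal.ofReal_mul toReal_nonneg, ofReal_toReal (ENNReal.mul_ne_top C1 (hz hs).ne), Real.enorm_eq_ofReal_abs]
        exact (mul_assoc _ _ _).symm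
      · have : F z = 0 := hF0 z (by simp [hS] at hs; linarith)
        simp [this]
    have := (enorm_add_le _ _).trans (add_le_add f1 f2)
    rw [← ENNReal.ofReal_le_ofReal_iff (by positivity), ← e3, ← Real.enorm_eq_ofReal_abs]
    refine this.trans (le_of_eq ?_)
    rw [hC]; ring
  filter_upwards [key] with z hz hz'
  have hzQ := pcyl_mono h0 h1 hz'
  have := hz hzQ.2.2
  rw [indicator_of_mem hzQ, hη.one z hz', one_mul] at this
  rw [Real.enorm_eq_ofReal_abs]
  refine (ENNReal.ofReal_le_ofReal this).trans (ofReal_toReal_le.trans ?_)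
  rw [indicator_of_mem (by exact ⟨mem_univ _, hzQ.2.2⟩)]


lemma gam {s : ℝ} (hs : -1 < s) : ∫⁻ σ in Ioi (0 : ℝ), ENNReal.ofReal σ ^ s * ENNReal.ofReal (wts σ) ≠ ∞ := by
  have h := (integrableOn_rpow_mul_exp_neg_mul_sq (b := 1 / 2) (by norm_num) hs).lintegral_lt_top
  refine (lt_of_eq_of_lt ?_ h).ne
  refine setLIntegral_congr_fun measurableSet_Ioi fun σ hσ => ?_
  rw [ENNReal.ofReal_rpow_of_pos hσ, ← ENNReal.ofReal_mul (by have : 0 < σ := hσ; positivity)]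
  rfl

lemma ofR_m : Measurable fun a : ℝ × E3 => ENNReal.ofReal a.1 := measurable_fst.ennreal_ofReal

/-- total weight -/
def DD : ℝ≥0∞ := ∫⁻ a, ENNReal.ofReal a.1 ^ (-27 / 28 : ℝ) * ENNReal.ofReal (wt a) ∂nuM
lemma DD_fin : DD ≠ ∞ := by
  unfold DD nuM
  have : ∀ a : ℝ × E3, ENNReal.ofReal a.1 ^ (-27 / 28 : ℝ) * ENNReal.ofReal (wt a) =
      (ENNReal.ofReal a.1 ^ (-27 / 28 : ℝ) * ENNReal.ofReal (wts a.1)) * ENNReal.ofReal (wty a.2) := fun a => by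
    unfold wt; rw [ENNReal.ofReal_mul (wts_pos _).le, mul_assoc]
  simp_rw [this]
  rw [lintegral_prod_mul (f := fun s => ENNReal.ofReal s ^ (-27 / 28 : ℝ) * ENNReal.ofReal (wts s)) (g := fun y => ENNReal.ofReal (wty y))]
  · exact ENNReal.mul_ne_top (gam (by norm_num)) wty_int.lintegral_lt_top.ne
  · have : Continuous wts := by unfold wts; fun_prop
    exact ((measurable_id.ennreal_ofReal.pow_const _).mul this.measurable.ennreal_ofReal).aemeasurable
  · have : Continuous wty := by unfold wty; fun_prop
    exact this.measurable.ennreal_ofReal.aemeasurable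

lemma scal {f : E3 → ℝ≥0∞} (hf : Measurable f) (x : E3) {c : ℝ} (hc : 0 < c) :
    ∫⁻ y, f (x - c • y) = ENNReal.ofReal ((c ^ 3)⁻¹) * ∫⁻ y, f y := by
  have h1 := Measure.map_addHaar_smul (volume : Measure E3) hc.ne'
  have m1 : Measurable fun y => f (x - y) := hf.comp (measurable_const.sub measurable_id)
  have h2 : ∫⁻ y, f (x - c • y) = ∫⁻ y, f (x - y) ∂(Measure.map (fun y : E3 => c • y) volume) := by
    rw [lintegral_map m1 (measurable_const_smul c)]
  rw [h2, h1, lintegral_smul_measure, lintegral_sub_left_eq_self f x]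
  simp only [finrank_euclideanSpace, Fintype.card_fin, smul_eq_mul]
  rw [abs_of_pos (by positivity)]

section
variable {κ p M : ℝ} {m : E3 × ℝ → ℝ≥0∞} {L : ℝ≥0∞}

lemma Bbd {f : E3 × ℝ → ℝ≥0∞} (hf : Measurable f) (hL : ∀ t, ∫⁻ x, f (x, t) ≤ L) (z : E3 × ℝ) :
    ∫⁻ a, ENNReal.ofReal a.1 ^ (9 / 4 : ℝ) * ENNReal.ofReal (wt a) * f (z - shf κ a) ∂nuM ≤
      (∫⁻ σ in Ioi (0 : ℝ), ENNReal.ofReal σ ^ (-3 / 4 : ℝ) * ENNReal.ofReal (wts σ)) * L := by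
  have mz : Measurable fun a => f (z - shf κ a) := (sh_meas hf).comp measurable_prodMk_left
  have mm : Measurable fun a : ℝ × E3 => ENNReal.ofReal a.1 ^ (9 / 4 : ℝ) * ENNReal.ofReal (wt a) * f (z - shf κ a) :=
    ((ofR_m.pow_const _).mul wt_meas).mul mz
  have ms : Measurable fun σ => ENNReal.ofReal σ ^ (-3 / 4 : ℝ) * ENNReal.ofReal (wts σ) := by
    have : Continuous wts := by unfold wts; fun_prop
    exact (measurable_id.ennreal_ofReal.pow_const _).mul this.measurable.ennreal_ofReal
  unfold nuM
  rw [lintegral_prod _ mm.aemeasurable, ← lintegral_mul_const _ ms]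
  refine setLIntegral_mono (ms.mul_const _) fun σ hσ => ?_
  have s0 : 0 < σ := hσ
  have mt : Measurable fun x => f (x, z.2 - κ * σ ^ 2) := hf.comp measurable_prodMk_right
  calc _ ≤ ∫⁻ y, (ENNReal.ofReal σ ^ (9 / 4 : ℝ) * ENNReal.ofReal (wts σ)) * f (z.1 - (2 * σ) • y, z.2 - κ * σ ^ 2) := by
        refine lintegral_mono fun y => ?_
        refine mul_le_mul' (mul_le_mul' le_rfl (ENNReal.ofReal_le_ofReal ?_)) le_rfl
        unfold wt
        refine mul_le_of_le_one_right (wts_pos _).le ?_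
        unfold wty; exact Real.exp_le_one_iff.2 (by nlinarith [sq_nonneg ‖y‖])
    _ = (ENNReal.ofReal σ ^ (9 / 4 : ℝ) * ENNReal.ofReal (wts σ)) * (ENNReal.ofReal (((2 * σ) ^ 3)⁻¹) * ∫⁻ y, f (y, z.2 - κ * σ ^ 2)) := by
        rw [lintegral_const_mul' _ _ (by have := ENNReal.rpow_ne_top_of_nonneg (y := 9 / 4) (by norm_num) (ofReal_ne_top (r := σ)); finiteness), scal mt z.1 (by positivity)]
    _ ≤ (ENNReal.ofReal σ ^ (9 / 4 : ℝ) * ENNReal.ofReal (wts σ)) * (ENNReal.ofReal (σ ^ (-3 : ℝ)) * L) := by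
        gcongr
        · rw [Real.rpow_neg s0.le]
          gcongr
          rw [show (3 : ℝ) = (3 : ℕ) by norm_num, Real.rpow_natCast]
          gcongr; linarith
        · exact hL _
    _ = (ENNReal.ofReal σ ^ (9 / 4 : ℝ) * ENNReal.ofReal (σ ^ (-3 : ℝ))) * ENNReal.ofReal (wts σ) * L := by ring
    _ = _ := by
        rw [← ENNReal.ofReal_rpow_of_pos s0, ← ENNReal.rpow_add _ _ (by simpa using s0) ofReal_ne_top]
        norm_num

lemma map_lem (hp : 1 ≤ p) {iq : ℝ} (hq : 0 ≤ iq) (hpq : iq + 3 / 10 = 1 / p) (hm : Measurable m) (hL1 : L ≠ ∞)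
    (hL : ∀ t, ∫⁻ x, m (x, t) ^ p ≤ L) : ∃ C : ℝ≥0∞, C ≠ ∞ ∧ ∃ A : E3 × ℝ → ℝ≥0∞, (∀ t, ∫⁻ x, A (x, t) ≤ C) ∧
      ∀ z, Rop κ m z ≤ C * A z ^ iq := by
  have p0 : 0 < p := by linarith
  set B0 := ∫⁻ σ in Ioi (0 : ℝ), ENNReal.ofReal σ ^ (-3 / 4 : ℝ) * ENNReal.ofReal (wts σ) with hB0
  have B1 : B0 ≠ ∞ := gam (by norm_num)
  have hp1 : 0 ≤ 1 - 1 / p := by rw [sub_nonneg, div_le_one p0]; exact hp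
  have mf : Measurable fun z => m z ^ p := hm.pow_const p
  set A : E3 × ℝ → ℝ≥0∞ := fun z => ∫⁻ a, ENNReal.ofReal a.1 ^ (-27 / 28 : ℝ) * ENNReal.ofReal (wt a) * m (z - shf κ a) ^ p ∂nuM with hA
  have r1 : (B0 * L) ^ (3 / 10 : ℝ) ≠ ∞ := ENNReal.rpow_ne_top_of_nonneg (by norm_num) (by finiteness)
  have r2 : DD ^ (1 - 1 / p) ≠ ∞ := ENNReal.rpow_ne_top_of_nonneg hp1 DD_fin
  have r3 := DD_fin
  refine ⟨DD * L + (B0 * L) ^ (3 / 10 : ℝ) * DD ^ (1 - 1 / p), by finiteness, A, fun t => ?_, fun z => ?_⟩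
  · refine le_trans ?_ le_self_add
    have m2 : Measurable (Function.uncurry fun (x : E3) (a : ℝ × E3) => ENNReal.ofReal a.1 ^ (-27 / 28 : ℝ) * ENNReal.ofReal (wt a) * m ((x, t) - shf κ a) ^ p) := by
      refine (((ofR_m.pow_const _).mul wt_meas).comp measurable_snd).mul ?_
      exact (sh_meas mf).comp (f := fun q : E3 × (ℝ × E3) => ((q.1, t), q.2)) (by fun_prop)
    simp only [hA]
    rw [lintegral_lintegral_swap m2.aemeasurable]
    unfold DD
    rw [← lintegral_mul_const _ (show Measurable fun a : ℝ × E3 => ENNReal.ofReal a.1 ^ (-27 / 28 : ℝ) * ENNReal.ofReal (wt a) from (ofR_m.pow_const _).mul wt_meas)]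
    refine lintegral_mono fun a => ?_
    have m3 : Measurable fun x => m (x, t - κ * a.1 ^ 2) ^ p := mf.comp measurable_prodMk_right
    have e : ∀ x, m ((x, t) - shf κ a) ^ p = m (x - (2 * a.1) • a.2, t - κ * a.1 ^ 2) ^ p := fun x => rfl
    simp_rw [e]
    rw [lintegral_const_mul _ (show Measurable fun x => m (x - (2 * a.1) • a.2, t - κ * a.1 ^ 2) ^ p from m3.comp (measurable_id.sub_const _)), lintegral_sub_right_eq_self (fun x => m (x, t - κ * a.1 ^ 2) ^ p)]
    exact mul_le_mul' le_rfl (hL _)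
  · have mz : Measurable fun a => m (z - shf κ a) := (sh_meas hm).comp measurable_prodMk_left
    have key := ENNReal.lintegral_prod_norm_pow_le (μ := nuM) (Finset.univ : Finset (Fin 3))
      (f := ![fun a => ENNReal.ofReal a.1 ^ (-27 / 28 : ℝ) * ENNReal.ofReal (wt a) * m (z - shf κ a) ^ p,
        fun a => ENNReal.ofReal a.1 ^ (9 / 4 : ℝ) * ENNReal.ofReal (wt a) * m (z - shf κ a) ^ p,
        fun a => ENNReal.ofReal a.1 ^ (-27 / 28 : ℝ) * ENNReal.ofReal (wt a)])
      (by
        intro i _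
        fin_cases i
        · exact (((ofR_m.pow_const _).mul wt_meas).mul (mz.pow_const p)).aemeasurable
        · exact (((ofR_m.pow_const _).mul wt_meas).mul (mz.pow_const p)).aemeasurable
        · exact ((ofR_m.pow_const _).mul wt_meas).aemeasurable) (p := ![iq, 3 / 10, 1 - 1 / p])
      (by simp [Fin.sum_univ_three]; rw [← one_div]; linarith)
      (by
        intro i _
        fin_cases i
        · simpa using hq
        · simp; norm_num
        · simpa using hp1)
    simp only [Fin.prod_univ_three, Matrix.cons_val_zero, Matrix.cons_val_one, Matrix.cons_val_two, Matrix.cons_val] at key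
    have e1 : Rop κ m z = ∫⁻ a, (ENNReal.ofReal a.1 ^ (-27 / 28 : ℝ) * ENNReal.ofReal (wt a) * m (z - shf κ a) ^ p) ^ iq *
        (ENNReal.ofReal a.1 ^ (9 / 4 : ℝ) * ENNReal.ofReal (wt a) * m (z - shf κ a) ^ p) ^ (3 / 10 : ℝ) *
        (ENNReal.ofReal a.1 ^ (-27 / 28 : ℝ) * ENNReal.ofReal (wt a)) ^ (1 - 1 / p) ∂nuM := by
      refine lintegral_congr_ae ?_
      filter_upwards [nuM_pos] with a ha
      have s0 : ENNReal.ofReal a.1 ≠ 0 := by simpa using ha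
      have s1 : ENNReal.ofReal a.1 ≠ ∞ := ofReal_ne_top
      have w0 : ENNReal.ofReal (wt a) ≠ 0 := by simpa using wt_pos a
      have w1 : ENNReal.ofReal (wt a) ≠ ∞ := ofReal_ne_top
      generalize ENNReal.ofReal a.1 = s at *
      generalize ENNReal.ofReal (wt a) = w at *
      generalize m (z - shf κ a) = μ
      rw [ENNReal.mul_rpow_of_nonneg _ _ hq, ENNReal.mul_rpow_of_nonneg _ _ hq, ENNReal.mul_rpow_of_nonneg _ _ (by norm_num : (0 : ℝ) ≤ 3 / 10),
        ENNReal.mul_rpow_of_nonneg _ _ (by norm_num : (0 : ℝ) ≤ 3 / 10), ENNReal.mul_rpow_of_nonneg _ _ hp1]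
      simp only [← ENNReal.rpow_mul]
      calc w * μ = s ^ (-27 / 28 * iq + 9 / 4 * (3 / 10) + -27 / 28 * (1 - 1 / p)) * w ^ (iq + 3 / 10 + (1 - 1 / p)) * μ ^ (p * iq + p * (3 / 10)) := by
            rw [← hpq, ← mul_add, hpq, mul_one_div_cancel p0.ne', show iq = 1 / p - 3 / 10 by linarith]
            ring_nf; simp
        _ = _ := by
            rw [ENNReal.rpow_add _ _ s0 s1, ENNReal.rpow_add _ _ s0 s1, ENNReal.rpow_add _ _ w0 w1, ENNReal.rpow_add _ _ w0 w1,
              ENNReal.rpow_add_of_nonneg _ _ (by positivity) (by positivity)]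
            ring
    rw [e1]
    refine key.trans ?_
    calc _ ≤ A z ^ iq * (B0 * L) ^ (3 / 10 : ℝ) * DD ^ (1 - 1 / p) := by
          refine mul_le_mul' (mul_le_mul' le_rfl (ENNReal.rpow_le_rpow (Bbd mf hL z) (by norm_num))) le_rfl
      _ = ((B0 * L) ^ (3 / 10 : ℝ) * DD ^ (1 - 1 / p)) * A z ^ iq := by ring
      _ ≤ _ := mul_le_mul' le_add_self le_rfl
end


lemma ae_sw {P : E3 × ℝ → Prop} (h : ∀ᵐ z, P z) : ∀ᵐ t : ℝ, ∀ᵐ x : E3, P (x, t) :=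
  Measure.ae_ae_of_ae_prod ((Measure.measurePreserving_swap (μ := (volume : Measure ℝ)) (ν := (volume : Measure E3))).quasiMeasurePreserving.ae h)

/-- local slice bound -/
def Bd (Q : Set (E3 × ℝ)) (p : ℝ) (f : E3 × ℝ → ℝ≥0∞) : Prop :=
  Measurable f ∧ ∃ M : ℝ≥0∞, M ≠ ∞ ∧ ∀ᵐ t : ℝ, ∫⁻ x, Q.indicator (fun z => f z ^ p) (x, t) ≤ M

section
variable {κ ρ ρ' p iq : ℝ} {z₀ : E3 × ℝ} {u : E3 × ℝ → ℝ} {k : Fin 3 → E3 × ℝ → ℝ}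

lemma pcyl_meas : MeasurableSet (pcyl z₀ ρ) := (pcyl_open _ _).measurableSet

lemma sl_meas {f : E3 × ℝ → ℝ≥0∞} (hf : Measurable f) : Measurable fun t : ℝ => ∫⁻ x, f (x, t) := by
  have : Measurable fun q : ℝ × E3 => f (q.2, q.1) := hf.comp measurable_swap
  exact this.lintegral_prod_right'

lemma boot0 (hκ : 0 ≤ κ) (h : LF κ (pcyl z₀ ρ) u k) (hu : MemLp u 2) (h0 : 0 < ρ') (h1 : ρ' < ρ)
    (hb : Bd (pcyl z₀ ρ) p fun z => ENNReal.ofReal (|u z| + ∑ b, |k b z|)) (hp : 5 / 4 ≤ p) (hq : 0 ≤ iq) (hpq : iq + 3 / 10 = 1 / p) :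
    ∃ C : ℝ≥0∞, C ≠ ∞ ∧ ∃ A : E3 × ℝ → ℝ≥0∞, (∀ t, ∫⁻ x, A (x, t) ≤ C) ∧ ∀ᵐ z, z ∈ pcyl z₀ ρ' → ‖u z‖ₑ ≤ C * A z ^ iq := by
  obtain ⟨fm, M, M1, hM⟩ := hb
  set f : E3 × ℝ → ℝ≥0∞ := fun z => ENNReal.ofReal (|u z| + ∑ b, |k b z|) with hf
  have p0 : 0 < p := by linarith
  set N : Set ℝ := {t | ∫⁻ x, (pcyl z₀ ρ).indicator (fun z => f z ^ p) (x, t) ≤ M} with hN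
  have Nm : MeasurableSet N := measurableSet_le (sl_meas ((fm.pow_const p).indicator pcyl_meas)) measurable_const
  set m : E3 × ℝ → ℝ≥0∞ := (pcyl z₀ ρ ∩ Prod.snd ⁻¹' N).indicator f with hm
  have mm : Measurable m := fm.indicator (pcyl_meas.inter (measurable_snd Nm))
  have m0 : ∀ z, z ∉ pcyl z₀ ρ → m z = 0 := fun z hz => indicator_of_notMem (fun h => hz h.1) _
  have mL : ∀ t, ∫⁻ x, m (x, t) ^ p ≤ M := fun t => by
    by_cases ht : t ∈ N
    · refine le_trans (lintegral_mono fun x => ?_) ht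
      by_cases hx : (x, t) ∈ pcyl z₀ ρ
      · simp only [hm]
        rw [indicator_of_mem hx, indicator_of_mem (show (x, t) ∈ pcyl z₀ ρ ∩ Prod.snd ⁻¹' N from ⟨hx, ht⟩)]
      · simp only [m0 _ hx]; rw [ENNReal.zero_rpow_of_pos p0]; exact zero_le
    · have : ∀ x, m (x, t) = 0 := fun x => indicator_of_notMem (fun h => ht h.2) _
      simp [this, ENNReal.zero_rpow_of_pos p0]
  have hmu : ∀ᵐ z, z ∈ pcyl z₀ ρ → f z ≤ m z := by
    have : ∀ᵐ z : E3 × ℝ, z.2 ∈ N := Measure.quasiMeasurePreserving_snd.ae hM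
    filter_upwards [this] with z hz hzQ
    simp only [hm]; rw [indicator_of_mem (show z ∈ pcyl z₀ ρ ∩ Prod.snd ⁻¹' N from ⟨hzQ, hz⟩)]
  have hR : ∫⁻ z in (univ : Set E3) ×ˢ Iio z₀.2, Rop κ m z ^ 2 ≠ ∞ := by
    have mL' : ∀ t, ∫⁻ x, m (x, t) ^ (5 / 4 : ℝ) ≤ volume (Metric.ball z₀.1 ρ) + M := fun t => by
      calc _ ≤ ∫⁻ x, ((Metric.ball z₀.1 ρ).indicator 1 x + m (x, t) ^ p) := by
            refine lintegral_mono fun x => ?_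
            by_cases hx : (x, t) ∈ pcyl z₀ ρ
            · simp only [indicator_of_mem hx.1, Pi.one_apply]
              rcases le_total (m (x, t)) 1 with h | h
              · exact le_add_right (ENNReal.rpow_le_one h (by norm_num))
              · exact le_add_left (ENNReal.rpow_le_rpow_of_exponent_le h hp)
            · simp only [m0 _ hx]; rw [ENNReal.zero_rpow_of_pos (by norm_num)]; exact zero_le
        _ = volume (Metric.ball z₀.1 ρ) + ∫⁻ x, m (x, t) ^ p := by
            rw [lintegral_add_left (measurable_one.indicator measurableSet_ball), lintegral_indicator_one measurableSet_ball]
        _ ≤ _ := add_le_add le_rfl (mL t)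
    have vb : volume (Metric.ball z₀.1 ρ) ≠ ∞ := measure_ball_lt_top.ne
    obtain ⟨C, C1, A, hA, hRA⟩ := map_lem (κ := κ) (p := 5 / 4) (iq := 1 / 2) (by norm_num) (by norm_num) (by norm_num) mm (by finiteness) mL'
    have z1 : ∀ z : E3 × ℝ, z.2 ≤ z₀.2 - ρ ^ 2 → Rop κ m z = 0 := fun z hz => by
      unfold Rop
      refine lintegral_eq_zero_of_ae_eq_zero (Eventually.of_forall fun a => ?_)
      have : m (z - shf κ a) = 0 := m0 _ fun h => by
        have e : (z - shf κ a).2 = z.2 - κ * a.1 ^ 2 := rfl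
        have := h.2.1
        have : 0 ≤ κ * a.1 ^ 2 := by positivity
        linarith
      simp [this]
    rw [← lintegral_indicator (MeasurableSet.univ.prod measurableSet_Iio), Measure.volume_eq_prod,
      lintegral_prod_symm _ (((Rop_meas mm).pow_const 2).indicator (MeasurableSet.univ.prod measurableSet_Iio)).aemeasurable]
    refine ne_top_of_le_ne_top (b := ∫⁻ t, (Ioo (z₀.2 - ρ ^ 2) z₀.2).indicator (fun _ => C ^ 2 * C) t) ?_ (lintegral_mono fun t => ?_)
    · rw [lintegral_indicator measurableSet_Ioo, setLIntegral_const, Real.volume_Ioo]; finiteness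
    · by_cases ht : t ∈ Ioo (z₀.2 - ρ ^ 2) z₀.2
      · rw [indicator_of_mem ht]
        calc _ ≤ ∫⁻ x, C ^ 2 * A (x, t) := by
              refine lintegral_mono fun x => (indicator_le_self' (fun _ _ => zero_le) _).trans ?_
              refine (pow_le_pow_left₀ zero_le (hRA (x, t)) 2).trans (le_of_eq ?_)
              rw [mul_pow, ← ENNReal.rpow_natCast (A (x, t) ^ (1 / 2 : ℝ)), ← ENNReal.rpow_mul]; norm_num
          _ = C ^ 2 * ∫⁻ x, A (x, t) := lintegral_const_mul' _ _ (by finiteness)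
          _ ≤ _ := mul_le_mul' le_rfl (hA t)
      · rw [indicator_of_notMem ht]
        refine le_of_eq (lintegral_eq_zero_of_ae_eq_zero (Eventually.of_forall fun x => ?_))
        by_cases h2 : t < z₀.2
        · have : t ≤ z₀.2 - ρ ^ 2 := by by_contra h3; exact ht ⟨not_le.1 h3, h2⟩
          simp only [Pi.zero_apply, indicator_apply_eq_zero]
          intro _; rw [z1 (x, t) this]; simp
        · exact indicator_of_notMem (fun h => h2 h.2) _
  obtain ⟨C, C1, hC⟩ := rep_pt hκ h hu h0 h1 mm hmu hR
  obtain ⟨D, D1, A, hA, hRA⟩ := map_lem (κ := κ) (by linarith) hq hpq mm M1 mL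
  refine ⟨C * D + D, by finiteness, A, fun t => (hA t).trans le_add_self, ?_⟩
  filter_upwards [hC] with z hz hzQ
  calc _ ≤ C * Rop κ m z := hz hzQ
    _ ≤ C * (D * A z ^ iq) := mul_le_mul' le_rfl (hRA z)
    _ = C * D * A z ^ iq := (mul_assoc _ _ _).symm
    _ ≤ _ := mul_le_mul' le_self_add le_rfl

lemma boot (hκ : 0 ≤ κ) (h : LF κ (pcyl z₀ ρ) u k) (hu : MemLp u 2) (h0 : 0 < ρ') (h1 : ρ' < ρ)
    (hb : Bd (pcyl z₀ ρ) p fun z => ENNReal.ofReal (|u z| + ∑ b, |k b z|)) (hp : 5 / 4 ≤ p) {q : ℝ} (hq : 0 < q) (hpq : 1 / q + 3 / 10 = 1 / p) :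
    Bd (pcyl z₀ ρ') q fun z => ‖u z‖ₑ := by
  obtain ⟨C, C1, A, hA, hC⟩ := boot0 hκ h hu h0 h1 hb hp (by positivity) hpq
  have C2 : C ^ q ≠ ∞ := ENNReal.rpow_ne_top_of_nonneg hq.le C1
  refine ⟨h.mu.enorm, C ^ q * C, by finiteness, ?_⟩
  filter_upwards [ae_sw hC] with t ht
  calc _ ≤ ∫⁻ x, C ^ q * A (x, t) := by
        refine lintegral_mono_ae ?_
        filter_upwards [ht] with x hx
        by_cases hxQ : (x, t) ∈ pcyl z₀ ρ'
        · rw [indicator_of_mem hxQ]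
          refine (ENNReal.rpow_le_rpow (hx hxQ) hq.le).trans (le_of_eq ?_)
          rw [ENNReal.mul_rpow_of_nonneg _ _ hq.le, ← ENNReal.rpow_mul, one_div_mul_cancel hq.ne', ENNReal.rpow_one]
        · rw [indicator_of_notMem hxQ]; exact zero_le
    _ = C ^ q * ∫⁻ x, A (x, t) := lintegral_const_mul' _ _ C2
    _ ≤ _ := mul_le_mul' le_rfl (hA t)

lemma Bd.mono {Q Q' : Set (E3 × ℝ)} {f : E3 × ℝ → ℝ≥0∞} (h : Bd Q p f) (hQ : Q' ⊆ Q) : Bd Q' p f := by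
  obtain ⟨a, M, M1, hM⟩ := h
  refine ⟨a, M, M1, ?_⟩
  filter_upwards [hM] with t ht
  exact (lintegral_mono fun x => indicator_le_indicator_of_subset hQ (fun _ => zero_le) _).trans ht

lemma Bd.of_le {r s : ℝ} {g h : Fin 3 → E3 × ℝ → ℝ≥0∞} {f : E3 × ℝ → ℝ≥0∞} (fm : Measurable f) (p0 : 0 < p) (s0 : 0 < s) (r0 : 0 < r)
    (hg : ∀ i, Bd (pcyl z₀ ρ) s (g i)) (hh : ∀ i, Bd (pcyl z₀ ρ) r (h i)) {C : ℝ≥0∞} (C1 : C ≠ ∞)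
    (hf : ∀ z ∈ pcyl z₀ ρ, ∀ S : ℝ≥0∞, 1 ≤ S → (∀ i, g i z ≤ S ^ (1 / s)) → (∀ i, h i z ≤ S ^ (1 / r)) → f z ≤ C * S ^ (1 / p)) :
    Bd (pcyl z₀ ρ) p f := by
  choose mg M M1 hM using hg
  choose mh N N1 hN using hh
  have C2 : C ^ p ≠ ∞ := ENNReal.rpow_ne_top_of_nonneg p0.le C1
  have vb : volume (Metric.ball z₀.1 ρ) ≠ ∞ := measure_ball_lt_top.ne
  have sM : ∑ i, M i ≠ ∞ := ENNReal.sum_ne_top.2 fun i _ => M1 i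
  have sN : ∑ i, N i ≠ ∞ := ENNReal.sum_ne_top.2 fun i _ => N1 i
  refine ⟨fm, C ^ p * (volume (Metric.ball z₀.1 ρ) + ∑ i, M i + ∑ i, N i), by finiteness, ?_⟩
  filter_upwards [eventually_all.2 hM, eventually_all.2 hN] with t hMt hNt
  have m1 : ∀ i, Measurable fun x : E3 => (pcyl z₀ ρ).indicator (fun z => g i z ^ s) (x, t) := fun i =>
    (((mg i).pow_const s).indicator pcyl_meas).comp measurable_prodMk_right
  have m2 : ∀ i, Measurable fun x : E3 => (pcyl z₀ ρ).indicator (fun z => h i z ^ r) (x, t) := fun i =>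
    (((mh i).pow_const r).indicator pcyl_meas).comp measurable_prodMk_right
  calc _ ≤ ∫⁻ x, C ^ p * ((Metric.ball z₀.1 ρ).indicator 1 x + ∑ i, (pcyl z₀ ρ).indicator (fun z => g i z ^ s) (x, t) +
          ∑ i, (pcyl z₀ ρ).indicator (fun z => h i z ^ r) (x, t)) := by
        refine lintegral_mono fun x => ?_
        by_cases hx : (x, t) ∈ pcyl z₀ ρ
        · simp only [indicator_of_mem hx, indicator_of_mem hx.1, Pi.one_apply]
          refine (ENNReal.rpow_le_rpow (hf _ hx (1 + ∑ i, g i (x, t) ^ s + ∑ i, h i (x, t) ^ r) ?_ (fun i => ?_) fun i => ?_) p0.le).trans (le_of_eq ?_)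
          · rw [add_assoc]; exact le_self_add
          · rw [one_div, ENNReal.le_rpow_inv_iff s0]
            exact (Finset.single_le_sum (f := fun i => g i (x, t) ^ s) (fun _ _ => zero_le) (Finset.mem_univ i)).trans (le_add_self.trans le_self_add)
          · rw [one_div, ENNReal.le_rpow_inv_iff r0]
            exact (Finset.single_le_sum (f := fun i => h i (x, t) ^ r) (fun _ _ => zero_le) (Finset.mem_univ i)).trans le_add_self
          · rw [ENNReal.mul_rpow_of_nonneg _ _ p0.le, ← ENNReal.rpow_mul, one_div_mul_cancel p0.ne', ENNReal.rpow_one]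
        · rw [indicator_of_notMem hx]; exact zero_le
    _ = C ^ p * (volume (Metric.ball z₀.1 ρ) + (∑ i, ∫⁻ x, (pcyl z₀ ρ).indicator (fun z => g i z ^ s) (x, t)) +
          ∑ i, ∫⁻ x, (pcyl z₀ ρ).indicator (fun z => h i z ^ r) (x, t)) := by
        rw [lintegral_const_mul' _ _ C2, lintegral_add_right _ (Finset.measurable_fun_sum Finset.univ fun i _ => m2 i),
          lintegral_add_right _ (Finset.measurable_fun_sum Finset.univ fun i _ => m1 i), lintegral_indicator_one measurableSet_ball,
          lintegral_finsetSum _ fun i _ => m1 i, lintegral_finsetSum _ fun i _ => m2 i]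
    _ ≤ _ := mul_le_mul' le_rfl (add_le_add (add_le_add le_rfl (Finset.sum_le_sum fun i _ => hMt i)) (Finset.sum_le_sum fun i _ => hNt i))
end


section
variable {U : Set (E3 × ℝ)} {v : Fin 3 → E3 × ℝ → ℝ} {W : Fin 3 → Fin 3 → E3 × ℝ → ℝ} {z₀ : E3 × ℝ} {ρ p q r s : ℝ}

lemma W_le (anti : ∀ i j z, W i j z = - W j i z) (i j : Fin 3) (z : E3 × ℝ) : ∃ c, ‖W i j z‖ₑ ≤ ‖W (c + 1) (c + 2) z‖ₑ := by
  by_cases hij : i = j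
  · subst hij
    have : W i i z = 0 := by have := anti i i z; linarith
    exact ⟨0, by rw [this]; simp⟩
  · have : ∃ c : Fin 3, (i = c + 1 ∧ j = c + 2) ∨ (j = c + 1 ∧ i = c + 2) := by revert i j; decide
    obtain ⟨c, ⟨a, b⟩ | ⟨a, b⟩⟩ := this
    · exact ⟨c, by rw [a, b]⟩
    · exact ⟨c, by rw [anti, enorm_neg, a, b]⟩

lemma ofr (x : ℝ) (y : Fin 3 → ℝ) : ENNReal.ofReal (|x| + ∑ b, |y b|) = ‖x‖ₑ + ∑ b, ‖y b‖ₑ := by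
  rw [ENNReal.ofReal_add (abs_nonneg _) (Finset.sum_nonneg fun _ _ => abs_nonneg _), ENNReal.ofReal_sum_of_nonneg fun _ _ => abs_nonneg _]
  simp only [Real.enorm_eq_ofReal_abs]

lemma dens_m {κ : ℝ} {Q : Set (E3 × ℝ)} {u : E3 × ℝ → ℝ} {k : Fin 3 → E3 × ℝ → ℝ} (h : LF κ Q u k) :
    Measurable fun z => ENNReal.ofReal (|u z| + ∑ b, |k b z|) := by
  have := h.mu
  have := h.mkk
  simp_rw [ofr]
  exact h.mu.enorm.add (Finset.measurable_fun_sum Finset.univ fun b _ => (h.mkk b).enorm)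

lemma vpre (h : NSF U v W) (anti : ∀ i j z, W i j z = - W j i z) (hQ : pcyl z₀ ρ ⊆ U) (p0 : 0 < p) (hs : p ≤ s) (hr : p ≤ r)
    (hv : ∀ a, Bd (pcyl z₀ ρ) s fun z => ‖v a z‖ₑ) (hw : ∀ c, Bd (pcyl z₀ ρ) r fun z => ‖W (c + 1) (c + 2) z‖ₑ) (a : Fin 3) :
    Bd (pcyl z₀ ρ) p fun z => ENNReal.ofReal (|v a z| + ∑ b, |W b a z|) := by
  refine Bd.of_le (dens_m (h.lfv hQ a)) p0 (by linarith) (by linarith) hv hw (C := 4) (by finiteness) fun z hz S S1 h1 h2 => ?_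
  have e1 : S ^ (1 / s) ≤ S ^ (1 / p) := ENNReal.rpow_le_rpow_of_exponent_le S1 (by gcongr)
  have e2 : S ^ (1 / r) ≤ S ^ (1 / p) := ENNReal.rpow_le_rpow_of_exponent_le S1 (by gcongr)
  rw [ofr]
  calc _ ≤ S ^ (1 / p) + ∑ b : Fin 3, S ^ (1 / p) := by
        refine add_le_add ((h1 a).trans e1) (Finset.sum_le_sum fun b _ => ?_)
        obtain ⟨c, hc⟩ := W_le anti b a z
        exact hc.trans ((h2 c).trans e2)
    _ = _ := by rw [Fin.sum_univ_three]; ring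

lemma wpre (h : NSF U v W) (anti : ∀ i j z, W i j z = - W j i z) (hQ : pcyl z₀ ρ ⊆ U) (p0 : 0 < p) (s0 : 0 < s) (r0 : 0 < r) (hsr : 1 / s + 1 / r = 1 / p)
    (hv : ∀ a, Bd (pcyl z₀ ρ) s fun z => ‖v a z‖ₑ) (hw : ∀ c, Bd (pcyl z₀ ρ) r fun z => ‖W (c + 1) (c + 2) z‖ₑ) (c : Fin 3) :
    Bd (pcyl z₀ ρ) p fun z => ENNReal.ofReal (|W (c + 1) (c + 2) z| + ∑ b, |kfl v W c b z|) := by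
  refine Bd.of_le (dens_m (h.lfw hQ c)) p0 s0 r0 hv hw (C := 10) (by finiteness) fun z hz S S1 h1 h2 => ?_
  have e2 : S ^ (1 / r) ≤ S ^ (1 / p) := ENNReal.rpow_le_rpow_of_exponent_le S1 (by rw [← hsr]; simpa using s0.le)
  have e3 : S ^ (1 / s) * S ^ (1 / r) = S ^ (1 / p) := by
    rw [← hsr, ENNReal.rpow_add_of_nonneg _ _ (by positivity) (by positivity)]
  have e4 : ∀ i, ‖∑ j, v j z * W j i z‖ₑ ≤ 3 * S ^ (1 / p) := fun i => by
    calc _ ≤ ∑ j, ‖v j z * W j i z‖ₑ := enorm_sum_le _ _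
      _ ≤ ∑ j : Fin 3, S ^ (1 / p) := by
        refine Finset.sum_le_sum fun j _ => ?_
        obtain ⟨c, hc⟩ := W_le anti j i z
        rw [enorm_mul, ← e3]
        exact mul_le_mul' (h1 j) (hc.trans (h2 c))
      _ = _ := by rw [Fin.sum_univ_three]; ring
  rw [ofr]
  calc _ ≤ S ^ (1 / p) + ∑ b : Fin 3, 3 * S ^ (1 / p) := by
        refine add_le_add ((h2 c).trans e2) (Finset.sum_le_sum fun b _ => ?_)
        unfold kfl
        split_ifs
        · exact e4 _
        · rw [enorm_neg]; exact e4 _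
        · simp
    _ = _ := by rw [Fin.sum_univ_three]; ring

lemma vstep (h : NSF U v W) (anti : ∀ i j z, W i j z = - W j i z) (hρ : 0 < ρ) (hQ : pcyl z₀ ρ ⊆ U)
    (hv : ∀ a, Bd (pcyl z₀ ρ) s fun z => ‖v a z‖ₑ) (hw : ∀ c, Bd (pcyl z₀ ρ) r fun z => ‖W (c + 1) (c + 2) z‖ₑ)
    (hp : 5 / 4 ≤ p) (hs : p ≤ s) (hr : p ≤ r) (hq : 0 < q) (hpq : 1 / q + 3 / 10 = 1 / p) (a : Fin 3) :
    Bd (pcyl z₀ (ρ / 2)) q fun z => ‖v a z‖ₑ :=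
  boot le_rfl (h.lfv hQ a) (h.v2 a) (by linarith) (by linarith) (vpre h anti hQ (by linarith) hs hr hv hw a) hp hq hpq

lemma wstep (h : NSF U v W) (anti : ∀ i j z, W i j z = - W j i z) (hρ : 0 < ρ) (hQ : pcyl z₀ ρ ⊆ U)
    (hv : ∀ a, Bd (pcyl z₀ ρ) s fun z => ‖v a z‖ₑ) (hw : ∀ c, Bd (pcyl z₀ ρ) r fun z => ‖W (c + 1) (c + 2) z‖ₑ)
    (hp : 5 / 4 ≤ p) (s0 : 0 < s) (r0 : 0 < r) (hsr : 1 / s + 1 / r = 1 / p) (hq : 0 < q) (hpq : 1 / q + 3 / 10 = 1 / p) (c : Fin 3) :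
    Bd (pcyl z₀ (ρ / 2)) q fun z => ‖W (c + 1) (c + 2) z‖ₑ :=
  boot zero_le_one (h.lfw hQ c) (h.W2 _ _) (by linarith) (by linarith) (wpre h anti hQ (by linarith) s0 r0 hsr hv hw c) hp hq hpq

lemma chain (h : NSF U v W) (anti : ∀ i j z, W i j z = - W j i z) (hρ : 0 < ρ) (hQ : pcyl z₀ ρ ⊆ U)
    (hv : ∀ a, Bd (pcyl z₀ ρ) 2 fun z => ‖v a z‖ₑ) (hw : ∀ c, Bd (pcyl z₀ ρ) 2 fun z => ‖W (c + 1) (c + 2) z‖ₑ) (a : Fin 3) :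
    ∃ C : ℝ≥0∞, C ≠ ∞ ∧ ∀ᵐ z, z ∈ pcyl z₀ (ρ / 2 / 2 / 2 / 2 / 2) → ‖v a z‖ₑ ≤ C := by
  have m1 : ∀ {R : ℝ}, 0 < R → pcyl z₀ (R / 2) ⊆ pcyl z₀ R := fun hR => pcyl_mono (by linarith) (by linarith)
  have r1 : 0 < ρ / 2 := by linarith
  have r2 : 0 < ρ / 2 / 2 := by linarith
  have r3 : 0 < ρ / 2 / 2 / 2 := by linarith
  have r4 : 0 < ρ / 2 / 2 / 2 / 2 := by linarith
  have Q1 := (m1 hρ).trans hQ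
  have Q2 := (m1 r1).trans Q1
  have Q3 := (m1 r2).trans Q2
  have Q4 := (m1 r3).trans Q3
  have v1 := vstep (p := 2) (q := 5) h anti hρ hQ hv hw (by norm_num) (by norm_num) (by norm_num) (by norm_num) (by norm_num)
  have w2 := wstep (p := 10 / 7) (q := 5 / 2) h anti r1 Q1 v1 (fun c => (hw c).mono (m1 hρ)) (by norm_num) (by norm_num) (by norm_num) (by norm_num) (by norm_num) (by norm_num)
  have v3 := vstep (p := 5 / 2) (q := 10) h anti r2 Q2 (fun c => (v1 c).mono (m1 r1)) w2 (by norm_num) (by norm_num) (by norm_num) (by norm_num) (by norm_num)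
  have w4 := wstep (p := 2) (q := 5) h anti r3 Q3 v3 (fun c => (w2 c).mono (m1 r2)) (by norm_num) (by norm_num) (by norm_num) (by norm_num) (by norm_num) (by norm_num)
  obtain ⟨C, C1, A, -, hA⟩ := boot0 (iq := 0) (p := 10 / 3) le_rfl (h.lfv Q4 a) (h.v2 a) (half_pos r4) (half_lt_self r4)
    (vpre h anti Q4 (by norm_num) (by norm_num) (by norm_num) (fun c => (v3 c).mono (m1 r3)) w4 a) (by norm_num) le_rfl (by norm_num)
  exact ⟨C, C1, by simpa using hA⟩
end

section
variable {Ω : Set E3} {T : ℝ} {v : E3 × ℝ → E3} {Dv : E3 × ℝ → Fin 3 → Fin 3 → ℝ}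
  {p : E3 × ℝ → ℝ} {v₀ : E3 → E3} {z₀ : E3 × ℝ} {ρ : ℝ}

lemma v_bd (hΩ : IsOpen Ω) (hsol : IsSuitableWeakSolution Ω T v Dv p v₀) (hQ : pcyl z₀ ρ ⊆ Ω ×ˢ Ioo 0 T) (a : Fin 3) :
    Bd (pcyl z₀ ρ) 2 fun z => ‖Vx Ω T v a z‖ₑ := by
  have h := hsol.v_linf_l2
  unfold MemMixed mixedNorm at h
  rw [if_pos rfl] at h
  set K := essSup (fun t => eLpNorm (fun x => v (x, t)) 2 (volume.restrict Ω)) (volume.restrict (Ioo 0 T)) with hK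
  refine ⟨((flow hΩ hsol).mv a).enorm, K ^ (2 : ℝ), by finiteness, ?_⟩
  have h1 : ∀ᵐ t ∂(volume.restrict (Ioo 0 T)), eLpNorm (fun x => v (x, t)) 2 (volume.restrict Ω) ≤ K := ENNReal.ae_le_essSup _
  filter_upwards [(ae_restrict_iff' measurableSet_Ioo).1 h1] with t ht
  by_cases hT : t ∈ Ioo 0 T
  · have h2 := eLpNorm_nnreal_pow_eq_lintegral (f := fun x => v (x, t)) (μ := volume.restrict Ω) (p := 2) (by norm_num)
    refine le_trans ?_ ((le_of_eq h2.symm).trans (ENNReal.rpow_le_rpow (ht hT) (by norm_num)))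
    rw [← lintegral_indicator hΩ.measurableSet]
    refine lintegral_mono fun x => ?_
    by_cases hx : (x, t) ∈ pcyl z₀ ρ
    · rw [indicator_of_mem hx, indicator_of_mem (hQ hx).1]
      unfold Vx
      rw [indicator_of_mem (hQ hx)]
      refine ENNReal.rpow_le_rpow ?_ (by norm_num)
      rw [enorm_le_iff_norm_le]
      exact coord_le _ _
    · rw [indicator_of_notMem hx]; exact zero_le
  · have : ∀ x, (pcyl z₀ ρ).indicator (fun z => ‖Vx Ω T v a z‖ₑ ^ (2 : ℝ)) (x, t) = 0 := fun x => indicator_of_notMem (fun h => hT (hQ h).2) _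
    exact (lintegral_eq_zero_of_ae_eq_zero (Eventually.of_forall this)).trans_le zero_le

theorem reg_main (hΩ : IsOpen Ω) (hsol : IsSuitableWeakSolution Ω T v Dv p v₀) {r : ℝ} (hr : 0 < r) (hQ : pcyl z₀ r ⊆ Ω ×ˢ Ioo 0 T)
    {γ α : ℝ≥0∞} (hγ : 3 < γ) (hα₁ : 2 ≤ α) (hα₂ : α ≠ ∞) (hexp : 3 / γ + 2 / α ≤ 1)
    (hf : MemMixed (fun z => cross3 (v z) (unitd (curlOf Dv z))) (Metric.ball z₀.1 r) (z₀.2 - r ^ 2) z₀.2 γ α) :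
    RegularPoint Ω T v z₀ := by
  have fl := flow hΩ hsol
  have mD : ∀ i j, Measurable fun z => Dv z i j := fun i j => (measurable_pi_apply j).comp ((measurable_pi_apply i).comp hsol.meas_Dv)
  have mg : Measurable fun z => cross3 (v z) (unitd (curlOf Dv z)) :=
    cross3_m hsol.meas_v (unitd_m (vec3_m ((mD _ _).sub (mD _ _)) ((mD _ _).sub (mD _ _)) ((mD _ _).sub (mD _ _))))
  obtain ⟨ρ, ρ0, ρr, hm⟩ := mlt_exists (ε := 1 / 100) hr mg hγ hα₁ hα₂ hexp hf (by norm_num)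
  have hQρ : pcyl z₀ ρ ⊆ Ω ×ˢ Ioo 0 T := (pcyl_mono ρ0 ρr).trans hQ
  set W : Fin 3 → Fin 3 → E3 × ℝ → ℝ := fun i j z => Dx Ω T Dv i j z - Dx Ω T Dv j i z with hW
  have anti : ∀ i j z, W i j z = - W j i z := fun i j z => by simp only [hW]; ring
  have ge : ∀ z ∈ pcyl z₀ ρ, gvec (Vx Ω T v) W z = cross3 (v z) (unitd (curlOf Dv z)) := fun z hz => by
    have e1 : ∀ j, Vx Ω T v j z = v z j := fun j => indicator_of_mem (hQρ hz) _
    have e2 : ∀ i j, Dx Ω T Dv i j z = Dv z i j := fun i j => indicator_of_mem (hQρ hz) _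
    unfold gvec wvec vvec curlOf
    simp only [hW, e1, e2]
    rfl
  have hm' : Mlt (pcyl z₀ ρ) (fun z => ‖gvec (Vx Ω T v) W z‖) (1 / 100) := fun F hF M hM hE => by
    have e : ((pcyl z₀ ρ).indicator fun z => ‖gvec (Vx Ω T v) W z‖ * Sop 1 F z) =
        (pcyl z₀ ρ).indicator fun z => ‖cross3 (v z) (unitd (curlOf Dv z))‖ * Sop 1 F z :=
      indicator_congr fun z hz => by rw [ge z hz]
    rw [e]; exact hm F hF M hM hE
  have ρ1 : 0 < ρ / 2 := half_pos ρ0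
  have ρ2 : ρ / 2 < ρ := half_lt_self ρ0
  obtain ⟨η, hη⟩ := cutoff z₀ ρ1 ρ2
  obtain ⟨C, hC⟩ := (fl.vs anti hQρ).ctr hη hm'
  have hQ2 := (pcyl_mono ρ1 ρ2).trans hQρ
  have wb : ∀ c, Bd (pcyl z₀ (ρ / 2)) 2 fun z => ‖W (c + 1) (c + 2) z‖ₑ := fun c => by
    have hl := hC.linf (fun c => (hη.tst.cont.measurable.mul (fl.mW _ _)).indicator pcyl_meas)
      (fun c z hz => indicator_of_notMem (fun h => absurd h.2.2 (not_lt.2 hz)) _) c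
    refine ⟨(fl.mW _ _).enorm, ENNReal.ofReal ((8 * (C + 1)) ^ 2), ofReal_ne_top, ?_⟩
    filter_upwards [hl] with t ht
    refine le_trans (lintegral_mono fun x => ?_) ht
    by_cases hx : (x, t) ∈ pcyl z₀ (ρ / 2)
    · rw [indicator_of_mem hx, indicator_of_mem (pcyl_mono ρ1 ρ2 hx), hη.one _ hx, one_mul, ENNReal.rpow_ofNat]
    · rw [indicator_of_notMem hx]; exact zero_le
  have fin := chain fl anti ρ1 hQ2 (v_bd hΩ hsol hQ2) wb
  choose D D1 hD using fin
  set R := ρ / 2 / 2 / 2 / 2 / 2 / 2 with hR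
  have R0 : 0 < R := by positivity
  have sub : pcyl z₀ R ⊆ Ω ×ˢ Ioo 0 T := (pcyl_mono R0 (by rw [hR]; linarith)).trans hQ2
  refine ⟨R, R0, sub, ∑ j, (D j).toReal, ?_⟩
  rw [ae_restrict_iff' pcyl_meas]
  filter_upwards [eventually_all.2 hD] with z hz hzR
  have c1 : ∀ j, |v z j| ≤ (D j).toReal := fun j => by
    have := hz j hzR
    unfold Vx at this
    rw [indicator_of_mem (sub hzR), Real.enorm_eq_ofReal_abs] at this
    exact (ENNReal.ofReal_le_iff_le_toReal (D1 j)).1 this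
  refine le_trans ?_ (Finset.sum_le_sum fun j _ => c1 j)
  rw [EuclideanSpace.norm_eq, Real.sqrt_le_left (Finset.sum_nonneg fun _ _ => abs_nonneg _)]
  simp only [Fin.sum_univ_three, Real.norm_eq_abs]
  have a0 := abs_nonneg (v z 0)
  have a1 := abs_nonneg (v z 1)
  have a2 := abs_nonneg (v z 2)
  nlinarith [mul_nonneg a0 a1, mul_nonneg a0 a2, mul_nonneg a1 a2]
end


/-- **Theorem 1.1 (ii)**: if `(v,p)` is a suitable weak solution of the
Navier–Stokes equations in `Q_T = Ω × (0,T)`, `z₀ ∈ Q_T`, the closure of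
`Q_{z₀,r}` is contained in `Q_T`, and
`v × (ω/|ω|) ∈ L^{γ,α}_{x,t}(Q_{z₀,r})` for some exponents `γ ∈ (3,∞]`,
`α ∈ [2,∞)` satisfying `3/γ + 2/α ≤ 1`, where `ω = curl v`, then `z₀` is a
regular point of `v`. -/
theorem velocity_cross_vorticity_direction_serrin_implies_regular
    (Ω : Set E3) (T : ℝ) (v : E3 × ℝ → E3) (Dv : E3 × ℝ → Fin 3 → Fin 3 → ℝ)
    (p : E3 × ℝ → ℝ) (v₀ : E3 → E3) (z₀ : E3 × ℝ) (r : ℝ)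
    (hΩ : IsOpen Ω) (hT : 0 < T)
    (hsol : IsSuitableWeakSolution Ω T v Dv p v₀)
    (hz₀ : z₀ ∈ Ω ×ˢ Ioo 0 T) (hr : 0 < r)
    (hQ : closure (pcyl z₀ r) ⊆ Ω ×ˢ Ioo 0 T)
    (γ α : ℝ≥0∞) (hγ : 3 < γ) (hα₁ : 2 ≤ α) (hα₂ : α ≠ ∞)
    (hexp : 3 / γ + 2 / α ≤ 1)
    (hf : MemMixed (fun z => cross3 (v z) (unitd (curlOf Dv z)))
      (Metric.ball z₀.1 r) (z₀.2 - r ^ 2) z₀.2 γ α) :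
    RegularPoint Ω T v z₀ := by
  exact reg_main hΩ hsol hr (subset_closure.trans hQ) hγ hα₁ hα₂ hexp hf

end
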